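/- arXiv:0908.3159 — 2 statements merged into one kernel-verified Lean document; each statement's English description precedes it below -/
import Mathlib

section
/- For every p ≥ 3, the prism W_{p,1} × I over the wedge product W_{p,1} = C_p ⋈ Δ_1 admits a realization such that the prism Σ_{p,4} × I over the surface survives the projection to R^4 (all its faces are preserved and lie on the lower hull); furthermore, the polytope dual to the projected 4-polytope contains the dual surface Σ_{p,4}* as a subcomplex of its 2-skeleton, so that via a Schlegel diagram the dual surface Σ_{p,4}* (an equivelar surface of type {4,p}) is realized as an embedded polyhedral surface in R^3. -/
open Matrix Set

noncomputable section

def setDim {V : Type*} [AddCommGroup V] [Module ℝ V] (s : Set V) : ℕ :=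
  Module.finrank ℝ (affineSpan ℝ s).direction

def IsFaceOf {V : Type*} [AddCommGroup V] [Module ℝ V] (F P : Set V) : Prop :=
  F ⊆ P ∧ ∃ (c : V →ₗ[ℝ] ℝ) (b : ℝ), (∀ x ∈ P, c x ≤ b) ∧ F = {x ∈ P | c x = b}

def IsVertexOf {V : Type*} [AddCommGroup V] [Module ℝ V] (v : V) (P : Set V) : Prop :=
  IsFaceOf {v} P

def IsFacetOf {V : Type*} [AddCommGroup V] [Module ℝ V] (F P : Set V) : Prop :=
  IsFaceOf F P ∧ F.Nonempty ∧ setDim F + 1 = setDim P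

/-- Encoding vectors of the vertices of `Σ_{p,4}`. -/
def IsVertVec (p q : ℕ) (H : ZMod p → Set (ZMod q)) : Prop :=
  ∃ k : ZMod p, H k = Set.univ ∧ H (k + 1) = Set.univ ∧
    ∀ i, i ≠ k → i ≠ k + 1 → ∃ j : ZMod q, H i = {j}ᶜ

/-- Encoding vectors of the edges of `Σ_{p,4}`. -/
def IsEdgeVec (p q : ℕ) (H : ZMod p → Set (ZMod q)) : Prop :=
  ∃ k : ZMod p, H k = Set.univ ∧ ∀ i, i ≠ k → ∃ j : ZMod q, H i = {j}ᶜ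

/-- Encoding vectors of the `p`-gon faces of `Σ_{p,4}`. -/
def IsPgonVec (p q : ℕ) [NeZero p] (H : ZMod p → Set (ZMod q)) : Prop :=
  ∃ jv : ZMod p → ZMod q, ((∑ i, jv i) = 0 ∨ (∑ i, jv i) = 1) ∧ ∀ i, H i = {jv i}ᶜ

/-- The face poset of the surface `Σ_{p,2q}` in terms of encoding vectors. -/
def sigmaFaces (p q : ℕ) [NeZero p] : Set (ZMod p → Set (ZMod q)) :=
  {H | IsVertVec p q H ∨ IsEdgeVec p q H ∨ IsPgonVec p q H}

/-- Face inclusion in terms of the encoding vectors. -/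
def faceIncl {p q : ℕ} (H H' : ZMod p → Set (ZMod q)) : Prop :=
  ∀ i, H' i ⊆ H i

section Polyhedra

variable {ι V V' : Type*} [AddCommGroup V] [Module ℝ V] [AddCommGroup V'] [Module ℝ V']

/-- The polyhedron of all solutions of the inequalities `n f x ≤ r f`. -/
def polyhedron (n : ι → V →ₗ[ℝ] ℝ) (r : ι → ℝ) : Set V :=
  {x | ∀ f, n f x ≤ r f}

/-- The indices of the inequalities that are tight at `x`. -/
def tightSet (n : ι → V →ₗ[ℝ] ℝ) (r : ι → ℝ) (x : V) : Set ι :=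
  {f | n f x = r f}

/-- The face of a polyhedron on which all inequalities from `T` are tight. -/
def tightFace (n : ι → V →ₗ[ℝ] ℝ) (r : ι → ℝ) (T : Set ι) : Set V :=
  {x ∈ polyhedron n r | T ⊆ tightSet n r x}

/-- The inequalities that are tight on the whole set `F`. -/
def commonTight (n : ι → V →ₗ[ℝ] ℝ) (r : ι → ℝ) (F : Set V) : Set ι :=
  {f | ∀ x ∈ F, n f x = r f}

variable {n : ι → V →ₗ[ℝ] ℝ} {r : ι → ℝ} {n' : ι → V' →ₗ[ℝ] ℝ} {r' : ι → ℝ}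

theorem IsFaceOf.convex {F P : Set V} (hF : IsFaceOf F P) (hP : Convex ℝ P) : Convex ℝ F := by
  obtain ⟨-, c, b, -, rfl⟩ := hF
  exact hP.inter (convex_hyperplane c.isLinear b)

theorem isFaceOf_empty (P : Set V) : IsFaceOf ∅ P :=
  ⟨empty_subset _, 0, 1, by simp, by simp⟩

theorem convex_polyhedron (n : ι → V →ₗ[ℝ] ℝ) (r : ι → ℝ) : Convex ℝ (polyhedron n r) := by
  have : polyhedron n r = ⋂ f, {x | n f x ≤ r f} := by
    ext x; simp [polyhedron]
  rw [this]
  exact convex_iInter fun f => convex_halfSpace_le (n f).isLinear _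

theorem tightSet_midpoint {x y : V} (hx : x ∈ polyhedron n r) (hy : y ∈ polyhedron n r) :
    tightSet n r ((1 / 2 : ℝ) • x + (1 / 2 : ℝ) • y) = tightSet n r x ∩ tightSet n r y := by
  ext f
  have h1 := hx f
  have h2 := hy f
  simp only [tightSet, mem_ofPred_eq, map_add, map_smul, smul_eq_mul, mem_inter_iff]
  constructor
  · intro h; constructor <;> linarith
  · rintro ⟨h, h'⟩; linarith

theorem exists_tightSet_eq_commonTight [Finite ι] {F : Set V} (hF : F ⊆ polyhedron n r)
    (hc : Convex ℝ F) (hne : F.Nonempty) :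
    ∃ x ∈ F, tightSet n r x = commonTight n r F := by
  obtain ⟨x, hx, hmin⟩ := (measure fun x : V => (tightSet n r x).ncard).wf.has_min F hne
  refine ⟨x, hx, subset_antisymm (fun f hf y hy => ?_) fun f hf => hf x hx⟩
  by_contra hfy
  have hm : (1 / 2 : ℝ) • x + (1 / 2 : ℝ) • y ∈ F :=
    hc hx hy (by norm_num) (by norm_num) (by norm_num)
  refine hmin _ hm ?_
  change (tightSet n r _).ncard < (tightSet n r x).ncard
  rw [tightSet_midpoint (hF hx) (hF hy)]
  exact ncard_lt_ncard ⟨inter_subset_left, fun h => hfy (h hf).2⟩ (toFinite _)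

/-- A linear functional attaining its maximum at `x` also attains it at every point at which
all inequalities tight at `x` are tight. -/
theorem eq_of_tightSet_subset [Finite ι] {x y : V} (hx : x ∈ polyhedron n r)
    (hy : y ∈ polyhedron n r) (hxy : tightSet n r x ⊆ tightSet n r y) {c : V →ₗ[ℝ] ℝ} {b : ℝ}
    (hc : ∀ z ∈ polyhedron n r, c z ≤ b) (hcx : c x = b) : c y = b := by
  have key : ∃ s : ℝ, 0 < s ∧ ∀ f, n f (x + s • (x - y)) ≤ r f := by
    have : ∀ᶠ s : ℝ in nhdsWithin 0 (Ioi 0), ∀ f, n f (x + s • (x - y)) ≤ r f := by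
      rw [Filter.eventually_all]
      intro f
      by_cases hf : f ∈ tightSet n r x
      · have h1 : n f x = r f := hf
        have h2 : n f y = r f := hxy hf
        exact Filter.Eventually.of_forall fun s => by simp [h1, h2]
      · have h1 : n f x < r f := lt_of_le_of_ne (hx f) hf
        have hcont : Continuous fun s : ℝ => n f x + s * (n f x - n f y) := by fun_prop
        have : ∀ᶠ s : ℝ in nhds 0, n f x + s * (n f x - n f y) < r f :=
          hcont.continuousAt.eventually_lt continuousAt_const (by simpa using h1)
        filter_upwards [nhdsWithin_le_nhds this] with s hs
        simpa using hs.le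
    obtain ⟨s, hs, hs0⟩ := (this.and self_mem_nhdsWithin).exists
    exact ⟨s, hs0, hs⟩
  obtain ⟨s, hs, h⟩ := key
  have h1 := hc _ h
  have h2 := hc y hy
  simp only [map_add, map_smul, map_sub, smul_eq_mul, hcx] at h1
  have h3 : 0 ≤ s * (c y - b) := by linarith
  have := nonneg_of_mul_nonneg_right h3 hs
  linarith

theorem isFaceOf_tightFace [Finite ι] (T : Set ι) :
    IsFaceOf (tightFace n r T) (polyhedron n r) := by
  have := Fintype.ofFinite T
  refine ⟨fun x hx => hx.1, ∑ f : T, n f, ∑ f : T, r f, fun x hx => ?_, ?_⟩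
  · rw [LinearMap.sum_apply]
    exact Finset.sum_le_sum fun f _ => hx f
  · ext x
    refine and_congr_right fun hx => ?_
    have h := Finset.sum_eq_sum_iff_of_le (s := Finset.univ) fun (f : T) _ => hx f.1
    rw [LinearMap.sum_apply, h]
    simp [subset_def, tightSet]

theorem commonTight_tightFace {x : V} (hx : x ∈ polyhedron n r) :
    commonTight n r (tightFace n r (tightSet n r x)) = tightSet n r x :=
  subset_antisymm (fun _ hf => hf x ⟨hx, subset_rfl⟩) fun _ hf _ hy => hy.2 hf

/-- A nonempty face is the face determined by the inequalities tight at one of its points. -/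
theorem IsFaceOf.exists_eq_tightFace [Finite ι] {F : Set V} (hF : IsFaceOf F (polyhedron n r))
    (hne : F.Nonempty) :
    ∃ x ∈ polyhedron n r, F = tightFace n r (tightSet n r x) := by
  obtain ⟨x, hx, hT⟩ := exists_tightSet_eq_commonTight hF.1 (hF.convex (convex_polyhedron n r)) hne
  refine ⟨x, hF.1 hx, subset_antisymm ?_ ?_⟩
  · intro y hy
    refine ⟨hF.1 hy, ?_⟩
    rw [hT]
    exact fun f hf => hf y hy
  · intro y hy
    obtain ⟨hFP, c, b, hc, hFe⟩ := hF
    rw [hFe] at hx ⊢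
    exact ⟨hy.1, eq_of_tightSet_subset hx.1 hy.1 hy.2 hc hx.2⟩

theorem tightFace_univ (h : univ ∉ tightSet n r '' polyhedron n r) :
    tightFace n r univ = ∅ := by
  by_contra! hne
  obtain ⟨x, hx, hT⟩ := hne
  exact h ⟨x, hx, univ_subset_iff.1 hT⟩

theorem tightFace_commonTight_commonTight [Finite ι]
    (h : tightSet n r '' polyhedron n r = tightSet n' r' '' polyhedron n' r')
    (hu : univ ∉ tightSet n r '' polyhedron n r) {F : Set V} (hF : IsFaceOf F (polyhedron n r)) :
    tightFace n r (commonTight n' r' (tightFace n' r' (commonTight n r F))) = F := by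
  rcases F.eq_empty_or_nonempty with rfl | hne
  · have h1 : commonTight n r (∅ : Set V) = univ := by simp [commonTight]
    have h2 : commonTight n' r' (∅ : Set V') = univ := by simp [commonTight]
    rw [h1, tightFace_univ (h ▸ hu), h2, tightFace_univ hu]
  · obtain ⟨x, hx, rfl⟩ := hF.exists_eq_tightFace hne
    obtain ⟨x', hx', hT⟩ : tightSet n r x ∈ tightSet n' r' '' polyhedron n' r' :=
      h ▸ mem_image_of_mem _ hx
    rw [commonTight_tightFace hx, ← hT, commonTight_tightFace hx']

/-- Two polyhedra given by the same tight sets have isomorphic face lattices. -/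
def faceIso [Finite ι]
    (h : tightSet n r '' polyhedron n r = tightSet n' r' '' polyhedron n' r')
    (hu : univ ∉ tightSet n r '' polyhedron n r) :
    {F // IsFaceOf F (polyhedron n r)} ≃o {F // IsFaceOf F (polyhedron n' r')} where
  toFun F := ⟨tightFace n' r' (commonTight n r F.1), isFaceOf_tightFace _⟩
  invFun F := ⟨tightFace n r (commonTight n' r' F.1), isFaceOf_tightFace _⟩
  left_inv F := Subtype.ext (tightFace_commonTight_commonTight h hu F.2)
  right_inv F := Subtype.ext (tightFace_commonTight_commonTight h.symm (h ▸ hu) F.2)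
  map_rel_iff' {F F'} := by
    have mono : ∀ {E E' : Set V}, E ⊆ E' →
        tightFace n' r' (commonTight n r E) ⊆ tightFace n' r' (commonTight n r E') :=
      fun hE x hx => ⟨hx.1, fun f hf => hx.2 fun y hy => hf y (hE hy)⟩
    have mono' : ∀ {E E' : Set V'}, E ⊆ E' →
        tightFace n r (commonTight n' r' E) ⊆ tightFace n r (commonTight n' r' E') :=
      fun hE x hx => ⟨hx.1, fun f hf => hx.2 fun y hy => hf y (hE hy)⟩
    refine ⟨fun hle => ?_, fun hle => mono hle⟩
    have := mono' hle
    simp only [Equiv.coe_fn_mk] at this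
    rwa [tightFace_commonTight_commonTight h hu F.2,
      tightFace_commonTight_commonTight h hu F'.2] at this

theorem isFaceOf_image {L : V →ₗ[ℝ] V'} {D : Submodule ℝ V} (hL : ∀ d ∈ D, L d = 0 → d = 0)
    {F X : Set V} (hD : ∀ x ∈ F, ∀ y ∈ F, y - x ∈ D) (hX : IsFaceOf X F) :
    IsFaceOf (L '' X) (L '' F) := by
  rcases F.eq_empty_or_nonempty with rfl | ⟨x₀, hx₀⟩
  · rw [subset_empty_iff.1 hX.1, image_empty]
    exact isFaceOf_empty _
  obtain ⟨hXF, c, b, hc, hXe⟩ := hX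
  obtain ⟨ρ, hρ⟩ := (L.domRestrict D).exists_leftInverse_of_injective
    (LinearMap.ker_eq_bot'.2 fun d hd => Subtype.ext (hL d d.2 hd))
  let c' : V' →ₗ[ℝ] ℝ := c ∘ₗ D.subtype ∘ₗ ρ
  have hval : ∀ y ∈ F, c' (L y) = c' (L x₀) + (c y - c x₀) := by
    intro y hy
    have h1 : ρ (L (y - x₀)) = ⟨y - x₀, hD x₀ hx₀ y hy⟩ := by
      simpa using LinearMap.congr_fun hρ ⟨y - x₀, hD x₀ hx₀ y hy⟩
    have h2 : c' (L (y - x₀)) = c (y - x₀) := by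
      simp only [c', LinearMap.comp_apply, h1, Submodule.subtype_apply]
    rw [map_sub, map_sub, map_sub] at h2
    linarith
  refine ⟨image_mono hXF, c', c' (L x₀) + (b - c x₀), ?_, ?_⟩
  · rintro _ ⟨y, hy, rfl⟩
    have := hc y hy
    rw [hval y hy]; linarith
  · ext w
    constructor
    · rintro ⟨y, hy, rfl⟩
      refine ⟨⟨y, hXF hy, rfl⟩, ?_⟩
      rw [hXe] at hy
      rw [hval y hy.1, hy.2]
    · rintro ⟨⟨y, hy, rfl⟩, hw⟩
      refine ⟨y, ?_, rfl⟩
      rw [hXe]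
      rw [hval y hy] at hw
      exact ⟨hy, by linarith⟩

/-- A linear map that is injective on a set in the affine sense preserves its face lattice. -/
theorem nonempty_faceIso_image {L : V →ₗ[ℝ] V'} {D : Submodule ℝ V}
    (hL : ∀ d ∈ D, L d = 0 → d = 0) {F : Set V} (hD : ∀ x ∈ F, ∀ y ∈ F, y - x ∈ D) :
    Nonempty ({X // IsFaceOf X F} ≃o {X // IsFaceOf X (L '' F)}) := by
  have hinj : InjOn L F := fun x hx y hy hxy =>
    (sub_eq_zero.1 (hL _ (hD x hx y hy) (by rw [map_sub, hxy, sub_self]))).symm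
  refine ⟨⟨⟨fun X => ⟨L '' X.1, isFaceOf_image hL hD X.2⟩,
    fun Y => ⟨F ∩ L ⁻¹' Y.1, ?_⟩, fun X => Subtype.ext ?_, fun Y => Subtype.ext ?_⟩, ?_⟩⟩
  · obtain ⟨hY, c, b, hc, hYe⟩ := Y.2
    refine ⟨inter_subset_left, c ∘ₗ L, b, fun x hx => hc _ ⟨x, hx, rfl⟩, ?_⟩
    ext x
    rw [hYe]
    simp only [mem_inter_iff, mem_preimage, mem_ofPred_eq, LinearMap.comp_apply]
    exact ⟨fun h => ⟨h.1, h.2.2⟩, fun h => ⟨h.1, ⟨x, h.1, rfl⟩, h.2⟩⟩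
  · ext x
    constructor
    · rintro ⟨hx, y, hy, hxy⟩
      rwa [← hinj (X.2.1 hy) hx hxy]
    · exact fun hx => ⟨X.2.1 hx, x, hx, rfl⟩
  · ext w
    constructor
    · rintro ⟨x, hx, rfl⟩
      exact hx.2
    · intro hw
      obtain ⟨x, hx, rfl⟩ := Y.2.1 hw
      exact ⟨x, ⟨hx, hw⟩, rfl⟩
  · intro X X'
    exact hinj.image_subset_image_iff X.2.1 X'.2.1

end Polyhedra

section Polygons

/-- Homogeneous coordinates of a point of the plane. -/
def homog (x : Fin 2 → ℝ) : Fin 3 → ℝ :=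
  ![1, x 0, x 1]

/-- The zero sets of the edges, the vertices and the polygon itself for a cyclically labelled
`p`-gon. -/
def polygonZeroSets (p : ℕ) : Set (Set (ZMod p)) :=
  {Z | Z = ∅ ∨ ∃ k, Z = {k} ∨ Z = {k, k + 1}}

theorem dotProduct_homog (c : Fin 3 → ℝ) (x : Fin 2 → ℝ) :
    c ⬝ᵥ homog x = c 0 + c 1 * x 0 + c 2 * x 1 := by
  simp [homog, dotProduct, Fin.sum_univ_three]

theorem dotProduct_homog_combo (c : Fin 3 → ℝ) (x y : Fin 2 → ℝ) (s : ℝ) :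
    c ⬝ᵥ homog ((1 - s) • x + s • y) = (1 - s) * (c ⬝ᵥ homog x) + s * (c ⬝ᵥ homog y) := by
  simp only [dotProduct_homog, Pi.add_apply, Pi.smul_apply, smul_eq_mul]
  ring

theorem exists_combo_of_dotProduct_homog_eq_zero {c : Fin 3 → ℝ} {v w x q : Fin 2 → ℝ}
    (hv : c ⬝ᵥ homog v = 0) (hw : c ⬝ᵥ homog w = 0) (hx : c ⬝ᵥ homog x = 0)
    (hq : c ⬝ᵥ homog q ≠ 0) (hvw : v ≠ w) : ∃ s : ℝ, x = (1 - s) • v + s • w := by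
  simp only [dotProduct_homog] at hv hw hx hq
  set d0 := w 0 - v 0 with hd0
  set d1 := w 1 - v 1 with hd1
  have hd : d0 ^ 2 + d1 ^ 2 ≠ 0 := by
    intro h
    have h0 : d0 = 0 := by nlinarith [sq_nonneg d0, sq_nonneg d1]
    have h1 : d1 = 0 := by nlinarith [sq_nonneg d0, sq_nonneg d1]
    refine hvw (funext fun i => ?_)
    fin_cases i
    · simp; linarith
    · simp; linarith
  have hcd : c 1 * d0 + c 2 * d1 = 0 := by rw [hd0, hd1]; linarith
  have hce : c 1 * (x 0 - v 0) + c 2 * (x 1 - v 1) = 0 := by linarith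
  have hdet : (x 0 - v 0) * d1 - (x 1 - v 1) * d0 = 0 := by
    by_contra hne
    have h1 : c 1 * ((x 0 - v 0) * d1 - (x 1 - v 1) * d0) = 0 := by
      linear_combination d1 * hce - (x 1 - v 1) * hcd
    have h2 : c 2 * ((x 0 - v 0) * d1 - (x 1 - v 1) * d0) = 0 := by
      linear_combination (x 0 - v 0) * hcd - d0 * hce
    have h3 := (mul_eq_zero.1 h1).resolve_right hne
    have h4 := (mul_eq_zero.1 h2).resolve_right hne
    rw [h3, h4] at hv hq
    apply hq
    linarith
  refine ⟨((x 0 - v 0) * d0 + (x 1 - v 1) * d1) / (d0 ^ 2 + d1 ^ 2), funext fun i => ?_⟩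
  set s := ((x 0 - v 0) * d0 + (x 1 - v 1) * d1) / (d0 ^ 2 + d1 ^ 2) with hs
  have hs' : s * (d0 ^ 2 + d1 ^ 2) = (x 0 - v 0) * d0 + (x 1 - v 1) * d1 := by
    rw [hs]; field_simp
  fin_cases i
  · simp only [Fin.zero_eta, Pi.add_apply, Pi.smul_apply, smul_eq_mul]
    have : (x 0 - v 0 - s * d0) * (d0 ^ 2 + d1 ^ 2) = 0 := by
      linear_combination (-d0) * hs' + d1 * hdet
    have := (mul_eq_zero.1 this).resolve_right hd
    rw [hd0] at this
    linarith
  · simp only [Fin.mk_one, Pi.add_apply, Pi.smul_apply, smul_eq_mul]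
    have : (x 1 - v 1 - s * d1) * (d0 ^ 2 + d1 ^ 2) = 0 := by
      linear_combination (-d1) * hs' - d0 * hdet
    have := (mul_eq_zero.1 this).resolve_right hd
    rw [hd1] at this
    linarith

theorem zmod_natCast_ne_zero {p m : ℕ} (h0 : 0 < m) (hm : m < p) : (m : ZMod p) ≠ 0 := by
  rw [Ne, ZMod.natCast_eq_zero_iff]
  exact Nat.not_dvd_of_pos_of_lt h0 hm

/-- A system of linear inequalities in the plane having solutions at which exactly two cyclically
consecutive ones are tight describes a cyclically labelled polygon. -/
theorem zeroSets_eq_polygonZeroSets {p : ℕ} (hp : 3 ≤ p) {c : ZMod p → Fin 3 → ℝ}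
    (hc : ∀ k, ∃ x, ∀ i, 0 ≤ c i ⬝ᵥ homog x ∧ (c i ⬝ᵥ homog x = 0 ↔ i = k ∨ i = k + 1)) :
    {Z | ∃ x, (∀ i, 0 ≤ c i ⬝ᵥ homog x) ∧ {i | c i ⬝ᵥ homog x = 0} = Z} =
      polygonZeroSets p := by
  have h1 : (1 : ZMod p) ≠ 0 := by
    simpa using zmod_natCast_ne_zero (p := p) (m := 1) (by omega) (by omega)
  have h2 : (2 : ZMod p) ≠ 0 := by
    simpa using zmod_natCast_ne_zero (p := p) (m := 2) (by omega) (by omega)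
  choose v hv using hc
  have hpos : ∀ k i, i ≠ k → i ≠ k + 1 → 0 < c i ⬝ᵥ homog (v k) := fun k i hik hik' =>
    lt_of_le_of_ne (hv k i).1 fun h => by
      rcases (hv k i).2.1 h.symm with h | h <;> contradiction
  have hzero : ∀ k, c k ⬝ᵥ homog (v k) = 0 := fun k => (hv k k).2.2 (Or.inl rfl)
  have hzero' : ∀ k, c (k + 1) ⬝ᵥ homog (v k) = 0 := fun k => (hv k (k + 1)).2.2 (Or.inr rfl)
  have ne1 : ∀ k : ZMod p, k ≠ k + 1 := fun k h => h1 (by linear_combination -h)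
  have ne2 : ∀ k : ZMod p, k ≠ k + 1 + 1 := fun k h => h2 (by linear_combination -h)
  have combo_pos : ∀ k (s : ℝ), 0 < s → s < 1 → ∀ i,
      0 ≤ c i ⬝ᵥ homog ((1 - s) • v k + s • v (k + 1)) ∧
        (c i ⬝ᵥ homog ((1 - s) • v k + s • v (k + 1)) = 0 ↔ i = k + 1) := by
    intro k s hs hs1 i
    rw [dotProduct_homog_combo]
    have ha := (hv k i).1
    have hb := (hv (k + 1) i).1
    have h1s : 0 < 1 - s := by linarith
    refine ⟨by positivity, fun h => ?_, ?_⟩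
    · have e1 : c i ⬝ᵥ homog (v k) = 0 := by
        have : 0 ≤ s * (c i ⬝ᵥ homog (v (k + 1))) := by positivity
        have h' : 0 ≤ (1 - s) * (c i ⬝ᵥ homog (v k)) := by positivity
        exact (mul_eq_zero.1 (by linarith : (1 - s) * (c i ⬝ᵥ homog (v k)) = 0)).resolve_left h1s.ne'
      have e2 : c i ⬝ᵥ homog (v (k + 1)) = 0 := by
        rw [e1] at h
        exact (mul_eq_zero.1 (by linarith : s * (c i ⬝ᵥ homog (v (k + 1))) = 0)).resolve_left hs.ne'
      rcases (hv k i).2.1 e1 with rfl | rfl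
      · rcases (hv (i + 1) i).2.1 e2 with h | h
        · exact h
        · exact absurd h (ne2 i)
      · rfl
    · rintro rfl
      rw [hzero', hzero]; ring
  ext Z
  constructor
  · rintro ⟨x, hx, rfl⟩
    rcases eq_empty_or_nonempty {i | c i ⬝ᵥ homog x = 0} with h | ⟨i, hi⟩
    · exact Or.inl h
    right
    obtain ⟨k, rfl⟩ : ∃ k, i = k + 1 := ⟨i - 1, by ring⟩
    have hi : c (k + 1) ⬝ᵥ homog x = 0 := hi
    have hA : 0 < c k ⬝ᵥ homog (v (k + 1)) := hpos _ _ (ne1 k) (ne2 k)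
    have hB : 0 < c (k + 1 + 1) ⬝ᵥ homog (v k) :=
      hpos _ _ (ne2 k).symm (fun h => ne1 (k + 1) h.symm)
    have hvw : v k ≠ v (k + 1) := fun h => by
      rw [← h, hzero] at hA
      exact lt_irrefl _ hA
    obtain ⟨s, rfl⟩ := exists_combo_of_dotProduct_homog_eq_zero (hzero' k) (hzero (k + 1)) hi
      (hpos (k + 1 + 1) (k + 1) (ne1 _) (ne2 _)).ne' hvw
    have hs0 : 0 ≤ s := by
      have := hx k
      rw [dotProduct_homog_combo, hzero, mul_zero, zero_add] at this
      exact nonneg_of_mul_nonneg_left this hA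
    have hs1 : s ≤ 1 := by
      have := hx (k + 1 + 1)
      rw [dotProduct_homog_combo, hzero', mul_zero, add_zero] at this
      linarith [nonneg_of_mul_nonneg_left this hB]
    rcases hs0.eq_or_lt with rfl | hs0
    · refine ⟨k, Or.inr ?_⟩
      ext i
      simpa using (hv k i).2
    rcases hs1.eq_or_lt with rfl | hs1
    · refine ⟨k + 1, Or.inr ?_⟩
      ext i
      simpa using (hv (k + 1) i).2
    · refine ⟨k + 1, Or.inl ?_⟩
      ext i
      simpa using (combo_pos k s hs0 hs1 i).2
  · have edge : ∀ k, ∃ x, ∀ i, 0 ≤ c i ⬝ᵥ homog x ∧ (c i ⬝ᵥ homog x = 0 ↔ i = k) := by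
      intro k
      have := combo_pos (k - 1) (1 / 2) (by norm_num) (by norm_num)
      rw [sub_add_cancel] at this
      exact ⟨_, this⟩
    rintro (rfl | ⟨k, rfl | rfl⟩)
    · obtain ⟨x, hx⟩ := edge 0
      obtain ⟨y, hy⟩ := edge 1
      have hpos' : ∀ i, 0 < c i ⬝ᵥ homog ((1 - 1 / 2 : ℝ) • x + (1 / 2 : ℝ) • y) := by
        intro i
        rw [dotProduct_homog_combo]
        have hxi := hx i
        have hyi := hy i
        by_cases hi : i = 0
        · have : c i ⬝ᵥ homog y ≠ 0 := fun h => h1 ((hyi.2.1 h).symm.trans hi)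
          have := lt_of_le_of_ne hyi.1 this.symm
          linarith
        · have : c i ⬝ᵥ homog x ≠ 0 := fun h => hi (hxi.2.1 h)
          have := lt_of_le_of_ne hxi.1 this.symm
          linarith
      exact ⟨_, fun i => (hpos' i).le, eq_empty_of_forall_notMem fun i hi => (hpos' i).ne' hi⟩
    · obtain ⟨x, hx⟩ := edge k
      exact ⟨x, fun i => (hx i).1, by ext i; simpa using (hx i).2⟩
    · exact ⟨v k, fun i => (hv k i).1, by ext i; simpa using (hv k i).2⟩

end Polygons

section WedgePrism

variable {p : ℕ}

/-- The set of facets of the prism over a wedge product that contain the points lying over the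
intersection of the facets `Z` of the polygon, in the fibre position `st` and the prism
position `τ`. -/
def prismTight (Z : Set (ZMod p)) (st : ZMod p → Option (ZMod 2)) (τ : Option Bool) :
    Set ((ZMod p × ZMod 2) ⊕ Bool) :=
  {f | f.elim (fun ij => ij.1 ∈ Z ∨ st ij.1 = some ij.2) fun b => τ = some b}

/-- The tight sets of the points of the prism over the wedge product of a `p`-gon and a
segment. -/
def wedgePrismTightSets (p : ℕ) : Set (Set ((ZMod p × ZMod 2) ⊕ Bool)) :=
  {T | ∃ Z ∈ polygonZeroSets p, ∃ st τ, T = prismTight Z st τ}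

theorem univ_notMem_wedgePrismTightSets : univ ∉ wedgePrismTightSets p := by
  rintro ⟨Z, -, st, τ, h⟩
  have h1 : Sum.inr true ∈ prismTight Z st τ := h ▸ mem_univ _
  have h2 : Sum.inr false ∈ prismTight Z st τ := h ▸ mem_univ _
  have h3 : τ = some true := h1
  have h4 : τ = some false := h2
  simp [h3] at h4

theorem zmod_two_cases (j : ZMod 2) : j = 0 ∨ j = 1 := by
  revert j; decide

theorem segment_state {w : ZMod 2 → ℝ} (hw : w 0 * w 1 < 0) {l y : ℝ} (h : ∀ j, w j * y ≤ l) :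
    0 ≤ l ∧ ∃ st : Option (ZMod 2), ∀ j, w j * y = l ↔ l = 0 ∨ st = some j := by
  have h0 := h 0
  have h1 := h 1
  have hl : 0 ≤ l := by
    by_contra! hl
    have : 0 < (w 0 * y) * (w 1 * y) := mul_pos_of_neg_of_neg (by linarith) (by linarith)
    nlinarith [sq_nonneg y]
  have both : w 0 * y = l → w 1 * y = l → l = 0 := by
    intro e0 e1
    have : (w 0 * w 1) * y ^ 2 = l ^ 2 := by
      linear_combination (w 1 * y) * e0 + l * e1
    nlinarith [sq_nonneg y, sq_nonneg l]
  refine ⟨hl, ?_⟩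
  rcases hl.eq_or_lt with rfl | hl
  · have hy : y = 0 := by
      by_contra hy
      have hy2 : 0 < y ^ 2 := by positivity
      have : 0 ≤ (w 0 * y) * (w 1 * y) := mul_nonneg_of_nonpos_of_nonpos h0 h1
      nlinarith
    exact ⟨none, fun j => by simp [hy]⟩
  · by_cases e0 : w 0 * y = l
    · refine ⟨some 0, fun j => ?_⟩
      rcases zmod_two_cases j with rfl | rfl
      · simp [e0]
      · have : w 1 * y ≠ l := fun e1 => hl.ne' (both e0 e1)
        simp [this, hl.ne']
    · by_cases e1 : w 1 * y = l
      · refine ⟨some 1, fun j => ?_⟩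
        rcases zmod_two_cases j with rfl | rfl
        · simp [e0, hl.ne']
        · simp [e1]
      · refine ⟨none, fun j => ?_⟩
        rcases zmod_two_cases j with rfl | rfl
        · simp [e0, hl.ne']
        · simp [e1, hl.ne']

theorem exists_segment_position {w : ZMod 2 → ℝ} (hw : w 0 * w 1 < 0) (st : Option (ZMod 2)) :
    ∃ τ : ℝ, ∀ l, 0 ≤ l → ∀ j,
      w j * (τ * l) ≤ l ∧ (w j * (τ * l) = l ↔ l = 0 ∨ st = some j) := by
  have hne : ∀ j, w j ≠ 0 := by
    intro j h
    rcases zmod_two_cases j with rfl | rfl <;> simp [h] at hw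
  have hneg : ∀ i j, i ≠ j → w i * (w j)⁻¹ < 0 := by
    intro i j hij
    have : w i * w j < 0 := by
      rcases zmod_two_cases i with rfl | rfl <;> rcases zmod_two_cases j with rfl | rfl
      · exact absurd rfl hij
      · exact hw
      · rwa [mul_comm]
      · exact absurd rfl hij
    have h2 : 0 < ((w j)⁻¹) ^ 2 := by
      have := inv_ne_zero (hne j)
      positivity
    have h3 : w i * (w j)⁻¹ = (w i * w j) * ((w j)⁻¹) ^ 2 := by
      field_simp [hne j]
    rw [h3]
    exact mul_neg_of_neg_of_pos this h2
  rcases st with _ | j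
  · refine ⟨0, fun l hl j => ⟨by simpa using hl, by simp [eq_comm]⟩⟩
  · refine ⟨(w j)⁻¹, fun l hl i => ?_⟩
    rw [← mul_assoc]
    by_cases hij : i = j
    · subst hij
      rw [mul_inv_cancel₀ (hne i)]
      simp
    · have h := hneg i j hij
      refine ⟨by nlinarith, ?_⟩
      have hji : ¬ j = i := fun h => hij h.symm
      simp only [Option.some.injEq, hji, or_false]
      exact ⟨fun e => by nlinarith, fun e => by simp [e]⟩

/-- The inequalities of the prism over a wedge product. -/
def wedgePrismNormal (a : ZMod p → Fin 2 → ℝ) (b : ZMod 2 → Fin 1 → ℝ) :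
    (ZMod p × ZMod 2) ⊕ Bool → ((Fin 2 → ℝ) × (ZMod p → Fin 1 → ℝ)) × ℝ →ₗ[ℝ] ℝ :=
  Sum.elim
    (fun ij =>
      { toFun := fun z => a ij.1 ⬝ᵥ z.1.1 + b ij.2 ⬝ᵥ z.1.2 ij.1
        map_add' := fun z z' => by
          simp only [Prod.fst_add, Prod.snd_add, Pi.add_apply, dotProduct_add]
          ring
        map_smul' := fun s z => by
          simp only [Prod.smul_fst, Prod.smul_snd, Pi.smul_apply, dotProduct_smul, smul_eq_mul,
            RingHom.id_apply]
          ring })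
    fun β => if β then LinearMap.snd ℝ _ _ else -LinearMap.snd ℝ _ _

/-- The right-hand sides of the inequalities of the prism over a wedge product. -/
def wedgePrismBound : (ZMod p × ZMod 2) ⊕ Bool → ℝ :=
  Sum.elim (fun _ => 1) fun β => if β then 1 else 0

theorem mem_wedgePrism {a : ZMod p → Fin 2 → ℝ} {b : ZMod 2 → Fin 1 → ℝ}
    {z : ((Fin 2 → ℝ) × (ZMod p → Fin 1 → ℝ)) × ℝ} :
    z ∈ polyhedron (wedgePrismNormal a b) wedgePrismBound ↔
      (∀ i j, a i ⬝ᵥ z.1.1 + b j ⬝ᵥ z.1.2 i ≤ 1) ∧ z.2 ∈ Icc (0 : ℝ) 1 := by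
  simp only [polyhedron, wedgePrismNormal, wedgePrismBound, mem_ofPred_eq, Sum.forall,
    Prod.forall, Bool.forall_bool, Sum.elim_inl, Sum.elim_inr, LinearMap.coe_mk, AddHom.coe_mk,
    mem_Icc]
  simp

theorem mul_neg_of_isBounded {b : ZMod 2 → Fin 1 → ℝ}
    (h : Bornology.IsBounded {y : Fin 1 → ℝ | ∀ j, b j ⬝ᵥ y ≤ 1}) : b 0 0 * b 1 0 < 0 := by
  obtain ⟨R, hR⟩ := h.exists_norm_le
  by_contra! hb
  have hR0 : 0 ≤ R := (norm_nonneg _).trans (hR 0 (by simp))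
  have key : ∀ s : ℝ, (∀ j, b j 0 * s ≤ 1) → |s| ≤ R := by
    intro s hs
    have := hR (fun _ => s) (fun j => by simpa [dotProduct] using hs j)
    exact (norm_le_pi_norm (fun _ : Fin 1 => s) 0).trans this
  rcases mul_nonneg_iff.1 hb with ⟨h0, h1⟩ | ⟨h0, h1⟩
  · have := key (-(R + 1)) fun j => by
      rcases zmod_two_cases j with rfl | rfl <;> nlinarith
    rw [abs_neg, abs_of_nonneg (by linarith)] at this
    linarith
  · have := key (R + 1) fun j => by
      rcases zmod_two_cases j with rfl | rfl <;> nlinarith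
    rw [abs_of_nonneg (by linarith)] at this
    linarith

theorem dotProduct_homog_vecCons (c : Fin 2 → ℝ) (x : Fin 2 → ℝ) :
    ![1, -c 0, -c 1] ⬝ᵥ homog x = 1 - c ⬝ᵥ x := by
  rw [dotProduct_homog]
  simp only [dotProduct, Fin.sum_univ_two, cons_val_zero, cons_val_one, cons_val]
  ring

theorem tightSet_image_wedgePrism {a : ZMod p → Fin 2 → ℝ} {b : ZMod 2 → Fin 1 → ℝ}
    (hp : 3 ≤ p) (hb : b 0 0 * b 1 0 < 0)
    (ha : ∀ k, ∃ x, ∀ i, a i ⬝ᵥ x ≤ 1 ∧ (a i ⬝ᵥ x = 1 ↔ i = k ∨ i = k + 1)) :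
    tightSet (wedgePrismNormal a b) wedgePrismBound ''
      polyhedron (wedgePrismNormal a b) wedgePrismBound = wedgePrismTightSets p := by
  have hZ := zeroSets_eq_polygonZeroSets hp (c := fun i => ![1, -a i 0, -a i 1]) fun k => by
    obtain ⟨x, hx⟩ := ha k
    refine ⟨x, fun i => ?_⟩
    rw [dotProduct_homog_vecCons, ← (hx i).2, sub_nonneg, sub_eq_zero]
    exact ⟨(hx i).1, eq_comm⟩
  simp only [dotProduct_homog_vecCons, sub_nonneg, sub_eq_zero] at hZ
  have hw : (fun j => b j 0) 0 * (fun j => b j 0) 1 < 0 := hb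
  have hdot : ∀ j (y : Fin 1 → ℝ), b j ⬝ᵥ y = b j 0 * y 0 := fun j y => by simp [dotProduct]
  ext T
  constructor
  · rintro ⟨⟨⟨x, y⟩, t⟩, hz, rfl⟩
    rw [mem_wedgePrism] at hz
    obtain ⟨hz, ht⟩ := hz
    have hst := fun i => segment_state (w := fun j => b j 0) hw (l := 1 - a i ⬝ᵥ x) (y := y i 0) fun j => by
      have := hz i j
      simp only [hdot] at this
      linarith
    choose hl st hst using hst
    refine ⟨_, hZ.subset ⟨x, fun i => by have := hl i; linarith, rfl⟩, st,
      if t = 1 then some true else if t = 0 then some false else none, ?_⟩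
    ext f
    rcases f with ⟨i, j⟩ | b'
    · have := hst i j
      simp only [sub_eq_zero] at this
      simp only [tightSet, prismTight, wedgePrismNormal, wedgePrismBound, mem_ofPred_eq,
        Sum.elim_inl, LinearMap.coe_mk, AddHom.coe_mk, hdot]
      rw [← this, eq_sub_iff_add_eq']
    · rcases b' with _ | _
      · simp only [tightSet, prismTight, wedgePrismNormal, wedgePrismBound, mem_ofPred_eq,
          Sum.elim_inr]
        split_ifs <;> simp_all
      · simp only [tightSet, prismTight, wedgePrismNormal, wedgePrismBound, mem_ofPred_eq,
          Sum.elim_inr]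
        split_ifs <;> simp_all
  · rintro ⟨Z, hZp, st, τ, rfl⟩
    obtain ⟨x, hx, rfl⟩ := hZ.superset hZp
    choose s hs using fun i => exists_segment_position (w := fun j => b j 0) hw (st i)
    obtain ⟨t, ht, htt, htf⟩ : ∃ t : ℝ, t ∈ Icc (0 : ℝ) 1 ∧ (t = 1 ↔ τ = some true) ∧
        (t = 0 ↔ τ = some false) := by
      rcases τ with _ | _ | _
      · exact ⟨1 / 2, by norm_num, by simp, by simp⟩
      · exact ⟨0, by norm_num, by norm_num, by norm_num⟩
      · exact ⟨1, by norm_num, by norm_num, by norm_num⟩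
    have hs' := fun i => hs i (1 - a i ⬝ᵥ x) (by linarith [hx i])
    refine ⟨((x, fun i _ => s i * (1 - a i ⬝ᵥ x)), t), mem_wedgePrism.2 ⟨fun i j => ?_, ht⟩, ?_⟩
    · have := (hs' i j).1
      simp only [hdot]
      linarith
    · ext f
      rcases f with ⟨i, j⟩ | b'
      · have := (hs' i j).2
        simp only [sub_eq_zero] at this
        simp only [tightSet, prismTight, wedgePrismNormal, wedgePrismBound, mem_ofPred_eq,
          Sum.elim_inl, LinearMap.coe_mk, AddHom.coe_mk, hdot]
        rw [← this, eq_sub_iff_add_eq']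
      · rcases b' with _ | _
        · simp [tightSet, prismTight, wedgePrismNormal, wedgePrismBound, htf]
        · simp [tightSet, prismTight, wedgePrismNormal, wedgePrismBound, htt]

/-- The vertices of a polygon whose facets are cyclically labelled. -/
theorem exists_polygon_vertex (hp : 3 ≤ p) {a : ZMod p → Fin 2 → ℝ} {C : Set (Fin 2 → ℝ)}
    (hC : C = {x | ∀ i, a i ⬝ᵥ x ≤ 1}) (hCbd : Bornology.IsBounded C)
    (hCinj : Function.Injective fun i => {x ∈ C | a i ⬝ᵥ x = 1})
    (hCcyc : ∀ i i' : ZMod p,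
      (∃ v, {x ∈ C | a i ⬝ᵥ x = 1} ∩ {x ∈ C | a i' ⬝ᵥ x = 1} = {v}) ↔
        (i' = i + 1 ∨ i = i' + 1)) (k : ZMod p) :
    ∃ x, ∀ i, a i ⬝ᵥ x ≤ 1 ∧ (a i ⬝ᵥ x = 1 ↔ i = k ∨ i = k + 1) := by
  have h1 : (1 : ZMod p) ≠ 0 := by
    simpa using zmod_natCast_ne_zero (p := p) (m := 1) (by omega) (by omega)
  have adj : ∀ i i' v, i ≠ i' → v ∈ C → a i ⬝ᵥ v = 1 → a i' ⬝ᵥ v = 1 →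
      i' = i + 1 ∨ i = i' + 1 := by
    intro i i' v hii hv hi hi'
    refine (hCcyc i i').1 ⟨v, subset_antisymm ?_ (by rintro _ rfl; exact ⟨⟨hv, hi⟩, hv, hi'⟩)⟩
    rintro w ⟨⟨hw, hwi⟩, -, hwi'⟩
    by_contra hwv
    have hq : (![1, -a i 0, -a i 1]) ⬝ᵥ homog 0 ≠ 0 := by
      rw [dotProduct_homog_vecCons]; simp
    have hline : ∀ x, a i ⬝ᵥ x = 1 → a i' ⬝ᵥ x = 1 := by
      intro x hx
      obtain ⟨s, rfl⟩ := exists_combo_of_dotProduct_homog_eq_zero (c := ![1, -a i 0, -a i 1])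
        (v := w) (w := v) (x := x) (q := 0) (by rw [dotProduct_homog_vecCons, hwi, sub_self])
        (by rw [dotProduct_homog_vecCons, hi, sub_self])
        (by rw [dotProduct_homog_vecCons, hx, sub_self]) hq hwv
      rw [dotProduct_add, dotProduct_smul, dotProduct_smul, hwi', hi']
      simp
    have hline' : ∀ x, a i' ⬝ᵥ x = 1 → a i ⬝ᵥ x = 1 := by
      intro x hx
      have hq : (![1, -a i' 0, -a i' 1]) ⬝ᵥ homog 0 ≠ 0 := by
        rw [dotProduct_homog_vecCons]; simp
      obtain ⟨s, rfl⟩ := exists_combo_of_dotProduct_homog_eq_zero (c := ![1, -a i' 0, -a i' 1])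
        (v := w) (w := v) (x := x) (q := 0) (by rw [dotProduct_homog_vecCons, hwi', sub_self])
        (by rw [dotProduct_homog_vecCons, hi', sub_self])
        (by rw [dotProduct_homog_vecCons, hx, sub_self]) hq hwv
      rw [dotProduct_add, dotProduct_smul, dotProduct_smul, hwi, hi]
      simp
    exact hii (hCinj (Set.ext fun x =>
      ⟨fun hx => ⟨hx.1, hline x hx.2⟩, fun hx => ⟨hx.1, hline' x hx.2⟩⟩))
  have notAll : ∀ v ∈ C, ¬ ∀ i, a i ⬝ᵥ v = 1 := by
    intro v hv hall
    have hCv : C ⊆ {v} := by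
      intro y hy
      by_contra hyv
      have hyv : 0 < ‖y - v‖ := norm_pos_iff.2 (sub_ne_zero.2 hyv)
      obtain ⟨R, hR⟩ := hCbd.exists_norm_le
      have hR0 := (norm_nonneg _).trans (hR v hv)
      have hmem : v + ((2 * R + 1) / ‖y - v‖) • (y - v) ∈ C := by
        rw [hC] at hy ⊢
        intro i
        rw [dotProduct_add, dotProduct_smul, dotProduct_sub, hall i, smul_eq_mul]
        have := hy i
        have : (2 * R + 1) / ‖y - v‖ * (a i ⬝ᵥ y - 1) ≤ 0 :=
          mul_nonpos_of_nonneg_of_nonpos (by positivity) (by linarith)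
        linarith
      have h2 := norm_sub_le_norm_add (((2 * R + 1) / ‖y - v‖) • (y - v)) v
      rw [norm_smul, Real.norm_of_nonneg (by positivity), div_mul_cancel₀ _ hyv.ne'] at h2
      have := hR _ hmem
      have := hR v hv
      rw [add_comm _ v] at h2
      linarith
    refine h1 (hCinj (a₁ := 1) (a₂ := 0) (Set.ext fun x => ?_))
    constructor
    · rintro ⟨hx, -⟩
      have := hCv hx
      rw [mem_singleton_iff] at this
      exact ⟨hx, this ▸ hall 0⟩
    · rintro ⟨hx, -⟩
      have := hCv hx
      rw [mem_singleton_iff] at this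
      exact ⟨hx, this ▸ hall 1⟩
  obtain ⟨v, hv⟩ := (hCcyc k (k + 1)).2 (Or.inl rfl)
  have hv' : v ∈ {x ∈ C | a k ⬝ᵥ x = 1} ∩ {x ∈ C | a (k + 1) ⬝ᵥ x = 1} := hv ▸ rfl
  obtain ⟨⟨hvC, hvk⟩, -, hvk'⟩ := hv'
  refine ⟨v, fun i => ⟨by rw [hC] at hvC; exact hvC i, fun hi => ?_, ?_⟩⟩
  · by_contra! hne
    have e1 : i = k - 1 := by
      rcases adj i k v hne.1 hvC hi hvk with h | h
      · rw [h]; ring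
      · exact absurd h hne.2
    have e2 : i = k + 2 := by
      rcases adj i (k + 1) v hne.2 hvC hi hvk' with h | h
      · exact absurd (add_right_cancel h).symm hne.1
      · rw [h]; ring
    have e3 : ((3 : ℕ) : ZMod p) = 0 := by
      push_cast
      linear_combination e1 - e2
    have hp3 : p = 3 := by
      have := Nat.le_of_dvd (by norm_num) ((ZMod.natCast_eq_zero_iff _ _).1 e3)
      omega
    subst hp3
    refine notAll v hvC fun i' => ?_
    have : ∀ i' k : ZMod 3, i' = k ∨ i' = k + 1 ∨ i' = k + 2 := by decide
    rcases this i' k with rfl | rfl | rfl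
    · exact hvk
    · exact hvk'
    · exact e2 ▸ hi
  · rintro (rfl | rfl)
    · exact hvk
    · exact hvk'

end WedgePrism

section DeformedWedgePrism

variable {p : ℕ} {E F : Type*} [AddCommGroup E] [Module ℝ E] [AddCommGroup F] [Module ℝ F]

/-- The deformation term of the `i`-th pair of inequalities of the deformed prism over the wedge
product. -/
def deformTerm (δ : ℝ) (i : ZMod p) (u : ℕ → E) : E :=
  if i.val + 1 < p then δ • u i.val else -∑ j ∈ Finset.range p, δ ^ (2 * (p - j)) • u j

theorem map_deformTerm (f : E →ₗ[ℝ] F) (δ : ℝ) (i : ZMod p) (u : ℕ → E) :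
    f (deformTerm δ i u) = deformTerm δ i fun j => f (u j) := by
  unfold deformTerm
  split_ifs <;> simp

theorem deformTerm_congr {δ : ℝ} {i : ZMod p} {u u' : ℕ → E} (h : ∀ j < p, u j = u' j) :
    deformTerm δ i u = deformTerm δ i u' := by
  unfold deformTerm
  split_ifs with hi
  · rw [h _ (by omega)]
  · rw [Finset.sum_congr rfl fun j hj => by rw [h j (Finset.mem_range.1 hj)]]

theorem deformTerm_zero_left (i : ZMod p) (u : ℕ → E) : deformTerm 0 i u = 0 := by
  unfold deformTerm
  split_ifs
  · simp
  · rw [neg_eq_zero]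
    refine Finset.sum_eq_zero fun j hj => ?_
    have := Finset.mem_range.1 hj
    rw [zero_pow (by omega), zero_smul]

/-- The signs of the two inequalities describing a segment. -/
def segmentSign (j : ZMod 2) : ℝ :=
  if j = 0 then 1 else -1

theorem segmentSign_mul_neg : segmentSign 0 * segmentSign 1 < 0 := by
  simp [segmentSign]

theorem abs_segmentSign (j : ZMod 2) : |segmentSign j| = 1 := by
  unfold segmentSign
  split_ifs <;> simp

theorem abs_le_of_segmentSign_mul_le {y l : ℝ} (h : ∀ j, segmentSign j * y ≤ l) : |y| ≤ l := by
  have h0 := h 0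
  have h1 := h 1
  simp only [segmentSign, if_true, one_ne_zero, if_false] at h0 h1
  exact abs_le.2 ⟨by linarith, by linarith⟩

/-- The `j`-th fibre coordinate; the fibre coordinates are listed in reverse order. -/
def fibre (p j : ℕ) : (Fin (3 + p) → ℝ) →ₗ[ℝ] ℝ :=
  LinearMap.proj ⟨p + 2 - j, by omega⟩

/-- The two coordinates of the plane of the polygon. -/
def planePart (z : Fin (3 + p) → ℝ) : Fin 2 → ℝ :=
  fun l => z ⟨l, by omega⟩

/-- The inequalities of the deformed prism over the wedge product. -/
def deformedNormal (a : ZMod p → Fin 2 → ℝ) (δ : ℝ) :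
    (ZMod p × ZMod 2) ⊕ Bool → (Fin (3 + p) → ℝ) →ₗ[ℝ] ℝ :=
  Sum.elim
    (fun ij => a ij.1 0 • LinearMap.proj ⟨0, by omega⟩ + a ij.1 1 • LinearMap.proj ⟨1, by omega⟩ +
      deformTerm δ ij.1 (fibre p) + segmentSign ij.2 • fibre p (ij.1.val + 1))
    fun β => if β then fibre p 0 else -fibre p 0

theorem deformedNormal_inl (a : ZMod p → Fin 2 → ℝ) (δ : ℝ) (i : ZMod p) (j : ZMod 2)
    (z : Fin (3 + p) → ℝ) :
    deformedNormal a δ (Sum.inl (i, j)) z =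
      a i ⬝ᵥ planePart z + deformTerm δ i (fun k => fibre p k z) +
        segmentSign j * fibre p (i.val + 1) z := by
  have : (deformTerm δ i (fibre p)) z = deformTerm δ i (fun k => fibre p k z) :=
    map_deformTerm (LinearMap.applyₗ z) δ i (fibre p)
  simp [deformedNormal, this, planePart, dotProduct, Fin.sum_univ_two]

theorem deformedNormal_inr (a : ZMod p → Fin 2 → ℝ) (δ : ℝ) (β : Bool) (z : Fin (3 + p) → ℝ) :
    deformedNormal a δ (Sum.inr β) z = if β then fibre p 0 z else -fibre p 0 z := by
  cases β <;> simp [deformedNormal]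

/-- The deformed prism over the wedge product. -/
abbrev deformedPrism (a : ZMod p → Fin 2 → ℝ) (δ : ℝ) : Set (Fin (3 + p) → ℝ) :=
  polyhedron (deformedNormal a δ) 1

theorem mem_deformedPrism {a : ZMod p → Fin 2 → ℝ} {δ : ℝ} {z : Fin (3 + p) → ℝ} :
    z ∈ deformedPrism a δ ↔
      (∀ i j, segmentSign j * fibre p (i.val + 1) z ≤
        1 - a i ⬝ᵥ planePart z - deformTerm δ i fun k => fibre p k z) ∧
        -1 ≤ fibre p 0 z ∧ fibre p 0 z ≤ 1 := by
  simp only [deformedPrism, polyhedron, mem_ofPred_eq, Sum.forall, Prod.forall,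
    Bool.forall_bool, deformedNormal_inl, deformedNormal_inr, Pi.one_apply, if_true]
  refine and_congr (forall_congr' fun i => forall_congr' fun j => ?_) (and_congr ?_ Iff.rfl)
  · constructor <;> intro h <;> linarith
  · simp only [Bool.false_eq_true, if_false]
    exact neg_le

/-- The fibre coordinates, as affine functions on the plane in homogeneous coordinates, when their
relative positions `s` and `t` in the fibres are prescribed. -/
def fibreForm (a : ZMod p → Fin 2 → ℝ) (δ : ℝ) (s : ZMod p → ℝ) (t : ℝ) : ℕ → Fin 3 → ℝ
  | 0 => t • ![1, 0, 0]
  | j + 1 => s j • (![1, -a j 0, -a j 1] - δ • fibreForm a δ s t j)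

/-- The widths of the fibres, as affine functions on the plane in homogeneous coordinates. -/
def widthForm (a : ZMod p → Fin 2 → ℝ) (δ : ℝ) (s : ZMod p → ℝ) (t : ℝ) (i : ZMod p) :
    Fin 3 → ℝ :=
  ![1, -a i 0, -a i 1] - deformTerm δ i (fibreForm a δ s t)

theorem widthForm_dotProduct (a : ZMod p → Fin 2 → ℝ) (δ : ℝ) (s : ZMod p → ℝ) (t : ℝ)
    (i : ZMod p) (x : Fin 2 → ℝ) :
    widthForm a δ s t i ⬝ᵥ homog x =
      1 - a i ⬝ᵥ x - deformTerm δ i fun k => fibreForm a δ s t k ⬝ᵥ homog x := by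
  have h : (deformTerm δ i (fibreForm a δ s t)) ⬝ᵥ homog x = _ :=
    map_deformTerm ((dotProductBilin ℝ ℝ).flip (homog x)) δ i (fibreForm a δ s t)
  rw [widthForm, sub_dotProduct, dotProduct_homog_vecCons, h]
  rfl

theorem fibreForm_zero_dotProduct (a : ZMod p → Fin 2 → ℝ) (δ : ℝ) (s : ZMod p → ℝ) (t : ℝ)
    (x : Fin 2 → ℝ) : fibreForm a δ s t 0 ⬝ᵥ homog x = t := by
  simp [fibreForm, homog]

theorem fibreForm_succ_dotProduct (a : ZMod p → Fin 2 → ℝ) (δ : ℝ) (s : ZMod p → ℝ) (t : ℝ)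
    (i : ZMod p) (hi : i.val + 1 < p) (x : Fin 2 → ℝ) :
    fibreForm a δ s t (i.val + 1) ⬝ᵥ homog x = s i * (widthForm a δ s t i ⬝ᵥ homog x) := by
  have : NeZero p := ⟨by omega⟩
  rw [fibreForm, ZMod.natCast_rightInverse i, widthForm, deformTerm, if_pos hi, smul_dotProduct,
    smul_eq_mul]

/-- The planar slices of the deformed prism are polygons with the same cyclic labelling. -/
def SlicesArePolygons (a : ZMod p → Fin 2 → ℝ) (δ : ℝ) : Prop :=
  ∀ s ∈ Icc (-1 : ZMod p → ℝ) 1, ∀ t ∈ Icc (-1 : ℝ) 1, ∀ k, ∃ x, ∀ i,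
    0 ≤ widthForm a δ s t i ⬝ᵥ homog x ∧ (widthForm a δ s t i ⬝ᵥ homog x = 0 ↔ i = k ∨ i = k + 1)

theorem tightSet_image_deformedPrism {a : ZMod p → Fin 2 → ℝ} {δ : ℝ} (hp : 3 ≤ p)
    (h : SlicesArePolygons a δ) :
    tightSet (deformedNormal a δ) 1 '' deformedPrism a δ = wedgePrismTightSets p := by
  have : NeZero p := ⟨by omega⟩
  have hval : ∀ j < p, ((j : ℕ) : ZMod p).val = j := fun j hj => ZMod.val_natCast_of_lt hj
  ext T
  constructor
  · rintro ⟨z, hz, rfl⟩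
    obtain ⟨hz, ht0, ht1⟩ := mem_deformedPrism.1 hz
    set x := planePart z with hx
    set u := fun k => fibre p k z with hu
    set l := fun i => 1 - a i ⬝ᵥ x - deformTerm δ i u with hl
    have habs : ∀ i : ZMod p, |u (i.val + 1)| ≤ l i := fun i => abs_le_of_segmentSign_mul_le (hz i)
    choose hl0 st hst using fun i => segment_state segmentSign_mul_neg (hz i)
    set s : ZMod p → ℝ := fun i => u (i.val + 1) / l i with hs
    have hs1 : ∀ i, |s i| ≤ 1 := fun i => by
      rw [hs, abs_div, abs_of_nonneg (hl0 i)]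
      exact div_le_one_of_le₀ (habs i) (hl0 i)
    have hsl : ∀ i, u (i.val + 1) = s i * l i := by
      intro i
      rcases eq_or_ne (l i) 0 with h0 | h0
      · rw [h0, mul_zero, ← abs_nonpos_iff, ← h0]
        exact habs i
      · rw [hs, div_mul_cancel₀ _ h0]
    have hU : ∀ j < p, fibreForm a δ s (u 0) j ⬝ᵥ homog x = u j := by
      intro j
      induction j with
      | zero => exact fun _ => fibreForm_zero_dotProduct ..
      | succ j ih =>
        intro hj
        have hj' : ((j : ℕ) : ZMod p).val = j := hval j (by omega)
        have e1 := fibreForm_succ_dotProduct a δ s (u 0) j (by omega) x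
        rw [widthForm_dotProduct, deformTerm, if_pos (by omega), hj', ih (by omega)] at e1
        have e2 := hsl j
        simp only [hl, deformTerm] at e2
        rw [if_pos (by omega), hj'] at e2
        rw [e1, e2]
    have hW : ∀ i, widthForm a δ s (u 0) i ⬝ᵥ homog x = l i := fun i => by
      rw [widthForm_dotProduct, deformTerm_congr hU]
    have hZ := zeroSets_eq_polygonZeroSets hp
      (h s ⟨fun i => (abs_le.1 (hs1 i)).1, fun i => (abs_le.1 (hs1 i)).2⟩ (u 0) ⟨ht0, ht1⟩)
    refine ⟨{i | l i = 0}, hZ.subset ⟨x, fun i => (hW i).symm ▸ hl0 i, by simp only [hW]⟩, st,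
      if u 0 = 1 then some true else if u 0 = -1 then some false else none, ?_⟩
    ext f
    rcases f with ⟨i, j⟩ | β
    · have := hst i j
      simp only [tightSet, prismTight, mem_ofPred_eq, deformedNormal_inl, Sum.elim_inl,
        Pi.one_apply]
      rw [← this]
      constructor <;> intro h <;> linarith
    · rcases β with _ | _
      · simp only [tightSet, prismTight, mem_ofPred_eq, deformedNormal_inr, Sum.elim_inr,
          Pi.one_apply, Bool.false_eq_true, if_false]
        change -u 0 = 1 ↔ _
        rw [neg_eq_iff_eq_neg]
        split_ifs with h1 h2
        · rw [h1]; norm_num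
        · simp [h2]
        · simp [h2]
      · simp only [tightSet, prismTight, mem_ofPred_eq, deformedNormal_inr, Sum.elim_inr,
          Pi.one_apply, if_true]
        change u 0 = 1 ↔ _
        split_ifs with h1 h2
        · simp [h1]
        · simp [h1]
        · simp [h1]
  · rintro ⟨Z, hZp, st, τ, rfl⟩
    choose s hs using fun i => exists_segment_position segmentSign_mul_neg (st i)
    have hs1 : ∀ i, |s i| ≤ 1 := fun i => abs_le_of_segmentSign_mul_le fun j => by
      simpa using (hs i 1 zero_le_one j).1
    obtain ⟨t, ht, htt, htf⟩ : ∃ t : ℝ, t ∈ Icc (-1 : ℝ) 1 ∧ (t = 1 ↔ τ = some true) ∧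
        (-t = 1 ↔ τ = some false) := by
      rcases τ with _ | _ | _
      · exact ⟨0, by norm_num, by simp, by simp⟩
      · exact ⟨-1, by norm_num, by norm_num, by norm_num⟩
      · exact ⟨1, by norm_num, by norm_num, by norm_num⟩
    obtain ⟨x, hx, rfl⟩ := (zeroSets_eq_polygonZeroSets hp
      (h s ⟨fun i => (abs_le.1 (hs1 i)).1, fun i => (abs_le.1 (hs1 i)).2⟩ t ht)).superset hZp
    set U := fibreForm a δ s t with hU
    set l := fun i => widthForm a δ s t i ⬝ᵥ homog x with hl
    let z : Fin (3 + p) → ℝ := fun m =>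
      if m.1 = 0 then x 0 else if m.1 = 1 then x 1 else
        if m.1 = 2 then s ((p - 1 : ℕ) : ZMod p) * l ((p - 1 : ℕ) : ZMod p)
        else U (p + 2 - m.1) ⬝ᵥ homog x
    have hzx : planePart z = x := by
      ext m
      fin_cases m <;> simp [planePart, z]
    have hzu : ∀ j < p, fibre p j z = U j ⬝ᵥ homog x := by
      intro j hj
      simp only [fibre, LinearMap.proj_apply, z]
      rw [if_neg (by omega), if_neg (by omega), if_neg (by omega),
        show p + 2 - (p + 2 - j) = j by omega]
    have hzp : fibre p p z = s ((p - 1 : ℕ) : ZMod p) * l ((p - 1 : ℕ) : ZMod p) := by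
      simp only [fibre, LinearMap.proj_apply, z]
      rw [if_neg (by omega), if_neg (by omega), if_pos (by omega)]
    have hlz : ∀ i, 1 - a i ⬝ᵥ planePart z - (deformTerm δ i fun k => fibre p k z) = l i := by
      intro i
      rw [hzx, deformTerm_congr hzu, hl]
      exact (widthForm_dotProduct ..).symm
    have hsz : ∀ i : ZMod p, fibre p (i.val + 1) z = s i * l i := by
      intro i
      have hi := ZMod.val_lt i
      by_cases hi' : i.val + 1 < p
      · rw [hzu _ hi']
        exact fibreForm_succ_dotProduct a δ s t i hi' x
      · have e : i.val + 1 = p := by omega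
        have e' : ((p - 1 : ℕ) : ZMod p) = i := by
          rw [← ZMod.natCast_zmod_val i]
          congr 1
          omega
        rw [e, hzp, e']
    have hz0 : fibre p 0 z = t := by
      rw [hzu 0 (by omega)]
      exact fibreForm_zero_dotProduct ..
    refine ⟨z, mem_deformedPrism.2 ⟨fun i j => ?_, hz0 ▸ ht.1, hz0 ▸ ht.2⟩, ?_⟩
    · rw [hlz, hsz]
      exact (hs i (l i) (hx i) j).1
    · ext f
      rcases f with ⟨i, j⟩ | β
      · have := (hs i (l i) (hx i) j).2
        have h2 := hlz i
        simp only [tightSet, prismTight, mem_ofPred_eq, deformedNormal_inl, Sum.elim_inl,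
          Pi.one_apply]
        rw [← this, hsz]
        constructor <;> intro h <;> linarith
      · rcases β with _ | _
        · simp [tightSet, prismTight, deformedNormal_inr, hz0, htf]
        · simp [tightSet, prismTight, deformedNormal_inr, hz0, htt]

end DeformedWedgePrism

section DeformationParameter

open Topology

variable {p : ℕ} {a : ZMod p → Fin 2 → ℝ}

theorem continuous_deformTerm (i : ZMod p) {X : Type*} [TopologicalSpace X] {d : X → ℝ}
    {u : X → ℕ → Fin 3 → ℝ} (hd : Continuous d) (hu : ∀ j, Continuous fun x => u x j) :
    Continuous fun x => deformTerm (d x) i (u x) := by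
  unfold deformTerm
  split_ifs <;> fun_prop

theorem continuous_fibreForm (a : ZMod p → Fin 2 → ℝ) (j : ℕ) :
    Continuous fun q : ℝ × (ZMod p → ℝ) × ℝ => fibreForm a q.1 q.2.1 q.2.2 j := by
  induction j with
  | zero => unfold fibreForm; fun_prop
  | succ j ih => unfold fibreForm; fun_prop

theorem continuous_widthForm (a : ZMod p → Fin 2 → ℝ) (i : ZMod p) :
    Continuous fun q : ℝ × (ZMod p → ℝ) × ℝ => widthForm a q.1 q.2.1 q.2.2 i :=
  continuous_const.sub (continuous_deformTerm i continuous_fst (continuous_fibreForm a))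

theorem widthForm_zero (a : ZMod p → Fin 2 → ℝ) (s : ZMod p → ℝ) (t : ℝ) (i : ZMod p) :
    widthForm a 0 s t i = ![1, -a i 0, -a i 1] := by
  rw [widthForm, deformTerm_zero_left, sub_zero]

theorem continuous_cross {X : Type*} [TopologicalSpace X] {f g : X → Fin 3 → ℝ}
    (hf : Continuous f) (hg : Continuous g) : Continuous fun x => f x ⨯₃ g x := by
  simp only [cross_apply]
  fun_prop

theorem eventually_slicesArePolygons (hp : 3 ≤ p)
    (ha : ∀ k, ∃ x, ∀ i, a i ⬝ᵥ x ≤ 1 ∧ (a i ⬝ᵥ x = 1 ↔ i = k ∨ i = k + 1)) :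
    ∀ᶠ δ in 𝓝 (0 : ℝ), SlicesArePolygons a δ := by
  have : NeZero p := ⟨by omega⟩
  have h1 : (1 : ZMod p) ≠ 0 := by
    simpa using zmod_natCast_ne_zero (p := p) (m := 1) (by omega) (by omega)
  have h2 : (2 : ZMod p) ≠ 0 := by
    simpa using zmod_natCast_ne_zero (p := p) (m := 2) (by omega) (by omega)
  let v : ℝ × (ZMod p → ℝ) × ℝ → ZMod p → Fin 3 → ℝ := fun q k =>
    widthForm a q.1 q.2.1 q.2.2 k ⨯₃ widthForm a q.1 q.2.1 q.2.2 (k + 1)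
  have hv : ∀ k, Continuous fun q => v q k := fun k =>
    continuous_cross (continuous_widthForm a k) (continuous_widthForm a (k + 1))
  have hpos : ∀ q k i, i ≠ k → i ≠ k + 1 → q.1 = 0 →
      0 < v q k 0 * (widthForm a q.1 q.2.1 q.2.2 i ⬝ᵥ v q k) := by
    intro q k i hik hik1 hq
    obtain ⟨x, hx⟩ := ha k
    obtain ⟨y, hy⟩ := ha (k + 1)
    have e0 := (hx k).2.2 (Or.inl rfl)
    have e1 := (hx (k + 1)).2.2 (Or.inr rfl)
    have ei : a i ⬝ᵥ x < 1 := lt_of_le_of_ne (hx i).1 fun h => ((hx i).2.1 h).elim hik hik1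
    have ey := (hy (k + 1)).2.2 (Or.inl rfl)
    have ey' : a k ⬝ᵥ y ≠ 1 := fun h => ((hy k).2.1 h).elim (fun h => h1 (by
      linear_combination -h)) fun h => h2 (by linear_combination -h)
    simp only [v, hq, widthForm_zero, cross_apply, dotProduct, Fin.sum_univ_three,
      Fin.sum_univ_two, cons_val_zero, cons_val_one, cons_val] at *
    set d := a k 0 * a (k + 1) 1 - a k 1 * a (k + 1) 0 with hd
    have hd0 : d ≠ 0 := by
      intro hd0
      apply ey'
      have z0 : a (k + 1) 1 - a k 1 = d * x 0 := by
        rw [hd]; linear_combination a k 1 * e1 - a (k + 1) 1 * e0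
      have z1 : a k 0 - a (k + 1) 0 = d * x 1 := by
        rw [hd]; linear_combination a (k + 1) 0 * e0 - a k 0 * e1
      rw [hd0] at z0 z1
      linear_combination ey + y 0 * z1 - y 1 * z0
    have : 0 < d ^ 2 * (1 - (a i 0 * x 0 + a i 1 * x 1)) :=
      mul_pos (by positivity) (by linarith)
    refine this.trans_eq ?_
    rw [hd]
    linear_combination
      (d * a i 1 * a (k + 1) 0 - d * a i 0 * a (k + 1) 1) * e0 +
        (d * a i 0 * a k 1 - d * a i 1 * a k 0) * e1
  have hev : ∀ k i, i ≠ k → i ≠ k + 1 → ∀ᶠ δ in 𝓝 (0 : ℝ),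
      ∀ st ∈ Icc (-1 : ZMod p → ℝ) 1 ×ˢ Icc (-1 : ℝ) 1,
        0 < v (δ, st) k 0 * (widthForm a δ st.1 st.2 i ⬝ᵥ v (δ, st) k) := by
    intro k i hik hik1
    refine (isCompact_Icc.prod isCompact_Icc).eventually_forall_of_forall_eventually
      fun st _ => ?_
    have hc : Continuous fun q => v q k 0 * (widthForm a q.1 q.2.1 q.2.2 i ⬝ᵥ v q k) :=
      ((continuous_apply 0).comp (hv k)).mul ((continuous_widthForm a i).dotProduct (hv k))
    exact hc.continuousAt.eventually (lt_mem_nhds (hpos (0, st) k i hik hik1 rfl))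
  have hev' : ∀ᶠ δ in 𝓝 (0 : ℝ), ∀ k i, i ≠ k → i ≠ k + 1 →
      ∀ st ∈ Icc (-1 : ZMod p → ℝ) 1 ×ˢ Icc (-1 : ℝ) 1,
        0 < v (δ, st) k 0 * (widthForm a δ st.1 st.2 i ⬝ᵥ v (δ, st) k) := by
    simp only [Filter.eventually_all]
    exact hev
  filter_upwards [hev'] with δ hδ s hs t ht k
  set w := v (δ, s, t) k with hw
  have hD : ∀ i, i ≠ k → i ≠ k + 1 → 0 < w 0 * (widthForm a δ s t i ⬝ᵥ w) :=
    fun i h h' => hδ k i h h' (s, t) ⟨hs, ht⟩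
  have hw0 : w 0 ≠ 0 := by
    intro h
    have := hD (k + 2) (by simpa using h2) (fun h => h1 (by linear_combination h))
    rw [h, zero_mul] at this
    exact this.false
  have hdot : ∀ i, widthForm a δ s t i ⬝ᵥ homog ![w 1 / w 0, w 2 / w 0] =
      (widthForm a δ s t i ⬝ᵥ w) / w 0 := by
    intro i
    rw [dotProduct_homog]
    simp only [dotProduct, Fin.sum_univ_three, cons_val_zero, cons_val_one]
    field_simp
  refine ⟨![w 1 / w 0, w 2 / w 0], fun i => ?_⟩
  rw [hdot]
  by_cases hik : i = k
  · have : widthForm a δ s t i ⬝ᵥ w = 0 := by rw [hik]; exact dot_self_cross _ _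
    rw [this]; simp [hik]
  by_cases hik1 : i = k + 1
  · have : widthForm a δ s t i ⬝ᵥ w = 0 := by rw [hik1]; exact dot_cross_self _ _
    rw [this]; simp [hik1]
  have : 0 < (widthForm a δ s t i ⬝ᵥ w) / w 0 := by
    have := hD i hik hik1
    rw [← mul_div_mul_left _ _ hw0]
    exact div_pos this (mul_self_pos.2 hw0)
  exact ⟨this.le, by simp [hik, hik1, this.ne']⟩

end DeformationParameter

section Boundedness

open Topology

variable {p : ℕ} [NeZero p] {a : ZMod p → Fin 2 → ℝ}

theorem exists_mul_norm_le_dotProduct (h : Bornology.IsBounded {x | ∀ i, a i ⬝ᵥ x ≤ 1}) :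
    ∃ m > 0, ∀ x, ∃ i, m * ‖x‖ ≤ a i ⬝ᵥ x := by
  obtain ⟨R, hR0, hR⟩ := h.exists_pos_norm_le
  refine ⟨1 / (2 * R), by positivity, fun x => ?_⟩
  rcases eq_or_ne x 0 with rfl | hx
  · exact ⟨0, by simp⟩
  have hx0 : 0 < ‖x‖ := norm_pos_iff.2 hx
  by_contra! hlt
  have := hR ((2 * R / ‖x‖) • x) fun i => by
    rw [dotProduct_smul, smul_eq_mul]
    refine (mul_le_mul_of_nonneg_left (hlt i).le (by positivity)).trans_eq ?_
    field_simp
  rw [norm_smul, Real.norm_of_nonneg (by positivity), div_mul_cancel₀ _ hx0.ne'] at this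
  linarith

theorem exists_abs_dotProduct_le (a : ZMod p → Fin 2 → ℝ) :
    ∃ A, 0 ≤ A ∧ ∀ i x, |a i ⬝ᵥ x| ≤ A * ‖x‖ := by
  refine ⟨∑ i, (|a i 0| + |a i 1|), Finset.sum_nonneg fun i _ => by positivity, fun i x => ?_⟩
  have h0 : |x 0| ≤ ‖x‖ := norm_le_pi_norm x 0
  have h1 : |x 1| ≤ ‖x‖ := norm_le_pi_norm x 1
  calc |a i ⬝ᵥ x| ≤ |a i 0| * |x 0| + |a i 1| * |x 1| := by
        rw [dotProduct, Fin.sum_univ_two, ← abs_mul, ← abs_mul]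
        exact abs_add_le _ _
    _ ≤ (|a i 0| + |a i 1|) * ‖x‖ := by
        rw [add_mul]
        gcongr
    _ ≤ _ := by
        gcongr
        exact Finset.single_le_sum (f := fun i => |a i 0| + |a i 1|)
          (fun i _ => by positivity) (Finset.mem_univ i)

theorem abs_deformTerm_le {δ B : ℝ} (hδ0 : 0 ≤ δ) (hδ1 : δ ≤ 1) {u : ℕ → ℝ} (hB : 0 ≤ B)
    (hu : ∀ j < p, |u j| ≤ B) (i : ZMod p) : |deformTerm δ i u| ≤ p * δ * B := by
  have hp : (1 : ℝ) ≤ p := Nat.one_le_cast.2 (Nat.pos_of_ne_zero (NeZero.ne p))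
  unfold deformTerm
  split_ifs with hi
  · rw [smul_eq_mul, abs_mul, abs_of_nonneg hδ0]
    calc δ * |u i.val| ≤ 1 * δ * B := by
          rw [one_mul]
          exact mul_le_mul_of_nonneg_left (hu _ (by omega)) hδ0
      _ ≤ _ := by gcongr
  · rw [abs_neg]
    calc |∑ j ∈ Finset.range p, δ ^ (2 * (p - j)) • u j|
        ≤ ∑ j ∈ Finset.range p, |δ ^ (2 * (p - j)) • u j| := Finset.abs_sum_le_sum_abs _ _
      _ ≤ ∑ j ∈ Finset.range p, δ * B := Finset.sum_le_sum fun j hj => by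
          have hj := Finset.mem_range.1 hj
          rw [smul_eq_mul, abs_mul, abs_of_nonneg (pow_nonneg hδ0 _)]
          exact mul_le_mul (pow_le_of_le_one hδ0 hδ1 (by omega)) (hu j hj) (abs_nonneg _) hδ0
      _ = p * δ * B := by simp [mul_assoc]

theorem eventually_isBounded_deformedPrism (h : Bornology.IsBounded {x | ∀ i, a i ⬝ᵥ x ≤ 1}) :
    ∀ᶠ δ in 𝓝[>] (0 : ℝ), Bornology.IsBounded (deformedPrism a δ) := by
  obtain ⟨m, hm, hma⟩ := exists_mul_norm_le_dotProduct h
  obtain ⟨A, hA, hAa⟩ := exists_abs_dotProduct_le a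
  have hp0 : 0 < p := Nat.pos_of_ne_zero (NeZero.ne p)
  have hp : (1 : ℝ) ≤ p := Nat.one_le_cast.2 hp0
  have e1 : ∀ᶠ δ : ℝ in 𝓝[>] (0 : ℝ), 2 * (p * δ) ≤ 1 := by
    refine nhdsWithin_le_nhds (Filter.Tendsto.eventually_le_const (v := 0) one_pos ?_)
    exact Continuous.tendsto' (by fun_prop) _ _ (by simp)
  have e2 : ∀ᶠ δ in 𝓝[>] (0 : ℝ), 4 * (p * δ) * A ≤ m := by
    refine nhdsWithin_le_nhds (Filter.Tendsto.eventually_le_const (v := 0) hm ?_)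
    exact Continuous.tendsto' (by fun_prop) _ _ (by simp)
  filter_upwards [e1, e2, self_mem_nhdsWithin] with δ h1 h2 hδ
  have hδ : 0 < δ := hδ
  have hδ2 : 2 * δ ≤ 1 := by nlinarith
  refine isBounded_iff_forall_norm_le.2 ⟨6 / m + 4 * (1 + A * (6 / m)), fun z hz => ?_⟩
  obtain ⟨hz, ht0, ht1⟩ := mem_deformedPrism.1 hz
  set x := planePart z with hx
  set u := fun k => fibre p k z with hu
  have habs : ∀ i : ZMod p, |u (i.val + 1)| ≤ 1 - a i ⬝ᵥ x - deformTerm δ i u :=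
    fun i => abs_le_of_segmentSign_mul_le (hz i)
  have hAx : 0 ≤ A * ‖x‖ := by positivity
  have huB : ∀ j < p, |u j| ≤ 2 * (1 + A * ‖x‖) := by
    intro j
    induction j with
    | zero => exact fun _ => (abs_le.2 ⟨ht0, ht1⟩).trans (by linarith)
    | succ j ih =>
      intro hj
      have hv : ((j : ℕ) : ZMod p).val = j := ZMod.val_natCast_of_lt (by omega)
      have h3 := habs (j : ℕ)
      rw [deformTerm, if_pos (by omega), hv, smul_eq_mul] at h3
      have h4 := (abs_le.1 (hAa (j : ℕ) x)).1
      have h5 := (abs_le.1 (ih (by omega))).1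
      nlinarith
  have hdef := abs_deformTerm_le hδ.le (by linarith) (by positivity) huB
  have hxb : ‖x‖ ≤ 6 / m := by
    obtain ⟨i, hi⟩ := hma x
    have h3 := (abs_nonneg _).trans (habs i)
    have h4 := (abs_le.1 (hdef i)).1
    rw [le_div_iff₀ hm]
    nlinarith [mul_le_mul_of_nonneg_right h2 (norm_nonneg x)]
  have hAb : A * ‖x‖ ≤ A * (6 / m) := mul_le_mul_of_nonneg_left hxb hA
  have huB' : ∀ j ≤ p, |u j| ≤ 4 * (1 + A * ‖x‖) := by
    intro j hj
    rcases hj.lt_or_eq with hj | rfl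
    · exact (huB j hj).trans (by linarith)
    · have hv : (((j - 1 : ℕ) : ZMod j)).val = j - 1 := ZMod.val_natCast_of_lt (by omega)
      have h3 := habs ((j - 1 : ℕ) : ZMod j)
      rw [hv, Nat.sub_add_cancel hp0] at h3
      have h4 := (abs_le.1 (hdef ((j - 1 : ℕ) : ZMod j))).1
      have h5 := (abs_le.1 (hAa ((j - 1 : ℕ) : ZMod j) x)).1
      nlinarith
  have h6 : 0 ≤ 6 / m := by positivity
  refine (pi_norm_le_iff_of_nonneg (by positivity)).2 fun l => ?_
  rw [Real.norm_eq_abs]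
  rcases lt_or_ge l.1 2 with hl | hl
  · have : |x ⟨l.1, hl⟩| ≤ ‖x‖ := norm_le_pi_norm x _
    have e : x ⟨l.1, hl⟩ = z l := rfl
    rw [e] at this
    linarith
  · have hb := huB' (p + 2 - l.1) (by omega)
    have e : u (p + 2 - l.1) = z l := by
      simp only [hu, fibre, LinearMap.proj_apply]
      congr 1
      ext
      simp only
      omega
    rw [e] at hb
    linarith

end Boundedness

section Projection

variable {p : ℕ} {a : ZMod p → Fin 2 → ℝ} {δ : ℝ}

/-- The projection to the first four coordinates. -/
def projFour (h : 4 ≤ 3 + p) : (Fin (3 + p) → ℝ) →ₗ[ℝ] Fin 4 → ℝ :=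
  LinearMap.funLeft ℝ ℝ (Fin.castLE h)

theorem dotProduct_projFour (h : 4 ≤ 3 + p) (c : Fin 4 → ℝ) (z : Fin (3 + p) → ℝ) :
    c ⬝ᵥ projFour h z = c 0 * planePart z 0 + c 1 * planePart z 1 + c 2 * fibre p p z +
      c 3 * fibre p (p - 1) z := by
  have e2 : fibre p p z = z ⟨2, by omega⟩ := by
    simp [fibre]
  have e3 : fibre p (p - 1) z = z ⟨3, by omega⟩ := by
    simp only [fibre, LinearMap.proj_apply]
    congr 2
    omega
  rw [e2, e3, dotProduct, Fin.sum_univ_four]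
  rfl

/-- A linear functional in terms of the coordinates of the plane and the fibre coordinates. -/
theorem exists_coefficients (g : (Fin (3 + p) → ℝ) →ₗ[ℝ] ℝ) :
    ∃ (α : Fin 2 → ℝ) (w : ℕ → ℝ),
      ∀ z, g z = α ⬝ᵥ planePart z + ∑ j ∈ Finset.range (p + 1), w j * fibre p j z := by
  refine ⟨fun l => g (Pi.single ⟨l, by omega⟩ 1),
    fun j => g (Pi.single ⟨p + 2 - j, by omega⟩ 1), fun z => ?_⟩
  let f : ℕ → ℝ := fun m => if h : m < 3 + p then g (Pi.single ⟨m, h⟩ 1) * z ⟨m, h⟩ else 0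
  have h1 : g z = ∑ m ∈ Finset.range (p + 1 + 2), f m := by
    rw [show p + 1 + 2 = 3 + p by omega, ← Fin.sum_univ_eq_sum_range,
      LinearMap.pi_apply_eq_sum_univ]
    refine Finset.sum_congr rfl fun l _ => ?_
    simp only [f, l.2, dif_pos, Fin.eta, smul_eq_mul]
    rw [mul_comm]
    congr 2
    ext m
    simp [Pi.single_apply, eq_comm]
  rw [h1, Finset.sum_range_succ', Finset.sum_range_succ', ← Finset.sum_range_reflect,
    dotProduct, Fin.sum_univ_two]
  have h2 : ∀ j ∈ Finset.range (p + 1), f (p + 1 - 1 - j + 1 + 1) =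
      g (Pi.single ⟨p + 2 - j, by omega⟩ 1) * fibre p j z := by
    intro j hj
    have hj := Finset.mem_range.1 hj
    have e : p + 1 - 1 - j + 1 + 1 = p + 2 - j := by omega
    simp only [f, e, fibre, LinearMap.proj_apply]
    rw [dif_pos (by omega)]
  rw [Finset.sum_congr rfl h2]
  have h3 : f 0 = g (Pi.single ⟨0, by omega⟩ 1) * planePart z 0 := dif_pos (by omega)
  have h4 : f (0 + 1) = g (Pi.single ⟨1, by omega⟩ 1) * planePart z 1 := dif_pos (by omega)
  rw [h3, h4]
  simp only [Fin.val_zero, Fin.val_one]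
  ring

/-- The remainders in the elimination of the fibre coordinates with prescribed coefficients. -/
def elimRemainder (δ : ℝ) (σ w : ℕ → ℝ) : ℕ → ℝ
  | 0 => 0
  | j + 1 => σ j * ((w j - elimRemainder δ σ w j) / δ)

theorem sum_elimRemainder (hδ : δ ≠ 0) (σ w u : ℕ → ℝ) (m : ℕ) :
    ∑ j ∈ Finset.range m, (w j - elimRemainder δ σ w j) / δ * (δ * u j + σ j * u (j + 1)) =
      ∑ j ∈ Finset.range m, w j * u j + elimRemainder δ σ w m * u m := by
  induction m with
  | zero => simp [elimRemainder]
  | succ m ih =>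
    rw [Finset.sum_range_succ, ih, Finset.sum_range_succ, elimRemainder]
    field_simp
    ring

theorem abs_elimRemainder_le (hδ : 0 < δ) (hδ3 : 3 * δ ≤ 1) {σ : ℕ → ℝ} (hσ : ∀ j, |σ j| = 1)
    {w : ℕ → ℝ} (hw0 : ∀ j, 0 ≤ w j) {m : ℕ} (hw : ∀ j < m, w j = δ ^ 2 * w (j + 1)) :
    ∀ j ≤ m, |elimRemainder δ σ w j| ≤ w j / 2 := by
  intro j
  induction j with
  | zero =>
    intro _
    have := hw0 0
    simp only [elimRemainder, abs_zero]
    positivity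
  | succ j ih =>
    intro hj
    have h1 := abs_le.1 (ih (by omega))
    rw [elimRemainder, abs_mul, hσ, one_mul, abs_div, abs_of_pos hδ, div_le_iff₀ hδ]
    have h2 : |w j - elimRemainder δ σ w j| ≤ 3 * δ * (δ * w (j + 1)) / 2 := by
      have := hw j (by omega)
      have h3 : 0 ≤ δ ^ 2 * w (j + 1) := mul_nonneg (sq_nonneg δ) (hw0 _)
      rw [abs_le]
      constructor <;> nlinarith
    have h3 : 0 ≤ δ * w (j + 1) := mul_nonneg hδ.le (hw0 _)
    nlinarith

/-- The multipliers eliminating the fibre coordinates that are killed by the projection. -/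
def multiplier (p : ℕ) (δ κ : ℝ) (σ w : ℕ → ℝ) (j : ℕ) : ℝ :=
  if j + 1 < p then (w j - elimRemainder δ σ w j) / δ else κ

variable [NeZero p]

theorem sum_zmod_val (f : ℕ → ℝ) : ∑ i : ZMod p, f i.val = ∑ j ∈ Finset.range p, f j := by
  obtain ⟨q, rfl⟩ := Nat.exists_eq_succ_of_ne_zero (NeZero.ne p)
  exact Fin.sum_univ_eq_sum_range f (q + 1)

theorem sum_multiplier_mul (hδ : δ ≠ 0) (κ : ℝ) (jv : ZMod p → ZMod 2) (w : ℕ → ℝ) {σ : ℕ → ℝ}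
    (hσ : ∀ i : ZMod p, σ i.val = segmentSign (jv i)) (z : Fin (3 + p) → ℝ) :
    ∑ i, multiplier p δ κ σ w i.val * deformedNormal a δ (Sum.inl (i, jv i)) z =
      (∑ i, multiplier p δ κ σ w i.val • a i) ⬝ᵥ planePart z +
        ∑ j ∈ Finset.range (p - 1), (w j - κ * δ ^ (2 * (p - j))) * fibre p j z +
        (elimRemainder δ σ w (p - 1) - κ * δ ^ 2) * fibre p (p - 1) z +
        κ * σ (p - 1) * fibre p p z := by
  obtain ⟨q, rfl⟩ := Nat.exists_eq_succ_of_ne_zero (NeZero.ne p)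
  let f : ℕ → ℝ := fun j => multiplier (q + 1) δ κ σ w j *
    ((if j + 1 < q + 1 then δ * fibre (q + 1) j z
      else -∑ k ∈ Finset.range (q + 1), δ ^ (2 * (q + 1 - k)) * fibre (q + 1) k z) +
      σ j * fibre (q + 1) (j + 1) z)
  have h1 : ∀ i : ZMod (q + 1),
      multiplier (q + 1) δ κ σ w i.val * deformedNormal a δ (Sum.inl (i, jv i)) z =
        (multiplier (q + 1) δ κ σ w i.val • a i) ⬝ᵥ planePart z + f i.val := by
    intro i
    rw [deformedNormal_inl, deformTerm, smul_dotProduct, ← hσ]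
    simp only [f, smul_eq_mul]
    ring
  simp only [Nat.succ_eq_add_one]
  rw [Finset.sum_congr rfl fun i _ => h1 i, Finset.sum_add_distrib, sum_zmod_val,
    ← sum_dotProduct, Finset.sum_range_succ]
  have h2 : ∀ j ∈ Finset.range q, f j = (w j - elimRemainder δ σ w j) / δ *
      (δ * fibre (q + 1) j z + σ j * fibre (q + 1) (j + 1) z) := by
    intro j hj
    have hj := Finset.mem_range.1 hj
    simp only [f, multiplier]
    rw [if_pos (by omega), if_pos (by omega)]
  rw [Finset.sum_congr rfl h2, sum_elimRemainder hδ σ w (fun j => fibre (q + 1) j z)]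
  simp only [f, multiplier, lt_self_iff_false, if_false, Nat.add_sub_cancel,
    Finset.sum_range_succ, sub_mul, Finset.sum_sub_distrib, mul_assoc, ← Finset.mul_sum]
  rw [Nat.add_sub_cancel_left]
  ring

theorem natCast_val_signs (jv : ZMod p → ZMod 2) (i : ZMod p) :
    segmentSign (jv ((i.val : ℕ) : ZMod p)) = segmentSign (jv i) := by
  rw [ZMod.natCast_zmod_val]

theorem exists_positive_combination (h : 4 ≤ 3 + p) (a : ZMod p → Fin 2 → ℝ) (hδ : 0 < δ)
    (hδ3 : 3 * δ ≤ 1) (jv : ZMod p → ZMod 2) :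
    ∃ (μ : ZMod p → ℝ) (c : Fin 4 → ℝ), (∀ i, 0 < μ i) ∧ c 3 < 0 ∧
      ∀ z, ∑ i, μ i * deformedNormal a δ (Sum.inl (i, jv i)) z = c ⬝ᵥ projFour h z := by
  set σ : ℕ → ℝ := fun j => segmentSign (jv (j : ZMod p)) with hσ
  set w : ℕ → ℝ := fun j => δ ^ (2 * (p - j)) with hw
  set μ : ZMod p → ℝ := fun i => multiplier p δ 1 σ w i.val with hμ
  have hw0 : ∀ j, 0 < w j := fun j => pow_pos hδ _
  have hrem := abs_elimRemainder_le hδ hδ3 (σ := σ) (fun j => abs_segmentSign _)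
    (fun j => (hw0 j).le) (m := p - 1) fun j hj => by
      have hpj : p - (j + 1) + 1 = p - j := by omega
      simp only [hw]
      rw [← pow_add, ← hpj]
      ring_nf
  refine ⟨μ, ![(∑ i, μ i • a i) 0, (∑ i, μ i • a i) 1, σ (p - 1),
    elimRemainder δ σ w (p - 1) - δ ^ 2], fun i => ?_, ?_, fun z => ?_⟩
  · simp only [hμ, multiplier]
    split_ifs with hi
    · have := (abs_le.1 (hrem i.val (by omega))).2
      have := hw0 i.val
      exact div_pos (by linarith) hδ
    · exact one_pos
  · have h1 := (abs_le.1 (hrem (p - 1) le_rfl)).2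
    have h2 : w (p - 1) = δ ^ 2 := by
      have hp1 : p - (p - 1) = 1 := by
        have := NeZero.pos p
        omega
      simp only [hw, hp1, mul_one]
    have h3 : 0 < δ ^ 2 := by positivity
    rw [h2] at h1
    simp only [cons_val]
    linarith
  · rw [sum_multiplier_mul hδ.ne' 1 jv w (natCast_val_signs jv), dotProduct_projFour, dotProduct,
      Fin.sum_univ_two]
    simp only [hw, one_mul, sub_self, zero_mul, Finset.sum_const_zero, cons_val_zero, cons_val_one,
      cons_val]
    ring

theorem exists_eliminating_combination (h : 4 ≤ 3 + p) (a : ZMod p → Fin 2 → ℝ) (hδ : 0 < δ)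
    (jv : ZMod p → ZMod 2) (g : (Fin (3 + p) → ℝ) →ₗ[ℝ] ℝ) :
    ∃ (μ : ZMod p → ℝ) (c : Fin 4 → ℝ),
      ∀ z, g z + ∑ i, μ i * deformedNormal a δ (Sum.inl (i, jv i)) z = c ⬝ᵥ projFour h z := by
  obtain ⟨α, w, hg⟩ := exists_coefficients g
  set σ : ℕ → ℝ := fun j => segmentSign (jv (j : ZMod p)) with hσ
  set μ : ZMod p → ℝ := fun i => multiplier p δ 0 σ (-w) i.val with hμ
  refine ⟨μ, ![α 0 + (∑ i, μ i • a i) 0, α 1 + (∑ i, μ i • a i) 1, w p,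
    elimRemainder δ σ (-w) (p - 1) + w (p - 1)], fun z => ?_⟩
  rw [sum_multiplier_mul hδ.ne' 0 jv (-w) (natCast_val_signs jv), dotProduct_projFour, hg,
    dotProduct, dotProduct, Fin.sum_univ_two, Fin.sum_univ_two, Finset.sum_range_succ]
  have hs : ∑ j ∈ Finset.range p, w j * fibre p j z =
      ∑ j ∈ Finset.range (p - 1), w j * fibre p j z + w (p - 1) * fibre p (p - 1) z := by
    rw [← Finset.sum_range_succ, Nat.sub_add_cancel (Nat.pos_of_ne_zero (NeZero.ne p))]
  rw [hs]
  simp only [cons_val_zero, cons_val_one, cons_val, zero_mul, sub_zero, Pi.neg_apply, neg_mul,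
    Finset.sum_neg_distrib]
  ring

theorem eq_zero_of_projFour_eq_zero (h : 4 ≤ 3 + p) (hδ : 0 < δ) (jv : ZMod p → ZMod 2)
    {d : Fin (3 + p) → ℝ} (hd : ∀ i, deformedNormal a δ (Sum.inl (i, jv i)) d = 0)
    (hd' : projFour h d = 0) : d = 0 := by
  ext l
  obtain ⟨μ, c, hc⟩ := exists_eliminating_combination h a hδ jv (LinearMap.proj l)
  have := hc d
  simpa [hd, hd'] using this

/-- Faces of the deformed prism on which one inequality of each pair is tight lie on the lower hull
with respect to the projection. -/
theorem exists_lower_normal (h : 4 ≤ 3 + p) (hδ : 0 < δ) (hδ3 : 3 * δ ≤ 1) (jv : ZMod p → ZMod 2)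
    {F : Set (Fin (3 + p) → ℝ)} (hF : IsFaceOf F (deformedPrism a δ))
    (hFj : ∀ z ∈ F, ∀ i, deformedNormal a δ (Sum.inl (i, jv i)) z = 1) :
    ∃ (c : Fin 4 → ℝ) (β : ℝ), c 3 < 0 ∧ (∀ z ∈ deformedPrism a δ, c ⬝ᵥ projFour h z ≤ β) ∧
      F = {z ∈ deformedPrism a δ | c ⬝ᵥ projFour h z = β} := by
  obtain ⟨hFW, g, b, hg, hFe⟩ := hF
  obtain ⟨μ, c, hc⟩ := exists_eliminating_combination h a hδ jv g
  obtain ⟨μ', c', hμ', hc'3, hc'⟩ := exists_positive_combination h a hδ hδ3 jv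
  obtain ⟨K, hK, hK3⟩ : ∃ K : ℝ, (∀ i, 0 ≤ μ i + K * μ' i) ∧ c 3 + K * c' 3 < 0 := by
    refine Filter.Eventually.exists (f := Filter.atTop)
      (Filter.Eventually.and (Filter.eventually_all.2 fun i => ?_) ?_)
    · exact (Filter.tendsto_atTop_add_const_left _ _
        (Filter.tendsto_id.atTop_mul_const (hμ' i))).eventually_ge_atTop 0
    · exact (Filter.tendsto_atBot_add_const_left _ _
        (Filter.tendsto_id.atTop_mul_const_of_neg hc'3)).eventually_lt_atBot 0
  have key : ∀ z, (c + K • c') ⬝ᵥ projFour h z =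
      g z + ∑ i, (μ i + K * μ' i) * deformedNormal a δ (Sum.inl (i, jv i)) z := by
    intro z
    rw [add_dotProduct, smul_dotProduct, ← hc, ← hc', smul_eq_mul, Finset.mul_sum, add_assoc,
      ← Finset.sum_add_distrib]
    congr 1
    exact Finset.sum_congr rfl fun i _ => by ring
  have hle : ∀ z ∈ deformedPrism a δ,
      ∑ i, (μ i + K * μ' i) * deformedNormal a δ (Sum.inl (i, jv i)) z ≤
        ∑ i, (μ i + K * μ' i) := fun z hz =>
    Finset.sum_le_sum fun i _ => mul_le_of_le_one_right (hK i) (hz (Sum.inl (i, jv i)))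
  refine ⟨c + K • c', b + ∑ i, (μ i + K * μ' i), hK3, fun z hz => ?_, ?_⟩
  · rw [key]
    exact add_le_add (hg z hz) (hle z hz)
  · ext z
    rw [mem_ofPred_eq, key]
    constructor
    · intro hz
      refine ⟨hFW hz, ?_⟩
      have h1 : g z = b := (hFe ▸ hz : z ∈ {x ∈ deformedPrism a δ | g x = b}).2
      rw [h1, Finset.sum_congr rfl fun i _ => by rw [hFj z hz i, mul_one]]
    · rintro ⟨hz, he⟩
      rw [hFe]
      exact ⟨hz, le_antisymm (hg z hz) (by linarith [hle z hz])⟩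

end Projection

section SurfaceFaces

variable {p : ℕ}

/-- The inequalities determining a face of the prism over the surface, given by an encoding vector
and a face of the interval. -/
def surfaceTight (H : ZMod p → Set (ZMod 2)) (τ : Option Bool) :
    Set ((ZMod p × ZMod 2) ⊕ Bool) :=
  {f | f.elim (fun ij => ij.2 ∈ H ij.1) fun β => τ = some β}

theorem surfaceTight_none_subset {H H' : ZMod p → Set (ZMod 2)} {τ : Option Bool} :
    surfaceTight H none ⊆ surfaceTight H' τ ↔ ∀ i, H i ⊆ H' i := by
  constructor
  · intro h i j hj
    exact @h (Sum.inl (i, j)) hj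
  · rintro h (⟨i, j⟩ | β) hf
    · exact h i hf
    · simp [surfaceTight] at hf

theorem compl_singleton_zmod_two (j : ZMod 2) : ({j}ᶜ : Set (ZMod 2)) = {j + 1} := by
  ext i
  simp only [mem_compl_iff, mem_singleton_iff]
  revert i j
  decide

theorem prismTight_eq_surfaceTight {H : ZMod p → Set (ZMod 2)} {Z : Set (ZMod p)}
    (hZ : ∀ i ∈ Z, H i = univ) (hZ' : ∀ i ∉ Z, ∃ j : ZMod 2, H i = {j}ᶜ) (τ : Option Bool) :
    ∃ st, surfaceTight H τ = prismTight Z st τ := by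
  have : ∀ i, ∃ s : Option (ZMod 2), ∀ j, j ∈ H i ↔ i ∈ Z ∨ s = some j := by
    intro i
    by_cases hi : i ∈ Z
    · exact ⟨none, fun j => by simp [hZ i hi, hi]⟩
    · obtain ⟨j, hj⟩ := hZ' i hi
      refine ⟨some (j + 1), fun j' => ?_⟩
      rw [hj, compl_singleton_zmod_two]
      simp [hi, eq_comm]
  choose st hst using this
  refine ⟨st, ?_⟩
  ext f
  rcases f with ⟨i, j⟩ | β
  · exact hst i j
  · exact Iff.rfl

/-- The `p`-gons at a vertex of the surface. -/
theorem ncard_polygons_at_vertex (hp : 3 ≤ p) {V : ZMod p → Set (ZMod 2)} (hV : IsVertVec p 2 V) :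
    {jv : ZMod p → ZMod 2 | ∀ i, ({jv i}ᶜ : Set (ZMod 2)) ⊆ V i}.ncard = 4 := by
  have h1 : (1 : ZMod p) ≠ 0 := by
    simpa using zmod_natCast_ne_zero (p := p) (m := 1) (by omega) (by omega)
  obtain ⟨k, hk, hk1, h⟩ := hV
  have : ∀ i, ∃ j : ZMod 2, i ≠ k → i ≠ k + 1 → V i = {j}ᶜ := by
    intro i
    by_cases hi : i = k
    · exact ⟨0, fun h => (h hi).elim⟩
    by_cases hi1 : i = k + 1
    · exact ⟨0, fun _ h => (h hi1).elim⟩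
    obtain ⟨j, hj⟩ := h i hi hi1
    exact ⟨j, fun _ _ => hj⟩
  choose jv hjv using this
  have hkk : k + 1 ≠ k := fun h => h1 (by linear_combination h)
  let g : ZMod 2 × ZMod 2 → ZMod p → ZMod 2 := fun xy =>
    Function.update (Function.update jv k xy.1) (k + 1) xy.2
  have hg0 : ∀ xy, g xy k = xy.1 := fun xy => by simp [g, hkk.symm]
  have hg1 : ∀ xy, g xy (k + 1) = xy.2 := fun xy => by simp [g]
  have hg : ∀ xy i, i ≠ k → i ≠ k + 1 → g xy i = jv i := fun xy i hi hi1 => by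
    simp [g, hi, hi1]
  have hinj : Function.Injective g := fun xy xy' hxy =>
    Prod.ext (by rw [← hg0, hxy, hg0]) (by rw [← hg1, hxy, hg1])
  have hrange : {jv : ZMod p → ZMod 2 | ∀ i, ({jv i}ᶜ : Set (ZMod 2)) ⊆ V i} = range g := by
    ext σ
    constructor
    · intro hσ
      refine ⟨(σ k, σ (k + 1)), funext fun i => ?_⟩
      by_cases hi : i = k
      · rw [hi, hg0]
      by_cases hi1 : i = k + 1
      · rw [hi1, hg1]
      have := hσ i
      rw [hjv i hi hi1, compl_subset_compl, singleton_subset_iff] at this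
      rw [hg _ i hi hi1]
      exact this
    · rintro ⟨xy, rfl⟩ i
      by_cases hi : i = k
      · simp [hi, hk]
      by_cases hi1 : i = k + 1
      · simp [hi1, hk1]
      rw [hjv i hi hi1, hg _ i hi hi1]
  rw [hrange, ← image_univ, ncard_image_of_injective _ hinj, ncard_univ, Nat.card_prod]
  simp

variable [NeZero p]

theorem surfaceTight_mem_wedgePrismTightSets {H : ZMod p → Set (ZMod 2)}
    (hH : H ∈ sigmaFaces p 2) (τ : Option Bool) : surfaceTight H τ ∈ wedgePrismTightSets p := by
  rcases hH with ⟨k, hk, hk1, h⟩ | ⟨k, hk, h⟩ | ⟨jv, -, h⟩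
  · obtain ⟨st, hst⟩ := prismTight_eq_surfaceTight (Z := {k, k + 1})
      (by rintro i (rfl | rfl) <;> assumption) (fun i hi => by
        simp only [mem_insert_iff, mem_singleton_iff, not_or] at hi
        exact h i hi.1 hi.2) τ
    exact ⟨_, Or.inr ⟨k, Or.inr rfl⟩, st, τ, hst⟩
  · obtain ⟨st, hst⟩ := prismTight_eq_surfaceTight (Z := {k})
      (by rintro i rfl; assumption) (fun i hi => h i hi) τ
    exact ⟨_, Or.inr ⟨k, Or.inl rfl⟩, st, τ, hst⟩
  · obtain ⟨st, hst⟩ := prismTight_eq_surfaceTight (Z := ∅)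
      (by simp) (fun i _ => ⟨jv i, h i⟩) τ
    exact ⟨_, Or.inl rfl, st, τ, hst⟩

theorem exists_compl_singleton_subset {H : ZMod p → Set (ZMod 2)} (hH : H ∈ sigmaFaces p 2) :
    ∃ jv : ZMod p → ZMod 2, ∀ i, ({jv i}ᶜ : Set (ZMod 2)) ⊆ H i := by
  have : ∀ i, ∃ j : ZMod 2, ({j}ᶜ : Set (ZMod 2)) ⊆ H i := by
    intro i
    rcases hH with ⟨k, hk, hk1, h⟩ | ⟨k, hk, h⟩ | ⟨jv, -, h⟩
    · by_cases hi : i = k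
      · exact ⟨0, by simp [hi, hk]⟩
      by_cases hi1 : i = k + 1
      · exact ⟨0, by simp [hi1, hk1]⟩
      · obtain ⟨j, hj⟩ := h i hi hi1
        exact ⟨j, hj.superset⟩
    · by_cases hi : i = k
      · exact ⟨0, by simp [hi, hk]⟩
      · obtain ⟨j, hj⟩ := h i hi
        exact ⟨j, hj.superset⟩
    · exact ⟨jv i, (h i).superset⟩
  exact ⟨fun i => (this i).choose, fun i => (this i).choose_spec⟩

end SurfaceFaces

section ConvexHulls

variable {E : Type*} [AddCommGroup E] [Module ℝ E]

theorem mem_convexHull_of_eq {S : Set E} {c : E →ₗ[ℝ] ℝ} {s : ℝ} (hS : ∀ x ∈ S, s ≤ c x) {x : E}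
    (hx : x ∈ convexHull ℝ S) (hxs : c x = s) : x ∈ convexHull ℝ {y ∈ S | c y = s} := by
  set K := convexHull ℝ {y ∈ S | c y = s} with hK
  have hKs : ∀ y ∈ K, c y = s := convexHull_min (fun y hy => hy.2) (convex_hyperplane c.isLinear s)
  have hconv : Convex ℝ ({y | s < c y} ∪ K) := by
    intro y hy z hz α β hα hβ hαβ
    have hle : ∀ y ∈ {y | s < c y} ∪ K, s ≤ c y := fun y hy =>
      hy.elim (fun h => le_of_lt h) fun h => (hKs y h).ge
    have hy' := hle y hy
    have hz' := hle z hz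
    rcases hα.eq_or_lt with rfl | hα
    · rw [zero_add] at hαβ
      simpa [hαβ] using hz
    rcases hβ.eq_or_lt with rfl | hβ
    · rw [add_zero] at hαβ
      simpa [hαβ] using hy
    have e : c (α • y + β • z) = α * c y + β * c z := by simp
    have hs : α * s + β * s = s := by rw [← add_mul, hαβ, one_mul]
    rcases hy with hy | hy
    · have hy : s < c y := hy
      left
      rw [mem_ofPred_eq, e]
      linarith [mul_lt_mul_of_pos_left hy hα, mul_le_mul_of_nonneg_left hz' hβ.le]
    rcases hz with hz | hz
    · have hz : s < c z := hz
      left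
      rw [mem_ofPred_eq, e]
      linarith [mul_lt_mul_of_pos_left hz hβ, mul_le_mul_of_nonneg_left hy' hα.le]
    · exact Or.inr (convex_convexHull ℝ _ hy hz hα.le hβ.le hαβ)
  have hsub : S ⊆ {y | s < c y} ∪ K := fun y hy =>
    (hS y hy).lt_or_eq.imp id fun h => subset_convexHull ℝ _ ⟨hy, h.symm⟩
  exact (convexHull_min hsub hconv hx).elim (fun h => absurd hxs (ne_of_gt h)) id

theorem convexHull_inter_subset {S S' : Set E} {c : E →ₗ[ℝ] ℝ} {s : ℝ} (hS : ∀ x ∈ S, s ≤ c x)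
    (hS' : ∀ x ∈ S', c x ≤ s) :
    convexHull ℝ S ∩ convexHull ℝ S' ⊆ convexHull ℝ {y ∈ S | c y = s} := fun _ hx =>
  mem_convexHull_of_eq hS hx.1 <| le_antisymm
    (convexHull_min hS' (convex_halfSpace_le c.isLinear s) hx.2)
    (convexHull_min hS (convex_halfSpace_ge c.isLinear s) hx.1)

theorem notMem_convexHull_of_lt {S : Set E} {c : E →ₗ[ℝ] ℝ} {s : ℝ} (hS : ∀ x ∈ S, s < c x) {x : E}
    (hx : c x = s) : x ∉ convexHull ℝ S := fun h =>
  absurd hx (ne_of_gt (convexHull_min hS (convex_halfSpace_gt c.isLinear s) h))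

theorem setDim_convexHull (S : Set E) :
    setDim (convexHull ℝ S) = Module.finrank ℝ (vectorSpan ℝ S) := by
  rw [setDim, affineSpan_convexHull, direction_affineSpan]

/-- A finite set of points in convex position lying in a plane, but having at least three points,
spans the plane. -/
theorem finrank_vectorSpan_eq_two {S : Set (Fin 3 → ℝ)} (hS : 2 < S.ncard)
    (hext : ∀ x ∈ S, x ∉ convexHull ℝ (S \ {x})) {c : (Fin 3 → ℝ) →ₗ[ℝ] ℝ} (hc : c ≠ 0) {s : ℝ}
    (hcS : ∀ x ∈ S, c x = s) : Module.finrank ℝ (vectorSpan ℝ S) = 2 := by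
  apply le_antisymm
  · have hle : vectorSpan ℝ S ≤ LinearMap.ker c := by
      rw [vectorSpan_def, Submodule.span_le]
      rintro _ ⟨x, hx, y, hy, rfl⟩
      simp [hcS x hx, hcS y hy]
    have hlt := Submodule.finrank_lt (s := LinearMap.ker c) (by rwa [Ne, LinearMap.ker_eq_top])
    rw [Module.finrank_fin_fun] at hlt
    have := Submodule.finrank_mono hle
    omega
  · by_contra! hlt
    have hcol : Collinear ℝ S := collinear_iff_finrank_le_one.2 (by omega)
    obtain ⟨x, y, z, hx, hy, hz, hxy, hxz, hyz⟩ :=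
      (two_lt_ncard_iff (finite_of_ncard_pos (by omega))).1 hS
    have hsub : ({x, y, z} : Set (Fin 3 → ℝ)) ⊆ S := by
      rintro _ (rfl | rfl | rfl) <;> assumption
    have key : ∀ u ∈ S, ∀ v ∈ S, ∀ w ∈ S, u ≠ v → w ≠ v → ¬Wbtw ℝ u v w := by
      intro u hu v hv w hw huv hwv h
      rw [← mem_segment_iff_wbtw] at h
      exact hext v hv (segment_subset_convexHull (mem_sdiff_singleton.2 ⟨hu, huv⟩)
        (mem_sdiff_singleton.2 ⟨hw, hwv⟩) h)
    rcases (hcol.subset hsub).wbtw_or_wbtw_or_wbtw with h | h | h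
    · exact key x hx y hy z hz hxy hyz.symm h
    · exact key y hy z hz x hx hyz hxz h
    · exact key z hz x hx y hy hxz.symm hxy.symm h

end ConvexHulls

section DeformedSurface

variable {p : ℕ} {a : ZMod p → Fin 2 → ℝ} {δ : ℝ}

theorem isClosed_deformedPrism : IsClosed (deformedPrism a δ) := by
  have : deformedPrism a δ = ⋂ f, {x | deformedNormal a δ f x ≤ 1} := by
    ext x
    simp [polyhedron]
  rw [this]
  exact isClosed_iInter fun f =>
    isClosed_le (deformedNormal a δ f).continuous_of_finiteDimensional continuous_const

theorem tightSet_zero : tightSet (deformedNormal a δ) 1 0 = ∅ := by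
  ext f
  simp [tightSet]

theorem zero_mem_deformedPrism : 0 ∈ deformedPrism a δ := fun f => by simp

variable [NeZero p]

theorem projFour_face_preserved (h : 4 ≤ 3 + p) (hδ : 0 < δ) (hδ3 : 3 * δ ≤ 1)
    (jv : ZMod p → ZMod 2) {F : Set (Fin (3 + p) → ℝ)} (hF : IsFaceOf F (deformedPrism a δ))
    (hFj : ∀ z ∈ F, ∀ i, deformedNormal a δ (Sum.inl (i, jv i)) z = 1) :
    (IsFaceOf (projFour h '' F) (projFour h '' deformedPrism a δ) ∧
      Nonempty ({X // IsFaceOf X F} ≃o {X // IsFaceOf X (projFour h '' F)}) ∧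
      projFour h ⁻¹' (projFour h '' F) ∩ deformedPrism a δ = F) ∧
    ∃ (c : Fin 4 → ℝ) (β : ℝ), c 3 < 0 ∧ (∀ z ∈ projFour h '' deformedPrism a δ, c ⬝ᵥ z ≤ β) ∧
      projFour h '' F = {z ∈ projFour h '' deformedPrism a δ | c ⬝ᵥ z = β} := by
  obtain ⟨c, β, hc3, hcβ, hFe⟩ := exists_lower_normal h hδ hδ3 jv hF hFj
  have hle : ∀ z ∈ projFour h '' deformedPrism a δ, c ⬝ᵥ z ≤ β := by
    rintro _ ⟨z, hz, rfl⟩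
    exact hcβ z hz
  have himage : projFour h '' F = {z ∈ projFour h '' deformedPrism a δ | c ⬝ᵥ z = β} := by
    ext y
    constructor
    · rintro ⟨z, hz, rfl⟩
      rw [hFe] at hz
      exact ⟨⟨z, hz.1, rfl⟩, hz.2⟩
    · rintro ⟨⟨z, hz, rfl⟩, hy⟩
      exact ⟨z, hFe ▸ ⟨hz, hy⟩, rfl⟩
  refine ⟨⟨⟨image_mono hF.1, dotProductBilin ℝ ℝ c, β, hle, himage⟩, ?_, ?_⟩,
    c, β, hc3, hle, himage⟩
  · let D : Submodule ℝ (Fin (3 + p) → ℝ) :=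
      ⨅ i, LinearMap.ker (deformedNormal a δ (Sum.inl (i, jv i)))
    refine nonempty_faceIso_image (D := D) (fun d hd hd' => ?_) fun x hx y hy => ?_
    · refine eq_zero_of_projFour_eq_zero h hδ jv (a := a) (fun i => ?_) hd'
      simpa using (Submodule.mem_iInf _).1 hd i
    · refine (Submodule.mem_iInf _).2 fun i => ?_
      rw [LinearMap.mem_ker, map_sub, hFj x hx, hFj y hy, sub_self]
  · refine subset_antisymm (fun z hz => ?_) fun z hz => ⟨⟨z, hz, rfl⟩, hF.1 hz⟩
    have h1 : projFour h z ∈ {z ∈ projFour h '' deformedPrism a δ | c ⬝ᵥ z = β} := himage ▸ hz.1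
    exact hFe ▸ ⟨hz.2, h1.2⟩

theorem zero_mem_interior_projFour (h : 4 ≤ 3 + p) :
    0 ∈ interior (projFour h '' deformedPrism a δ) := by
  let O : Set (Fin (3 + p) → ℝ) := ⋂ f, {x | deformedNormal a δ f x < 1}
  have hO : IsOpen O := isOpen_iInter_of_finite fun f =>
    isOpen_lt (deformedNormal a δ f).continuous_of_finiteDimensional continuous_const
  have hsurj : Function.Surjective (projFour h) :=
    LinearMap.funLeft_surjective_of_injective ℝ ℝ _ (Fin.castLE_injective h)
  have hopen : IsOpen (projFour h '' O) :=
    (projFour h).isOpenMap_of_finiteDimensional hsurj O hO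
  have hsub : O ⊆ deformedPrism a δ := fun x hx f => (mem_iInter.1 hx f).le
  exact interior_maximal (image_mono hsub) hopen
    ⟨0, mem_iInter.2 fun f => by simp, map_zero _⟩

theorem exists_lower_normal_surface (h : 4 ≤ 3 + p) (a : ZMod p → Fin 2 → ℝ) (hδ : 0 < δ)
    (hδ3 : 3 * δ ≤ 1) {H : ZMod p → Set (ZMod 2)} {jv : ZMod p → ZMod 2}
    (hj : ∀ i, ({jv i}ᶜ : Set (ZMod 2)) ⊆ H i) :
    ∃ (c : Fin 4 → ℝ) (β : ℝ), c 3 < 0 ∧ (∀ z ∈ deformedPrism a δ, c ⬝ᵥ projFour h z ≤ β) ∧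
      ∀ z ∈ deformedPrism a δ, c ⬝ᵥ projFour h z = β ↔
        surfaceTight H none ⊆ tightSet (deformedNormal a δ) 1 z := by
  obtain ⟨c, β, hc3, hcβ, hFe⟩ := exists_lower_normal h hδ hδ3 (fun i => jv i + 1)
    (isFaceOf_tightFace (n := deformedNormal a δ) (r := 1) (surfaceTight H none)) fun z hz i =>
      @hz.2 (Sum.inl (i, jv i + 1)) (hj i (by rw [compl_singleton_zmod_two]; rfl))
  refine ⟨c, β, hc3, hcβ, fun z hz => ?_⟩
  have := Set.ext_iff.1 hFe z
  simp only [tightFace, mem_ofPred_eq] at this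
  exact ⟨fun h => (this.2 ⟨hz, h⟩).2, fun h => (this.1 ⟨hz, h⟩).2⟩

theorem dotProduct_projFour_eq_of_subset (h : 4 ≤ 3 + p) {c : Fin 4 → ℝ} {β : ℝ}
    (hc : ∀ z ∈ deformedPrism a δ, c ⬝ᵥ projFour h z ≤ β) {x y : Fin (3 + p) → ℝ}
    (hx : x ∈ deformedPrism a δ) (hy : y ∈ deformedPrism a δ)
    (hxy : tightSet (deformedNormal a δ) 1 x ⊆ tightSet (deformedNormal a δ) 1 y)
    (hcx : c ⬝ᵥ projFour h x = β) : c ⬝ᵥ projFour h y = β :=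
  eq_of_tightSet_subset (c := (dotProductBilin ℝ ℝ c).comp (projFour h)) hx hy hxy hc hcx

/-- The prism over a face of the surface projects to two different copies of the face. -/
theorem projFour_ne (h : 4 ≤ 3 + p) (hδ : 0 < δ) {H : ZMod p → Set (ZMod 2)} {jv : ZMod p → ZMod 2}
    (hj : ∀ i, ({jv i}ᶜ : Set (ZMod 2)) ⊆ H i) {x y : Fin (3 + p) → ℝ}
    (hx : tightSet (deformedNormal a δ) 1 x = surfaceTight H (some true))
    (hy : tightSet (deformedNormal a δ) 1 y = surfaceTight H (some false)) :
    projFour h x ≠ projFour h y := by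
  intro hxy
  have hmem : ∀ i, jv i + 1 ∈ H i := fun i => hj i (by rw [compl_singleton_zmod_two]; rfl)
  have hd : x - y = 0 := by
    refine eq_zero_of_projFour_eq_zero h hδ (fun i => jv i + 1) (a := a) (fun i => ?_)
      (by rw [map_sub, hxy, sub_self])
    have h1 : Sum.inl (i, jv i + 1) ∈ tightSet (deformedNormal a δ) 1 x := hx ▸ hmem i
    have h2 : Sum.inl (i, jv i + 1) ∈ tightSet (deformedNormal a δ) 1 y := hy ▸ hmem i
    rw [map_sub, sub_eq_zero]
    exact h1.trans h2.symm
  have h1 : (Sum.inr true : (ZMod p × ZMod 2) ⊕ Bool) ∈ surfaceTight H (some false) := by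
    rw [← hy, ← sub_eq_zero.1 hd, hx]
    exact rfl
  simp [surfaceTight] at h1

theorem exists_tightSet_eq_surfaceTight
    (hT : tightSet (deformedNormal a δ) 1 '' deformedPrism a δ = wedgePrismTightSets p)
    {H : ZMod p → Set (ZMod 2)} (hH : H ∈ sigmaFaces p 2) (τ : Option Bool) :
    ∃ z ∈ deformedPrism a δ, tightSet (deformedNormal a δ) 1 z = surfaceTight H τ :=
  hT.superset (surfaceTight_mem_wedgePrismTightSets hH τ)

theorem finrank_le_two_of_dotProduct_eq_one {x y : Fin 4 → ℝ} (hxy : x ≠ y) {S : Set (Fin 4 → ℝ)}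
    (hx : ∀ c ∈ S, c ⬝ᵥ x = 1) (hy : ∀ c ∈ S, c ⬝ᵥ y = 1) : setDim S ≤ 2 := by
  rw [setDim, direction_affineSpan]
  rcases S.eq_empty_or_nonempty with rfl | ⟨c, hc⟩
  · rw [vectorSpan_empty, finrank_bot]
    exact Nat.zero_le 2
  let M : Matrix (Fin 2) (Fin 4) ℝ := ![x, y]
  have hle : vectorSpan ℝ S ≤ LinearMap.ker M.mulVecLin := by
    rw [vectorSpan_def, Submodule.span_le]
    rintro _ ⟨u, hu, v, hv, rfl⟩
    simp only [vsub_eq_sub, SetLike.mem_coe, LinearMap.mem_ker, mulVecLin_apply]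
    ext m
    fin_cases m
    · change x ⬝ᵥ (u - v) = 0
      rw [dotProduct_comm, sub_dotProduct, hx u hu, hx v hv, sub_self]
    · change y ⬝ᵥ (u - v) = 0
      rw [dotProduct_comm, sub_dotProduct, hy u hu, hy v hv, sub_self]
  have hli : LinearIndependent ℝ M := by
    rw [LinearIndependent.pair_iff]
    intro s t hst
    have h1 : s + t = 0 := by
      have := congrArg (c ⬝ᵥ ·) hst
      simpa [hx c hc, hy c hc] using this
    have h2 : s • (x - y) = 0 := by
      rw [smul_sub, sub_eq_add_neg, ← neg_smul, ← eq_neg_of_add_eq_zero_right h1]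
      exact hst
    have h3 : s = 0 := (smul_eq_zero.1 h2).resolve_right (sub_ne_zero.2 hxy)
    exact ⟨h3, by linarith⟩
  have hrank : Module.finrank ℝ (LinearMap.range M.mulVecLin) = Fintype.card (Fin 2) :=
    hli.rank_matrix
  have hsum := M.mulVecLin.finrank_range_add_finrank_ker
  rw [hrank, Module.finrank_fin_fun, Fintype.card_fin] at hsum
  have := Submodule.finrank_mono hle
  omega

/-- The dual of the projected deformed prism contains the dual surface. -/
theorem exists_dual_faces (h : 4 ≤ 3 + p) (hδ : 0 < δ) (hδ3 : 3 * δ ≤ 1)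
    (hT : tightSet (deformedNormal a δ) 1 '' deformedPrism a δ = wedgePrismTightSets p) :
    ∃ ψ : (ZMod p → Set (ZMod 2)) → Set (Fin 4 → ℝ),
      Set.InjOn ψ (sigmaFaces p 2) ∧
      (∀ H ∈ sigmaFaces p 2,
        IsFaceOf (ψ H) {c | ∀ z ∈ projFour h '' deformedPrism a δ, c ⬝ᵥ z ≤ 1} ∧
        (ψ H).Nonempty ∧ setDim (ψ H) ≤ 2) ∧
      (∀ H ∈ sigmaFaces p 2, ∀ H' ∈ sigmaFaces p 2, (faceIncl H H' ↔ ψ H' ⊆ ψ H)) := by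
  let ψ : (ZMod p → Set (ZMod 2)) → Set (Fin 4 → ℝ) := fun H =>
    {c | (∀ z ∈ projFour h '' deformedPrism a δ, c ⬝ᵥ z ≤ 1) ∧ ∀ z ∈ deformedPrism a δ,
      surfaceTight H none ⊆ tightSet (deformedNormal a δ) 1 z → c ⬝ᵥ projFour h z = 1}
  have hne : ∀ H ∈ sigmaFaces p 2, ∃ c ∈ ψ H, ∀ z ∈ deformedPrism a δ,
      c ⬝ᵥ projFour h z = 1 → surfaceTight H none ⊆ tightSet (deformedNormal a δ) 1 z := by
    intro H hH
    obtain ⟨jv, hj⟩ := exists_compl_singleton_subset hH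
    obtain ⟨c, β, -, hcβ, hce⟩ := exists_lower_normal_surface h a hδ hδ3 hj
    have hβ : 0 < β := by
      refine lt_of_le_of_ne ?_ fun hβ => ?_
      · simpa using hcβ 0 zero_mem_deformedPrism
      · have h1 := (hce 0 zero_mem_deformedPrism).1 (by simpa using hβ)
        rw [tightSet_zero] at h1
        exact @h1 (Sum.inl (0, jv 0 + 1)) (hj 0 (by rw [compl_singleton_zmod_two]; rfl))
    have hdiv : ∀ z, (β⁻¹ • c) ⬝ᵥ projFour h z = 1 ↔ c ⬝ᵥ projFour h z = β := by
      intro z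
      rw [smul_dotProduct, smul_eq_mul, inv_mul_eq_one₀ hβ.ne', eq_comm]
    refine ⟨β⁻¹ • c, ⟨?_, fun z hz hzH => (hdiv z).2 ((hce z hz).2 hzH)⟩,
      fun z hz h1 => (hce z hz).1 ((hdiv z).1 h1)⟩
    rintro _ ⟨z, hz, rfl⟩
    rw [smul_dotProduct, smul_eq_mul, inv_mul_le_one₀ hβ]
    exact hcβ z hz
  have hincl : ∀ H ∈ sigmaFaces p 2, ∀ H' ∈ sigmaFaces p 2, (faceIncl H H' ↔ ψ H' ⊆ ψ H) := by
    intro H hH H' hH'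
    constructor
    · exact fun hHH' c hc => ⟨hc.1, fun z hz hzH =>
        hc.2 z hz ((surfaceTight_none_subset.2 hHH').trans hzH)⟩
    · intro hsub
      obtain ⟨c, hc, hc1⟩ := hne H' hH'
      obtain ⟨z, hz, hzT⟩ := exists_tightSet_eq_surfaceTight hT hH none
      have h1 := hc1 z hz ((hsub hc).2 z hz hzT.superset)
      rw [hzT] at h1
      exact surfaceTight_none_subset.1 h1
  refine ⟨ψ, fun H hH H' hH' hψ => funext fun i => ?_, fun H hH => ⟨?_, ?_, ?_⟩, hincl⟩
  · exact subset_antisymm ((hincl H' hH' H hH).2 hψ.subset i) ((hincl H hH H' hH').2 hψ.superset i)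
  · obtain ⟨z, hz, hzT⟩ := exists_tightSet_eq_surfaceTight hT hH none
    refine ⟨fun c hc => hc.1, (dotProductBilin ℝ ℝ).flip (projFour h z), 1,
      fun c hc => hc _ ⟨z, hz, rfl⟩, ?_⟩
    ext c
    refine ⟨fun hc => ⟨hc.1, hc.2 z hz hzT.superset⟩, fun hc => ⟨hc.1, fun y hy hyT => ?_⟩⟩
    exact dotProduct_projFour_eq_of_subset h (fun z hz => hc.1 _ ⟨z, hz, rfl⟩) hz hy
      (hzT ▸ hyT) hc.2
  · obtain ⟨c, hc, -⟩ := hne H hH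
    exact ⟨c, hc⟩
  · obtain ⟨jv, hj⟩ := exists_compl_singleton_subset hH
    obtain ⟨x, hx, hxT⟩ := exists_tightSet_eq_surfaceTight hT hH (some true)
    obtain ⟨y, hy, hyT⟩ := exists_tightSet_eq_surfaceTight hT hH (some false)
    exact finrank_le_two_of_dotProduct_eq_one (projFour_ne h hδ hj hxT hyT)
      (fun c hc => hc.2 x hx (hxT ▸ surfaceTight_none_subset.2 fun i => subset_rfl))
      (fun c hc => hc.2 y hy (hyT ▸ surfaceTight_none_subset.2 fun i => subset_rfl))

/-- The supporting hyperplanes of the projected `p`-gons, normalized as graphs of affine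
functions. -/
theorem exists_supporting_graphs (h : 4 ≤ 3 + p) (a : ZMod p → Fin 2 → ℝ) (hδ : 0 < δ)
    (hδ3 : 3 * δ ≤ 1) :
    ∃ (φ : (ZMod p → ZMod 2) → Fin 3 → ℝ) (η : (ZMod p → ZMod 2) → ℝ),
      ∀ jv, ∀ z ∈ deformedPrism a δ,
        φ jv ⬝ᵥ (fun l => projFour h z l.castSucc) ≤ η jv + projFour h z 3 ∧
        (φ jv ⬝ᵥ (fun l => projFour h z l.castSucc) = η jv + projFour h z 3 ↔
          surfaceTight (fun i => ({jv i}ᶜ : Set (ZMod 2))) none ⊆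
            tightSet (deformedNormal a δ) 1 z) := by
  choose c β hc3 hcβ hce using fun jv : ZMod p → ZMod 2 =>
    exists_lower_normal_surface h a hδ hδ3 (jv := jv) (fun i => subset_rfl)
  refine ⟨fun jv l => c jv l.castSucc / -c jv 3, fun jv => β jv / -c jv 3, fun jv z hz => ?_⟩
  have h3 : 0 < -c jv 3 := neg_pos.2 (hc3 jv)
  have e : (fun l : Fin 3 => c jv l.castSucc / -c jv 3) ⬝ᵥ (fun l => projFour h z l.castSucc) =
      c jv ⬝ᵥ projFour h z / -c jv 3 + projFour h z 3 := by
    simp only [dotProduct, Fin.sum_univ_castSucc (n := 3), add_div, Finset.sum_div]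
    have : c jv (Fin.last 3) * projFour h z (Fin.last 3) / -c jv 3 = -projFour h z 3 := by
      rw [div_eq_iff h3.ne']
      change c jv 3 * projFour h z 3 = _
      ring
    rw [this, neg_add_cancel_right]
    exact Finset.sum_congr rfl fun l _ => by ring
  rw [e, ← hce jv z hz, add_left_inj, add_le_add_iff_right, div_left_inj' h3.ne',
    div_le_div_iff_of_pos_right h3]
  exact ⟨hcβ jv z hz, Iff.rfl⟩

/-- The dual surface is realized as an embedded polyhedral surface. -/
theorem exists_embedded_surface (hp : 3 ≤ p) (h : 4 ≤ 3 + p) (hδ : 0 < δ) (hδ3 : 3 * δ ≤ 1)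
    (hT : tightSet (deformedNormal a δ) 1 '' deformedPrism a δ = wedgePrismTightSets p) :
    ∃ φ : (ZMod p → ZMod 2) → (Fin 3 → ℝ),
      Function.Injective φ ∧
      (∀ V, IsVertVec p 2 V →
        setDim (convexHull ℝ
            (φ '' {jv | ∀ i, ({jv i}ᶜ : Set (ZMod 2)) ⊆ V i})) = 2 ∧
        (φ '' {jv | ∀ i, ({jv i}ᶜ : Set (ZMod 2)) ⊆ V i}).ncard = 4 ∧
        ∀ x ∈ φ '' {jv | ∀ i, ({jv i}ᶜ : Set (ZMod 2)) ⊆ V i},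
          x ∉ convexHull ℝ
            ((φ '' {jv | ∀ i, ({jv i}ᶜ : Set (ZMod 2)) ⊆ V i}) \ {x})) ∧
      (∀ V V', IsVertVec p 2 V → IsVertVec p 2 V' →
        convexHull ℝ (φ '' {jv | ∀ i, ({jv i}ᶜ : Set (ZMod 2)) ⊆ V i}) ∩
          convexHull ℝ (φ '' {jv | ∀ i, ({jv i}ᶜ : Set (ZMod 2)) ⊆ V' i}) =
        convexHull ℝ (φ '' ({jv | ∀ i, ({jv i}ᶜ : Set (ZMod 2)) ⊆ V i} ∩
          {jv | ∀ i, ({jv i}ᶜ : Set (ZMod 2)) ⊆ V' i}))) := by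
  obtain ⟨φ, η, hφ⟩ := exists_supporting_graphs h a hδ hδ3
  let q : (Fin (3 + p) → ℝ) → Fin 3 → ℝ := fun z l => projFour h z l.castSucc
  let r : (Fin (3 + p) → ℝ) → ℝ := fun z => projFour h z 3
  have hle : ∀ jv, ∀ z ∈ deformedPrism a δ, φ jv ⬝ᵥ q z ≤ η jv + r z :=
    fun jv z hz => (hφ jv z hz).1
  have hiff : ∀ jv, ∀ z ∈ deformedPrism a δ, ∀ H τ,
      tightSet (deformedNormal a δ) 1 z = surfaceTight H τ →
        (φ jv ⬝ᵥ q z = η jv + r z ↔ ∀ i, ({jv i}ᶜ : Set (ZMod 2)) ⊆ H i) := by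
    intro jv z hz H τ hzT
    rw [← surfaceTight_none_subset (τ := τ), ← hzT]
    exact (hφ jv z hz).2
  have hpoly : ∀ jv : ZMod p → ZMod 2, ∃ z ∈ deformedPrism a δ, ∀ jv',
      φ jv' ⬝ᵥ q z = η jv' + r z ↔ jv' = jv := by
    intro jv
    have hmem : (fun i => ({jv i}ᶜ : Set (ZMod 2))) ∈ sigmaFaces p 2 :=
      Or.inr (Or.inr ⟨jv, zmod_two_cases _, fun i => rfl⟩)
    obtain ⟨z, hz, hzT⟩ := exists_tightSet_eq_surfaceTight hT hmem none
    refine ⟨z, hz, fun jv' => (hiff jv' z hz _ _ hzT).trans ?_⟩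
    simp only [compl_subset_compl, singleton_subset_iff, mem_singleton_iff, funext_iff, eq_comm]
  have hvert : ∀ V, IsVertVec p 2 V → ∀ τ : Option Bool, ∃ z ∈ deformedPrism a δ, ∀ jv,
      φ jv ⬝ᵥ q z = η jv + r z ↔ jv ∈ {jv | ∀ i, ({jv i}ᶜ : Set (ZMod 2)) ⊆ V i} := by
    intro V hV τ
    obtain ⟨z, hz, hzT⟩ := exists_tightSet_eq_surfaceTight hT (Or.inl hV) τ
    exact ⟨z, hz, fun jv => hiff jv z hz _ _ hzT⟩
  have hinj : Function.Injective φ := by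
    intro jv jv' he
    obtain ⟨z, hz, hzi⟩ := hpoly jv
    obtain ⟨z', hz', hzi'⟩ := hpoly jv'
    have h1 := (hzi jv).2 rfl
    have h2 := (hzi' jv').2 rfl
    have h3 := hle jv' z hz
    have h4 := hle jv z' hz'
    have h5 : φ jv' ⬝ᵥ q z = η jv' + r z := by
      rw [← he] at h2 h3 ⊢
      linarith
    exact ((hzi jv').1 h5).symm
  have hlin : ∀ z z' x, (dotProductBilin ℝ ℝ).flip (q z - q z') x = x ⬝ᵥ q z - x ⬝ᵥ q z' :=
    fun z z' x => dotProduct_sub x (q z) (q z')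
  have hext : ∀ V, IsVertVec p 2 V → ∀ x ∈ φ '' {jv | ∀ i, ({jv i}ᶜ : Set (ZMod 2)) ⊆ V i},
      x ∉ convexHull ℝ ((φ '' {jv | ∀ i, ({jv i}ᶜ : Set (ZMod 2)) ⊆ V i}) \ {x}) := by
    rintro V hV _ ⟨jv, hjv, rfl⟩
    obtain ⟨z, hz, hzi⟩ := hvert V hV none
    obtain ⟨z', hz', hzi'⟩ := hpoly jv
    refine notMem_convexHull_of_lt (c := (dotProductBilin ℝ ℝ).flip (q z - q z'))
      (s := r z - r z') ?_ ?_
    · rintro _ ⟨⟨jv', hjv', rfl⟩, hne⟩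
      have h1 := (hzi jv').2 hjv'
      have h2 := lt_of_le_of_ne (hle jv' z' hz')
        fun h => hne (congrArg φ ((hzi' jv').1 h))
      rw [hlin]
      linarith
    · have h1 := (hzi jv).2 hjv
      have h2 := (hzi' jv).2 rfl
      rw [hlin]
      linarith
  have hcard : ∀ V, IsVertVec p 2 V →
      (φ '' {jv | ∀ i, ({jv i}ᶜ : Set (ZMod 2)) ⊆ V i}).ncard = 4 := fun V hV => by
    rw [ncard_image_of_injective _ hinj, ncard_polygons_at_vertex hp hV]
  refine ⟨φ, hinj, fun V hV => ⟨?_, hcard V hV, hext V hV⟩, fun V V' hV hV' => ?_⟩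
  · rw [setDim_convexHull]
    obtain ⟨jv, hj⟩ := exists_compl_singleton_subset (Or.inl hV)
    obtain ⟨x, hx, hxT⟩ := exists_tightSet_eq_surfaceTight hT (Or.inl hV) (some true)
    obtain ⟨y, hy, hyT⟩ := exists_tightSet_eq_surfaceTight hT (Or.inl hV) (some false)
    have hS : ∀ u ∈ φ '' {jv | ∀ i, ({jv i}ᶜ : Set (ZMod 2)) ⊆ V i},
        (dotProductBilin ℝ ℝ).flip (q x - q y) u = r x - r y := by
      rintro _ ⟨jv', hjv', rfl⟩
      have h1 := (hiff jv' x hx _ _ hxT).2 hjv'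
      have h2 := (hiff jv' y hy _ _ hyT).2 hjv'
      rw [hlin]
      linarith
    refine finrank_vectorSpan_eq_two (by rw [hcard V hV]; norm_num) (hext V hV)
      (c := (dotProductBilin ℝ ℝ).flip (q x - q y)) (fun hzero => ?_) hS
    have hr : r x = r y := by
      have := hS (φ jv) ⟨jv, hj, rfl⟩
      rw [hzero, LinearMap.zero_apply] at this
      linarith
    have hq : ∀ l, q x l = q y l := by
      intro l
      have h1 := hlin x y (Pi.single l 1)
      rw [hzero, LinearMap.zero_apply, single_one_dotProduct, single_one_dotProduct] at h1
      linarith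
    exact projFour_ne h hδ hj hxT hyT (funext (Fin.lastCases hr hq))
  · refine subset_antisymm ?_ (subset_inter (convexHull_mono (image_mono inter_subset_left))
      (convexHull_mono (image_mono inter_subset_right)))
    obtain ⟨z, hz, hzi⟩ := hvert V hV none
    obtain ⟨z', hz', hzi'⟩ := hvert V' hV' none
    refine (convexHull_inter_subset (c := (dotProductBilin ℝ ℝ).flip (q z - q z'))
      (s := r z - r z') ?_ ?_).trans (convexHull_mono ?_)
    · rintro _ ⟨jv, hjv, rfl⟩
      have h1 := (hzi jv).2 hjv
      have h2 := hle jv z' hz'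
      rw [hlin]
      linarith
    · rintro _ ⟨jv, hjv, rfl⟩
      have h1 := (hzi' jv).2 hjv
      have h2 := hle jv z hz
      rw [hlin]
      linarith
    · rintro _ ⟨⟨jv, hjv, rfl⟩, he⟩
      refine ⟨jv, ⟨hjv, (hzi' jv).1 ?_⟩, rfl⟩
      have h1 := (hzi jv).2 hjv
      rw [hlin] at he
      linarith

theorem exists_deformation (hp : 3 ≤ p) (hbd : Bornology.IsBounded {x | ∀ i, a i ⬝ᵥ x ≤ 1})
    (ha : ∀ k, ∃ x, ∀ i, a i ⬝ᵥ x ≤ 1 ∧ (a i ⬝ᵥ x = 1 ↔ i = k ∨ i = k + 1)) :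
    ∃ δ : ℝ, 0 < δ ∧ 3 * δ ≤ 1 ∧ SlicesArePolygons a δ ∧
      Bornology.IsBounded (deformedPrism a δ) := by
  have hsmall : ∀ᶠ δ : ℝ in nhds 0, 3 * δ ≤ 1 :=
    Filter.Tendsto.eventually_le_const one_pos (Continuous.tendsto' (by fun_prop) 0 0 (by simp))
  have hpos : ∀ᶠ δ : ℝ in nhdsWithin 0 (Ioi 0), 0 < δ := self_mem_nhdsWithin
  exact (hpos.and ((hsmall.filter_mono nhdsWithin_le_nhds).and
    (((eventually_slicesArePolygons hp ha).filter_mono nhdsWithin_le_nhds).and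
      (eventually_isBounded_deformedPrism hbd)))).exists

end DeformedSurface

/-- For `p ≥ 3` the prism `W_{p,1} × I` over the wedge product
`W_{p,1} = C_p ⋈ Δ_1` admits a realization such that the prism `Σ_{p,4} × I` over the
surface survives the projection to `ℝ⁴` (all its faces are preserved and lie on the
lower hull); moreover the dual of the projected `4`-polytope contains the dual surface
`Σ_{p,4}*` as a subcomplex of its `2`-skeleton, and `Σ_{p,4}*` (an equivelar surface of
type `{4,p}`) is realized as an embedded polyhedral surface in `ℝ³`. -/
theorem prism_projection_and_dual_surface
    (p : ℕ) [NeZero p] (hp : 3 ≤ p)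
    -- the `p`-gon `C_p`:
    (a : ZMod p → Fin 2 → ℝ)
    (C : Set (Fin 2 → ℝ)) (hC : C = {x | ∀ i, a i ⬝ᵥ x ≤ 1})
    (hCbd : Bornology.IsBounded C) (hCdim : setDim C = 2)
    (hCfacets : ∀ i, IsFacetOf {x ∈ C | a i ⬝ᵥ x = 1} C)
    (hCinj : Function.Injective fun i => {x ∈ C | a i ⬝ᵥ x = 1})
    (hCall : ∀ G, IsFacetOf G C → ∃ i, G = {x ∈ C | a i ⬝ᵥ x = 1})
    (hCcyc : ∀ i i' : ZMod p,
      (∃ v, {x ∈ C | a i ⬝ᵥ x = 1} ∩ {x ∈ C | a i' ⬝ᵥ x = 1} = {v}) ↔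
        (i' = i + 1 ∨ i = i' + 1))
    -- the `1`-simplex (segment) `Δ_1`:
    (b : ZMod 2 → Fin 1 → ℝ)
    (Δ : Set (Fin 1 → ℝ)) (hΔ : Δ = {y | ∀ j, b j ⬝ᵥ y ≤ 1})
    (hΔbd : Bornology.IsBounded Δ) (hΔdim : setDim Δ = 1)
    (hΔfacets : ∀ j, IsFacetOf {y ∈ Δ | b j ⬝ᵥ y = 1} Δ)
    (hΔinj : Function.Injective fun j => {y ∈ Δ | b j ⬝ᵥ y = 1})
    (hΔall : ∀ G, IsFacetOf G Δ → ∃ j, G = {y ∈ Δ | b j ⬝ᵥ y = 1})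
    -- the wedge product `W = W_{p,1} = C_p ⋈ Δ_1` and its `p`-gon faces:
    (W : Set ((Fin 2 → ℝ) × (ZMod p → Fin 1 → ℝ)))
    (hW : W = {z | ∀ i j, a i ⬝ᵥ z.1 + b j ⬝ᵥ z.2 i ≤ 1})
    (G : (ZMod p → ZMod 2) → Set ((Fin 2 → ℝ) × (ZMod p → Fin 1 → ℝ)))
    (hG : ∀ jv, G jv =
      {z ∈ W | ∀ i, ∀ j', j' ≠ jv i → a i ⬝ᵥ z.1 + b j' ⬝ᵥ z.2 i = 1})
    -- the prism `W_{p,1} × I` over the wedge product: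
    (PW : Set (((Fin 2 → ℝ) × (ZMod p → Fin 1 → ℝ)) × ℝ))
    (hPW : PW = {z | z.1 ∈ W ∧ z.2 ∈ Set.Icc (0 : ℝ) 1})
    -- the projection to the first four coordinates:
    (π₄ : (Fin (3 + p) → ℝ) → (Fin 4 → ℝ))
    (hπ₄ : π₄ = fun x l => x (Fin.castLE (by omega) l)) :
    ∃ (W'' : Set (Fin (3 + p) → ℝ))
      (e : {F // IsFaceOf F PW} ≃o {F' // IsFaceOf F' W''}),
      -- `W''` is a realization of the prism `W_{p,1} × I` in `ℝ^{3+p}`: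
      Bornology.IsBounded W'' ∧ Convex ℝ W'' ∧ IsClosed W'' ∧
      -- every face of the prism `Σ_{p,4} × I` over the surface is preserved by `π₄`
      -- and its image lies on the lower hull of the `4`-polytope `π₄(W'')`:
      (∀ (F : Set (((Fin 2 → ℝ) × (ZMod p → Fin 1 → ℝ)) × ℝ)) (hF : IsFaceOf F PW),
        F.Nonempty → (∃ jv, F ⊆ (G jv) ×ˢ Set.Icc (0 : ℝ) 1) →
        ((IsFaceOf (π₄ '' (e ⟨F, hF⟩).1) (π₄ '' W'') ∧
          Nonempty ({X // IsFaceOf X (e ⟨F, hF⟩).1} ≃o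
            {X // IsFaceOf X (π₄ '' (e ⟨F, hF⟩).1)}) ∧
          π₄ ⁻¹' (π₄ '' (e ⟨F, hF⟩).1) ∩ W'' = (e ⟨F, hF⟩).1) ∧
        (∃ (c : Fin 4 → ℝ) (β : ℝ), c 3 < 0 ∧
          (∀ z ∈ π₄ '' W'', c ⬝ᵥ z ≤ β) ∧
          π₄ '' (e ⟨F, hF⟩).1 = {z ∈ π₄ '' W'' | c ⬝ᵥ z = β}))) ∧
      -- the dual of the projected `4`-polytope contains the dual surface `Σ_{p,4}*`
      -- as a subcomplex of its `2`-skeleton: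
      0 ∈ interior (π₄ '' W'') ∧
      (∃ ψ : (ZMod p → Set (ZMod 2)) → Set (Fin 4 → ℝ),
        Set.InjOn ψ (sigmaFaces p 2) ∧
        (∀ H ∈ sigmaFaces p 2,
          IsFaceOf (ψ H) {c | ∀ z ∈ π₄ '' W'', c ⬝ᵥ z ≤ 1} ∧
          (ψ H).Nonempty ∧ setDim (ψ H) ≤ 2) ∧
        (∀ H ∈ sigmaFaces p 2, ∀ H' ∈ sigmaFaces p 2,
          (faceIncl H H' ↔ ψ H' ⊆ ψ H))) ∧
      -- the dual surface `Σ_{p,4}*` is realized as an embedded polyhedral surface in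
      -- `ℝ³`: its vertices are the `p`-gons of `Σ_{p,4}`, its `2`-faces are the
      -- quadrilaterals dual to the vertices of `Σ_{p,4}`:
      (∃ φ : (ZMod p → ZMod 2) → (Fin 3 → ℝ),
        Function.Injective φ ∧
        (∀ V, IsVertVec p 2 V →
          setDim (convexHull ℝ
              (φ '' {jv | ∀ i, ({jv i}ᶜ : Set (ZMod 2)) ⊆ V i})) = 2 ∧
          (φ '' {jv | ∀ i, ({jv i}ᶜ : Set (ZMod 2)) ⊆ V i}).ncard = 4 ∧
          ∀ x ∈ φ '' {jv | ∀ i, ({jv i}ᶜ : Set (ZMod 2)) ⊆ V i},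
            x ∉ convexHull ℝ
              ((φ '' {jv | ∀ i, ({jv i}ᶜ : Set (ZMod 2)) ⊆ V i}) \ {x})) ∧
        (∀ V V', IsVertVec p 2 V → IsVertVec p 2 V' →
          convexHull ℝ (φ '' {jv | ∀ i, ({jv i}ᶜ : Set (ZMod 2)) ⊆ V i}) ∩
            convexHull ℝ (φ '' {jv | ∀ i, ({jv i}ᶜ : Set (ZMod 2)) ⊆ V' i}) =
          convexHull ℝ (φ '' ({jv | ∀ i, ({jv i}ᶜ : Set (ZMod 2)) ⊆ V i} ∩
            {jv | ∀ i, ({jv i}ᶜ : Set (ZMod 2)) ⊆ V' i})))) := by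
  have h4 : 4 ≤ 3 + p := by omega
  obtain rfl : π₄ = projFour h4 := hπ₄
  obtain rfl : PW = polyhedron (wedgePrismNormal a b) wedgePrismBound := by
    ext z
    rw [mem_wedgePrism, hPW, hW]
    rfl
  have ha := exists_polygon_vertex hp hC hCbd hCinj hCcyc
  obtain ⟨δ, hδ, hδ3, hslices, hbd⟩ := exists_deformation hp (hC ▸ hCbd) ha
  have hT := tightSet_image_deformedPrism hp hslices
  have hT' := tightSet_image_wedgePrism hp (mul_neg_of_isBounded (hΔ ▸ hΔbd)) ha
  refine ⟨deformedPrism a δ, faceIso (hT'.trans hT.symm) (hT' ▸ univ_notMem_wedgePrismTightSets),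
    hbd, convex_polyhedron _ _, isClosed_deformedPrism, ?_, zero_mem_interior_projFour h4,
    exists_dual_faces h4 hδ hδ3 hT, exists_embedded_surface hp h4 hδ hδ3 hT⟩
  rintro F hF - ⟨jv, hjv⟩
  refine projFour_face_preserved h4 hδ hδ3 (fun i => jv i + 1) (isFaceOf_tightFace _)
    fun z hz i => ?_
  refine @hz.2 (Sum.inl (i, jv i + 1)) fun x hx => ?_
  have hx1 := (hjv hx).1
  rw [hG] at hx1
  exact hx1.2 i (jv i + 1) (by simp)
end
end

section
/- Let P ⊂ R^d be a simple polytope with vertex set V and let A ⊆ V be an affine support set of P. Then the number of moduli of P, i.e. the local dimension of the realization space of P in a neighborhood of the given realization, is at least d·|A|. -/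
open Set

noncomputable section

def IsSimplePoly {V : Type*} [AddCommGroup V] [Module ℝ V] (P : Set V) : Prop :=
  ∀ v, IsVertexOf v P → {F | IsFacetOf F P ∧ v ∈ F}.ncard = setDim P

/-- The realization space of the polytope with vertices `x 0, …, x (n-1)`: all labeled
point configurations `y` whose convex hull is a polytope combinatorially equivalent to
the one of `x`, via a face-lattice isomorphism matching the labeled vertices. -/
def RealSpace (d n : ℕ) (x : Fin n → Fin d → ℝ) : Set (Fin n → Fin d → ℝ) :=
  {y | ∃ e : {F // IsFaceOf F (convexHull ℝ (Set.range x))} ≃o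
            {F // IsFaceOf F (convexHull ℝ (Set.range y))},
       ∀ (k : Fin n) (F : Set (Fin d → ℝ))
         (hF : IsFaceOf F (convexHull ℝ (Set.range x))),
         F = {x k} → (e ⟨F, hF⟩).1 = {y k}}

section Cone

variable {E : Type*} [AddCommGroup E] [Module ℝ E]

theorem exists_add_smul_nonpos_of_pos {n : ℕ} (w : Fin n → E) (c c' : Module.Dual ℝ E)
    (hc : ∀ j, c (w j) ≤ 0) (hzero : ∀ j, c (w j) = 0 → c' (w j) = 0)
    (hpos : ∃ j, 0 < c' (w j)) :
    ∃ t > (0 : ℝ), (∀ j, (c + t • c') (w j) ≤ 0) ∧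
      {j | (c + t • c') (w j) ≠ 0}.ncard < {j | c (w j) ≠ 0}.ncard := by
  classical
  obtain ⟨j₀, hj₀⟩ := hpos
  obtain ⟨m, hm, hmin⟩ := Finset.exists_min_image
    (Finset.univ.filter fun j => 0 < c' (w j)) (fun j => -c (w j) / c' (w j))
    ⟨j₀, by simpa using hj₀⟩
  simp only [Finset.mem_filter, Finset.mem_univ, true_and] at hm hmin
  have hneg : c (w m) < 0 := lt_of_le_of_ne (hc m) fun h => hm.ne' (hzero m h)
  have ht : 0 < -c (w m) / c' (w m) := div_pos (by linarith) hm
  refine ⟨-c (w m) / c' (w m), ht, fun j => ?_, ?_⟩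
  · simp only [LinearMap.add_apply, LinearMap.smul_apply, smul_eq_mul]
    rcases le_or_gt (c' (w j)) 0 with h | h
    · nlinarith [hc j, mul_nonneg ht.le (neg_nonneg.2 h)]
    · have := (le_div_iff₀ h).1 (hmin j h)
      linarith
  · refine Set.ncard_lt_ncard ⟨fun j hj h => hj ?_, fun h => ?_⟩ (Set.toFinite _)
    · simp [h, hzero j h]
    · refine h (a := m) hneg.ne ?_
      simp only [LinearMap.add_apply, LinearMap.smul_apply, smul_eq_mul]
      field_simp
      ring

/-- A functional that is nonpositive on a finite spanning family lies in the convex cone generated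
by those whose vanishing set in the family spans a hyperplane. -/
theorem mem_cone_of_nonpos [FiniteDimensional ℝ E] {n : ℕ} (w : Fin n → E)
    (hw : Submodule.span ℝ (Set.range w) = ⊤) (K : PointedCone ℝ (Module.Dual ℝ E))
    (hK : ∀ c : Module.Dual ℝ E, (∀ j, c (w j) ≤ 0) →
      Module.finrank ℝ (Submodule.span ℝ (w '' {j | c (w j) = 0})) + 1 = Module.finrank ℝ E →
      c ∈ K)
    (c : Module.Dual ℝ E) (hc : ∀ j, c (w j) ≤ 0) : c ∈ K := by
  induction hm : {j | c (w j) ≠ 0}.ncard using Nat.strong_induction_on generalizing c with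
  | _ m ih =>
  subst hm
  by_cases hc0 : c = 0
  · rw [hc0]; exact K.zero_mem
  set Z := Submodule.span ℝ (w '' {j | c (w j) = 0}) with hZ
  have hZker : Z ≤ LinearMap.ker c := by
    rw [hZ, Submodule.span_le]
    rintro _ ⟨j, hj, rfl⟩
    exact hj
  have hZtop : Z < ⊤ := lt_of_le_of_lt hZker
    (lt_top_iff_ne_top.2 fun h => hc0 (LinearMap.ker_eq_top.1 h))
  have hZlt : Module.finrank ℝ Z < Module.finrank ℝ E := Submodule.finrank_lt hZtop.ne
  by_cases hfr : Module.finrank ℝ Z + 1 = Module.finrank ℝ E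
  · exact hK c hc hfr
  have hlt : Z ⊔ Submodule.span ℝ {∑ j, w j} < ⊤ := by
    refine lt_top_iff_ne_top.2 fun h => ?_
    have h1 := Submodule.finrank_add_le_finrank_add_finrank Z (Submodule.span ℝ {∑ j, w j})
    have h2 := finrank_span_le_card (R := ℝ) ({∑ j, w j} : Set E)
    rw [h, finrank_top] at h1
    simp at h2
    omega
  obtain ⟨c', hc', hker⟩ := Submodule.exists_le_ker_of_lt_top _ hlt
  have hzero : ∀ j, c (w j) = 0 → c' (w j) = 0 := fun j hj =>
    hker (Submodule.mem_sup_left (Submodule.subset_span ⟨j, hj, rfl⟩))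
  have hsum : ∑ j, c' (w j) = 0 := by
    rw [← map_sum]
    exact hker (Submodule.mem_sup_right (Submodule.mem_span_singleton_self _))
  have hne : ∃ j ∈ Finset.univ, c' (w j) ≠ 0 := by
    by_contra! h
    refine hc' (LinearMap.ext_on hw ?_)
    rintro _ ⟨j, rfl⟩
    simpa using h j (Finset.mem_univ j)
  obtain ⟨j₁, -, hj₁⟩ := Finset.exists_pos_of_sum_zero_of_exists_nonzero _ hsum hne
  obtain ⟨j₂, -, hj₂⟩ := Finset.exists_pos_of_sum_zero_of_exists_nonzero (s := Finset.univ)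
    (fun j => (-c') (w j)) (by simpa using hsum) (by simpa using hne)
  obtain ⟨t, ht, ht1, ht2⟩ := exists_add_smul_nonpos_of_pos w c c' hc hzero ⟨j₁, hj₁⟩
  obtain ⟨s, hs, hs1, hs2⟩ := exists_add_smul_nonpos_of_pos w c (-c') hc
    (fun j hj => by simpa using hzero j hj) ⟨j₂, hj₂⟩
  have key : c = (s / (s + t)) • (c + t • c') + (t / (s + t)) • (c + s • (-c')) := by
    ext z
    simp
    field_simp
    ring
  rw [key]
  exact K.add_mem (K.smul_mem (by positivity : 0 ≤ s / (s + t)) (ih _ ht2 _ ht1 rfl))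
    (K.smul_mem (by positivity : 0 ≤ t / (s + t)) (ih _ hs2 _ hs1 rfl))

/-- Two nonzero functionals, nonpositive on a spanning family and vanishing on a common subfamily
spanning a hyperplane, are nonnegative multiples of one another. -/
theorem eq_smul_of_vanish_on_hyperplane [FiniteDimensional ℝ E] {n : ℕ} (w : Fin n → E)
    (hw : Submodule.span ℝ (Set.range w) = ⊤) (S : Set (Fin n))
    (hS : Module.finrank ℝ (Submodule.span ℝ (w '' S)) + 1 = Module.finrank ℝ E)
    (c g : Module.Dual ℝ E) (hc : ∀ j, c (w j) ≤ 0) (hg : ∀ j, g (w j) ≤ 0)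
    (hcS : ∀ j, c (w j) = 0 ↔ j ∈ S) (hgS : ∀ j ∈ S, g (w j) = 0) :
    ∃ r : ℝ, 0 ≤ r ∧ g = r • c := by
  have hex : ∃ j, j ∉ S := by
    by_contra! h
    rw [Set.eq_univ_of_forall h, Set.image_univ, hw, finrank_top] at hS
    omega
  obtain ⟨j₀, hj₀⟩ := hex
  have hneg : c (w j₀) < 0 := lt_of_le_of_ne (hc j₀) fun h => hj₀ ((hcS j₀).1 h)
  have hmem : w j₀ ∉ Submodule.span ℝ (w '' S) := by
    intro h
    have : Submodule.span ℝ (w '' S) ≤ LinearMap.ker c := by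
      rw [Submodule.span_le]
      rintro _ ⟨j, hj, rfl⟩
      exact (hcS j).2 hj
    exact hneg.ne (this h)
  have htop : Submodule.span ℝ (insert (w j₀) (w '' S)) = ⊤ := by
    have hlt : Submodule.span ℝ (w '' S) < Submodule.span ℝ (insert (w j₀) (w '' S)) :=
      lt_of_le_of_ne (Submodule.span_mono (Set.subset_insert _ _)) fun h =>
        hmem (h ▸ Submodule.subset_span (Set.mem_insert _ _))
    have h1 := Submodule.finrank_lt_finrank_of_lt hlt
    have h2 := Submodule.finrank_le (Submodule.span ℝ (insert (w j₀) (w '' S)))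
    exact Submodule.eq_top_of_finrank_eq (by omega)
  refine ⟨g (w j₀) / c (w j₀), div_nonneg_of_nonpos (hg j₀) hneg.le, LinearMap.ext_on htop ?_⟩
  rintro _ (rfl | ⟨j, hj, rfl⟩)
  · simp [hneg.ne]
  · simp [hgS j hj, (hcS j).2 hj]

end Cone

theorem exists_mul_add_nonpos {ι : Type*} [Finite ι] (p q : ι → ℝ)
    (h : ∀ j, p j < 0 ∨ (p j = 0 ∧ q j ≤ 0)) : ∃ N : ℝ, 0 ≤ N ∧ ∀ j, N * p j + q j ≤ 0 := by
  have : ∀ᶠ N : ℝ in Filter.atTop, 0 ≤ N ∧ ∀ j, N * p j + q j ≤ 0 := by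
    refine (Filter.eventually_ge_atTop 0).and (Filter.eventually_all.2 fun j => ?_)
    rcases h j with h | ⟨h, h'⟩
    · filter_upwards [Filter.eventually_ge_atTop (-q j / p j)] with N hN
      have := (div_le_iff_of_neg h).1 hN
      linarith
    · filter_upwards with N
      simpa [h] using h'
  exact this.exists

section Faces

variable {E : Type*} [AddCommGroup E] [Module ℝ E]

/-- The index sets of the members of a finite family lying on a common face of its hull. -/
def IsFaceIndexSet {n : ℕ} (y : Fin n → E) (S : Set (Fin n)) : Prop :=
  ∃ (c : Module.Dual ℝ E) (b : ℝ), (∀ j, c (y j) ≤ b) ∧ S = {j | c (y j) = b}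

theorem le_of_mem_convexHull_range {n : ℕ} {y : Fin n → E} {c : Module.Dual ℝ E} {b : ℝ}
    (h : ∀ j, c (y j) ≤ b) {z : E} (hz : z ∈ convexHull ℝ (Set.range y)) : c z ≤ b := by
  refine convexHull_min ?_ (convex_halfSpace_le c.isLinear b) hz
  rintro _ ⟨j, rfl⟩
  exact h j

theorem eq_of_mem_convexHull_image {n : ℕ} {y : Fin n → E} {c : Module.Dual ℝ E} {b : ℝ}
    {z : E} (hz : z ∈ convexHull ℝ (y '' {j | c (y j) = b})) : c z = b := by
  refine convexHull_min ?_ (convex_hyperplane c.isLinear b) hz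
  rintro _ ⟨j, hj, rfl⟩
  exact hj

theorem sep_convexHull_range_eq {n : ℕ} {y : Fin n → E} {c : Module.Dual ℝ E} {b : ℝ}
    (h : ∀ j, c (y j) ≤ b) :
    {z ∈ convexHull ℝ (Set.range y) | c z = b} = convexHull ℝ (y '' {j | c (y j) = b}) := by
  refine Set.Subset.antisymm ?_ fun z hz =>
    ⟨convexHull_mono (Set.image_subset_range _ _) hz, eq_of_mem_convexHull_image hz⟩
  rintro z ⟨hz, hzb⟩
  have hconv : Convex ℝ ({z | c z < b} ∪ convexHull ℝ (y '' {j | c (y j) = b})) := by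
    intro u hu v hv s t hs ht hst
    have hle : ∀ u ∈ {z | c z < b} ∪ convexHull ℝ (y '' {j | c (y j) = b}), c u ≤ b := by
      rintro u (hu | hu)
      · exact hu.le
      · exact (eq_of_mem_convexHull_image hu).le
    rcases hs.eq_or_lt with rfl | hs
    · obtain rfl : t = 1 := by linarith
      simpa using hv
    rcases ht.eq_or_lt with rfl | ht
    · obtain rfl : s = 1 := by linarith
      simpa using hu
    have hu' := hle u hu
    have hv' := hle v hv
    have hb : b = s * b + t * b := by rw [← add_mul, hst, one_mul]
    rcases hu with hu | hu
    · left
      have := mul_lt_mul_of_pos_left (show c u < b from hu) hs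
      have := mul_le_mul_of_nonneg_left hv' ht.le
      simp only [Set.mem_ofPred_eq, map_add, map_smul, smul_eq_mul]
      linarith
    rcases hv with hv | hv
    · left
      have := mul_lt_mul_of_pos_left (show c v < b from hv) ht
      have := mul_le_mul_of_nonneg_left hu' hs.le
      simp only [Set.mem_ofPred_eq, map_add, map_smul, smul_eq_mul]
      linarith
    · exact Or.inr (convex_convexHull ℝ _ hu hv hs.le ht.le hst)
  have hsub := convexHull_min (s := Set.range y) (by
    rintro _ ⟨j, rfl⟩
    rcases (h j).lt_or_eq with hj | hj
    · exact Or.inl hj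
    · exact Or.inr (subset_convexHull ℝ _ ⟨j, hj, rfl⟩)) hconv hz
  rcases hsub with hlt | hmem
  · exact absurd hzb hlt.ne
  · exact hmem

theorem IsFaceOf.isFaceIndexSet {n : ℕ} {y : Fin n → E} {F : Set E}
    (hF : IsFaceOf F (convexHull ℝ (Set.range y))) : IsFaceIndexSet y {j | y j ∈ F} := by
  obtain ⟨-, c, b, hle, rfl⟩ := hF
  refine ⟨c, b, fun j => hle _ (subset_convexHull ℝ _ ⟨j, rfl⟩), ?_⟩
  ext j
  exact ⟨fun h => h.2, fun h => ⟨subset_convexHull ℝ _ ⟨j, rfl⟩, h⟩⟩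

theorem IsFaceOf.eq_convexHull {n : ℕ} {y : Fin n → E} {F : Set E}
    (hF : IsFaceOf F (convexHull ℝ (Set.range y))) :
    F = convexHull ℝ (y '' {j | y j ∈ F}) := by
  obtain ⟨-, c, b, hle, rfl⟩ := hF
  have hmem : ∀ j, y j ∈ convexHull ℝ (Set.range y) := fun j => subset_convexHull ℝ _ ⟨j, rfl⟩
  rw [sep_convexHull_range_eq fun j => hle _ (hmem j)]
  congr 2
  ext j
  exact ⟨fun h => subset_convexHull ℝ _ ⟨j, h, rfl⟩, fun h => eq_of_mem_convexHull_image h⟩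

theorem IsFaceIndexSet.isFaceOf {n : ℕ} {y : Fin n → E} {S : Set (Fin n)}
    (hS : IsFaceIndexSet y S) :
    IsFaceOf (convexHull ℝ (y '' S)) (convexHull ℝ (Set.range y)) := by
  obtain ⟨c, b, h, rfl⟩ := hS
  exact ⟨convexHull_mono (Set.image_subset_range _ _), c, b,
    fun z hz => le_of_mem_convexHull_range h hz, (sep_convexHull_range_eq h).symm⟩

theorem IsFaceIndexSet.mem_convexHull_iff {n : ℕ} {y : Fin n → E} {S : Set (Fin n)}
    (hS : IsFaceIndexSet y S) (j : Fin n) : y j ∈ convexHull ℝ (y '' S) ↔ j ∈ S := by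
  refine ⟨fun h => ?_, fun h => subset_convexHull ℝ _ ⟨j, h, rfl⟩⟩
  obtain ⟨c, b, -, rfl⟩ := hS
  exact eq_of_mem_convexHull_image h

theorem mem_realSpace_of_isFaceIndexSet_iff {d n : ℕ} {x y : Fin n → Fin d → ℝ}
    (hx : Function.Injective x) (h : ∀ S, IsFaceIndexSet x S ↔ IsFaceIndexSet y S) :
    y ∈ RealSpace d n x := by
  refine ⟨⟨⟨fun F => ⟨convexHull ℝ (y '' {j | x j ∈ F.1}),
      ((h _).1 F.2.isFaceIndexSet).isFaceOf⟩,
    fun F => ⟨convexHull ℝ (x '' {j | y j ∈ F.1}), ((h _).2 F.2.isFaceIndexSet).isFaceOf⟩,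
    fun F => ?_, fun F => ?_⟩, ?_⟩, ?_⟩
  · apply Subtype.ext
    simp only [((h _).1 F.2.isFaceIndexSet).mem_convexHull_iff]
    exact F.2.eq_convexHull.symm
  · apply Subtype.ext
    simp only [((h _).2 F.2.isFaceIndexSet).mem_convexHull_iff]
    exact F.2.eq_convexHull.symm
  · rintro F G
    constructor
    · intro hFG
      have hFG' : convexHull ℝ (y '' {j | x j ∈ F.1}) ⊆ convexHull ℝ (y '' {j | x j ∈ G.1}) := hFG
      have : {j | x j ∈ F.1} ⊆ {j | x j ∈ G.1} := fun j hj =>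
        (((h _).1 G.2.isFaceIndexSet).mem_convexHull_iff j).1
          (hFG' (subset_convexHull ℝ _ ⟨j, hj, rfl⟩))
      change F.1 ⊆ G.1
      rw [F.2.eq_convexHull, G.2.eq_convexHull]
      exact convexHull_mono (Set.image_mono this)
    · intro hFG
      have hFG' : F.1 ⊆ G.1 := hFG
      exact convexHull_mono (Set.image_mono fun j hj => hFG' hj)
  · rintro k F hF rfl
    simp [hx.eq_iff]

/-- Face index sets of a simple arrangement are determined by its vertex-facet incidences `I`. -/
theorem isFaceIndexSet_iff_of_incidence {n : ℕ} {ι : Type*} [Fintype ι] {y : Fin n → E}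
    {c : ι → Module.Dual ℝ E} {b : ι → ℝ} {I : ι → Fin n → Prop}
    (hle : ∀ i j, c i (y j) ≤ b i) (heq : ∀ i j, c i (y j) = b i ↔ I i j)
    (hspan : ∀ k (g : Module.Dual ℝ E),
      ∃ r : ι → ℝ, (∀ i, r i ≠ 0 → I i k) ∧ g = ∑ i, r i • c i)
    (hedge : ∀ k i, I i k → ∃ j, ¬ I i j ∧ ∀ i', I i' k → i' ≠ i → I i' j) (S : Set (Fin n)) :
    IsFaceIndexSet y S ↔
      S = ∅ ∨ ∃ k, ∃ T : Set ι, (∀ i ∈ T, I i k) ∧ S = {j | ∀ i ∈ T, I i j} := by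
  classical
  constructor
  · rintro ⟨g, β, hgle, rfl⟩
    rcases Set.eq_empty_or_nonempty {j | g (y j) = β} with h | ⟨k, hk⟩
    · exact Or.inl h
    right
    have hk : g (y k) = β := hk
    obtain ⟨r, hr, rfl⟩ := hspan k g
    have hdiff : ∀ j, (∑ i, r i • c i) (y j) - β = ∑ i, r i * (c i (y j) - b i) := by
      intro j
      rw [← hk]
      simp only [LinearMap.sum_apply, LinearMap.smul_apply, smul_eq_mul, ← Finset.sum_sub_distrib]
      refine Finset.sum_congr rfl fun i _ => ?_
      by_cases hi : r i = 0
      · simp [hi]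
      · rw [(heq i k).2 (hr i hi)]; ring
    have hnonneg : ∀ i, 0 ≤ r i := by
      intro i
      by_cases hi : r i = 0
      · exact hi.ge
      obtain ⟨j, hj, hj'⟩ := hedge k i (hr i hi)
      have h1 : ∑ i, r i * (c i (y j) - b i) = r i * (c i (y j) - b i) := by
        refine Finset.sum_eq_single i (fun i' _ hne => ?_) (by simp)
        by_cases hi' : r i' = 0
        · simp [hi']
        · rw [(heq i' j).2 (hj' i' (hr i' hi') hne)]; ring
      have h2 := hdiff j
      rw [h1] at h2
      have h3 := hgle j
      have h4 : c i (y j) - b i < 0 :=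
        sub_neg.2 (lt_of_le_of_ne (hle i j) fun h => hj ((heq i j).1 h))
      by_contra! hneg
      have := mul_pos_of_neg_of_neg hneg h4
      linarith
    refine ⟨k, {i | r i ≠ 0}, hr, ?_⟩
    ext j
    simp only [Set.mem_ofPred_eq]
    rw [← sub_eq_zero, hdiff j, Finset.sum_eq_zero_iff_of_nonpos fun i _ =>
      mul_nonpos_of_nonneg_of_nonpos (hnonneg i) (sub_nonpos.2 (hle i j))]
    simp only [Finset.mem_univ, true_imp_iff, mul_eq_zero, sub_eq_zero, heq]
    exact forall_congr' fun i => or_iff_not_imp_left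
  · rintro (rfl | ⟨k, T, hT, rfl⟩)
    · exact ⟨0, 1, by simp, by simp⟩
    · refine ⟨∑ i with i ∈ T, c i, ∑ i with i ∈ T, b i, fun j => ?_, ?_⟩
      · rw [LinearMap.sum_apply]
        exact Finset.sum_le_sum fun i _ => hle i j
      · ext j
        rw [Set.mem_ofPred_eq, Set.mem_ofPred_eq, LinearMap.sum_apply,
          Finset.sum_eq_sum_iff_of_le fun i _ => hle i j]
        simp [heq]

end Faces

section Perturbation

open Filter Topology Matrix

theorem eventually_continuousAt_inv_mulVec {T κ : Type*} [TopologicalSpace T] [Fintype κ]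
    [DecidableEq κ] {t₀ : T} {M : T → Matrix κ κ ℝ} {r : T → κ → ℝ}
    (hM : ∀ᶠ t in 𝓝 t₀, ContinuousAt M t) (hr : ∀ᶠ t in 𝓝 t₀, ContinuousAt r t)
    (h0 : IsUnit (M t₀).det) :
    ∀ᶠ t in 𝓝 t₀, ContinuousAt (fun t => (M t)⁻¹ *ᵥ r t) t ∧ IsUnit (M t).det := by
  have hdet : Continuous fun N : Matrix κ κ ℝ => N.det := continuous_id.matrix_det
  have hadj : Continuous fun N : Matrix κ κ ℝ => N.adjugate := continuous_id.matrix_adjugate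
  have hmul : Continuous fun p : Matrix κ κ ℝ × (κ → ℝ) => p.1 *ᵥ p.2 :=
    continuous_fst.matrix_mulVec continuous_snd
  have hne : ∀ᶠ t in 𝓝 t₀, (M t).det ≠ 0 :=
    (hdet.continuousAt.comp hM.self_of_nhds).eventually_ne h0.ne_zero
  filter_upwards [hM, hr, hne] with t h1 h2 h3
  refine ⟨?_, isUnit_iff_ne_zero.2 h3⟩
  have hinv : ContinuousAt (fun t => (M t)⁻¹) t := by
    simp only [Matrix.inv_def, Ring.inverse_eq_inv']
    exact ((hdet.continuousAt.comp h1).inv₀ h3).smul (hadj.continuousAt.comp h1)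
  exact hmul.continuousAt.comp (hinv.prodMk h2)

/-- Affinely independent points admit dual affine functions. -/
theorem AffineIndependent.exists_dual {d : ℕ} {κ : Type*} [Fintype κ] [DecidableEq κ]
    {u : κ → Fin d → ℝ} (hu : AffineIndependent ℝ u) :
    ∃ (l : κ → Fin d → ℝ) (β : κ → ℝ), ∀ a a', l a ⬝ᵥ u a' + β a = if a' = a then 1 else 0 := by
  have hli : LinearIndependent ℝ fun a => (u a, (1 : ℝ)) := by
    rw [linearIndependent_iff']
    intro s g hg
    refine affineIndependent_iff.1 hu s g ?_ ?_
    · simpa [Prod.snd_sum] using congrArg Prod.snd hg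
    · simpa [Prod.fst_sum] using congrArg Prod.fst hg
  obtain ⟨L, hL⟩ := LinearMap.exists_leftInverse_of_injective _ (LinearMap.ker_eq_bot.2 hli)
  have hL' : ∀ a, L (u a, 1) = Finsupp.single a 1 := fun a => by
    simpa using LinearMap.congr_fun hL (Finsupp.single a 1)
  refine ⟨fun a => (dotProductEquiv ℝ (Fin d)).symm
    (Finsupp.lapply a ∘ₗ L ∘ₗ LinearMap.inl ℝ _ _), fun a => L (0, 1) a, fun a a' => ?_⟩
  have h1 : ∀ g : Module.Dual ℝ (Fin d → ℝ), ∀ z,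
      (dotProductEquiv ℝ (Fin d)).symm g ⬝ᵥ z = g z := fun g z => by
    rw [← dotProductEquiv_apply_apply, LinearEquiv.apply_symm_apply]
  rw [h1]
  have h2 : L (u a', 0) + L (0, 1) = Finsupp.single a' 1 := by
    rw [← map_add, ← hL' a']; simp
  have h3 := DFunLike.congr_fun h2 a
  simpa [Finsupp.single_apply] using h3

/-- A hyperplane through affinely independent points can be moved continuously along with them. -/
theorem exists_continuous_hyperplane {T κ : Type*} [TopologicalSpace T] [Finite κ]
    {d : ℕ} {t₀ : T} {v : T → κ → Fin d → ℝ} (hv : Continuous v)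
    (hind : AffineIndependent ℝ (v t₀)) {c : Fin d → ℝ} {b : ℝ} (hc : ∀ a, c ⬝ᵥ v t₀ a = b) :
    ∃ (c' : T → Fin d → ℝ) (b' : T → ℝ), c' t₀ = c ∧ b' t₀ = b ∧
      ∀ᶠ t in 𝓝 t₀, ContinuousAt c' t ∧ ContinuousAt b' t ∧ ∀ a, c' t ⬝ᵥ v t a = b' t := by
  classical
  have := Fintype.ofFinite κ
  obtain ⟨l, β, hl⟩ := hind.exists_dual
  set M : T → Matrix κ κ ℝ := fun t => Matrix.of fun a' a => l a ⬝ᵥ v t a' + β a with hMdef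
  set r : T → κ → ℝ := fun t a' => b - c ⬝ᵥ v t a' with hrdef
  have hM : Continuous M := by
    refine continuous_matrix fun a' a => ?_
    simp only [hMdef, Matrix.of_apply]
    fun_prop
  have hr : Continuous r := by fun_prop
  have hM0 : M t₀ = 1 := by
    ext a' a
    simp [hMdef, hl, Matrix.one_apply]
  have hev := eventually_continuousAt_inv_mulVec (t₀ := t₀)
    (Eventually.of_forall fun t => hM.continuousAt (x := t))
    (Eventually.of_forall fun t => hr.continuousAt (x := t)) (by simp [hM0])
  have hr0 : r t₀ = 0 := by
    ext a
    simp [hrdef, hc]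
  set s : T → κ → ℝ := fun t => (M t)⁻¹ *ᵥ r t with hs
  refine ⟨fun t => c + ∑ a, s t a • l a, fun t => b - ∑ a, s t a * β a, ?_, ?_, ?_⟩
  · simp [hs, hr0]
  · simp [hs, hr0]
  · filter_upwards [hev] with t ht
    have hsa : ∀ a, ContinuousAt (fun t => s t a) t := continuousAt_pi.1 ht.1
    refine ⟨?_, ?_, fun a' => ?_⟩
    · fun_prop
    · fun_prop
    · have h1 : M t *ᵥ s t = r t := by
        rw [hs, Matrix.mulVec_mulVec, Matrix.mul_nonsing_inv _ ht.2, Matrix.one_mulVec]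
      have h2 := congrFun h1 a'
      simp only [hMdef, hrdef, Matrix.mulVec, dotProduct, Matrix.of_apply] at h2
      simp only [add_dotProduct, sum_dotProduct, smul_dotProduct, smul_eq_mul]
      have h3 : ∑ a, ((∑ q, l a q * v t a' q) + β a) * s t a =
          ∑ a, s t a * (l a ⬝ᵥ v t a') + ∑ a, s t a * β a := by
        rw [← Finset.sum_add_distrib]
        exact Finset.sum_congr rfl fun a _ => by simp only [dotProduct]; ring
      rw [h3] at h2
      change _ = b - c ⬝ᵥ v t a' at h2
      linarith

/-- Deforming a simple point-hyperplane arrangement by moving the points in `A` freely. -/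
theorem exists_deformation_s17 {d n : ℕ} {ι : Type*} [Finite ι] {x : Fin n → Fin d → ℝ}
    {c : ι → Fin d → ℝ} {b : ι → ℝ} {I : ι → Fin n → Prop}
    (hI : ∀ i k, I i k → c i ⬝ᵥ x k = b i) (A : Set (Fin n))
    (hA : ∀ i, AffineIndependent ℝ fun a : {k // k ∈ A ∧ I i k} => x a.1)
    (σ : ∀ k, Fin d ≃ {i // I i k})
    (hlin : ∀ k, LinearIndependent ℝ fun i : {i // I i k} => c i.1) :
    ∃ (y : (A → Fin d → ℝ) → Fin n → Fin d → ℝ) (c' : (A → Fin d → ℝ) → ι → Fin d → ℝ)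
      (b' : (A → Fin d → ℝ) → ι → ℝ), y 0 = x ∧ c' 0 = c ∧ b' 0 = b ∧
      ∀ᶠ t in 𝓝 0, ContinuousAt y t ∧ ContinuousAt c' t ∧ ContinuousAt b' t ∧
        (∀ i k, I i k → c' t i ⬝ᵥ y t k = b' t i) ∧ (∀ a : A, y t a.1 = x a.1 + t a) ∧
        ∀ k, LinearIndependent ℝ fun i : {i // I i k} => c' t i.1 := by
  classical
  have hfac : ∀ i, ∃ (c' : (A → Fin d → ℝ) → Fin d → ℝ) (b' : (A → Fin d → ℝ) → ℝ),
      c' 0 = c i ∧ b' 0 = b i ∧ ∀ᶠ t in 𝓝 0, ContinuousAt c' t ∧ ContinuousAt b' t ∧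
        ∀ a : {k // k ∈ A ∧ I i k}, c' t ⬝ᵥ (x a.1 + t ⟨a.1, a.2.1⟩) = b' t := fun i =>
    exists_continuous_hyperplane (t₀ := (0 : A → Fin d → ℝ))
      (v := fun t (a : {k // k ∈ A ∧ I i k}) => x a.1 + t ⟨a.1, a.2.1⟩) (by fun_prop)
      (by simpa using hA i) (fun a => by simpa using hI i a.1 a.2.2)
  choose c' b' hc0 hb0 hcb using hfac
  have hcb' := eventually_all.2 hcb
  set M : Fin n → (A → Fin d → ℝ) → Matrix (Fin d) (Fin d) ℝ :=
    fun k t => Matrix.of fun p => c' (σ k p).1 t with hMdef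
  set r : Fin n → (A → Fin d → ℝ) → Fin d → ℝ := fun k t p => b' (σ k p).1 t with hrdef
  have hunit : ∀ k, IsUnit (M k 0).det := by
    intro k
    rw [← Matrix.isUnit_iff_isUnit_det, ← Matrix.linearIndependent_rows_iff_isUnit]
    have h1 := (hlin k).comp (σ k) (σ k).injective
    have h2 : (M k 0).row = (fun i : {i // I i k} => c i.1) ∘ σ k := by
      funext p
      simp only [Matrix.row, hMdef, Function.comp, ← hc0]
      rfl
    rwa [h2]
  have hev : ∀ k, ∀ᶠ t in 𝓝 0,
      ContinuousAt (fun t => (M k t)⁻¹ *ᵥ r k t) t ∧ IsUnit (M k t).det := by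
    intro k
    refine eventually_continuousAt_inv_mulVec ?_ ?_ (hunit k)
    · filter_upwards [hcb'] with t ht
      exact continuousAt_pi.2 fun p => (ht (σ k p).1).1
    · filter_upwards [hcb'] with t ht
      exact continuousAt_pi.2 fun p => (ht (σ k p).1).2.1
  have hsol : ∀ k t z, IsUnit (M k t).det → (∀ i, I i k → c' i t ⬝ᵥ z = b' i t) →
      (M k t)⁻¹ *ᵥ r k t = z := by
    intro k t z hu hz
    have h1 : M k t *ᵥ z = r k t := by
      funext p
      exact hz (σ k p).1 (σ k p).2
    rw [← h1, Matrix.mulVec_mulVec, Matrix.nonsing_inv_mul _ hu, Matrix.one_mulVec]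
  refine ⟨fun t k => (M k t)⁻¹ *ᵥ r k t, fun t i => c' i t, fun t i => b' i t,
    funext fun k => hsol k 0 _ (hunit k) fun i hi => by rw [hc0, hb0]; exact hI i k hi,
    funext hc0, funext hb0, ?_⟩
  filter_upwards [eventually_all.2 hev, hcb'] with t h1 h2
  refine ⟨continuousAt_pi.2 fun k => (h1 k).1, continuousAt_pi.2 fun i => (h2 i).1,
    continuousAt_pi.2 fun i => (h2 i).2.1, fun i k hik => ?_, fun a => ?_, fun k => ?_⟩
  · have h3 : M k t *ᵥ ((M k t)⁻¹ *ᵥ r k t) = r k t := by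
      rw [Matrix.mulVec_mulVec, Matrix.mul_nonsing_inv _ (h1 k).2, Matrix.one_mulVec]
    have h4 := congrFun h3 ((σ k).symm ⟨i, hik⟩)
    simpa [hMdef, hrdef, Matrix.mulVec] using h4
  · exact hsol a.1 t _ (h1 a.1).2 fun i hi => (h2 i).2.2 ⟨a.1, a.2, hi⟩
  · have h3 := (h1 k).2
    rw [← Matrix.isUnit_iff_isUnit_det, ← Matrix.linearIndependent_rows_iff_isUnit] at h3
    have h4 := h3.comp (σ k).symm (σ k).symm.injective
    have h5 : (fun i : {i // I i k} => c' i.1 t) = (M k t).row ∘ (σ k).symm := by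
      funext i
      change c' i.1 t = c' (σ k ((σ k).symm i)).1 t
      rw [Equiv.apply_symm_apply]
    rwa [h5]

end Perturbation

section Facets

variable {E : Type*} [AddCommGroup E] [Module ℝ E]

theorem LinearIndependent.eq_zero_of_sum_subtype {ι : Type*} [Fintype ι] {p : ι → Prop}
    {c : ι → E} (h : LinearIndependent ℝ fun i : {i // p i} => c i.1) {r : ι → ℝ}
    (hr : ∀ i, r i ≠ 0 → p i) (hsum : ∑ i, r i • c i = 0) (i : ι) (hi : p i) : r i = 0 := by
  classical
  refine Fintype.linearIndependent_iff.1 h (fun i => r i.1) ?_ ⟨i, hi⟩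
  rw [← Finset.sum_subtype (Finset.univ.filter p) (by simp) fun i => r i • c i, ← hsum]
  exact Finset.sum_filter_of_ne fun i _ hne => hr i fun h => hne (by simp [h])

theorem LinearIndependent.exists_sum_subtype [FiniteDimensional ℝ E] {ι : Type*} [Fintype ι]
    {p : ι → Prop} {c : ι → E} (h : LinearIndependent ℝ fun i : {i // p i} => c i.1)
    (hcard : Nat.card {i // p i} = Module.finrank ℝ E) (g : E) :
    ∃ r : ι → ℝ, (∀ i, r i ≠ 0 → p i) ∧ g = ∑ i, r i • c i := by
  classical
  have hg : g ∈ Submodule.span ℝ (Set.range fun i : {i // p i} => c i.1) := by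
    rw [h.span_eq_top_of_card_eq_finrank' (by rw [← hcard, Nat.card_eq_fintype_card])]
    trivial
  obtain ⟨s, rfl⟩ := (Submodule.mem_span_range_iff_exists_fun ℝ).1 hg
  refine ⟨fun i => if hi : p i then s ⟨i, hi⟩ else 0, fun i hi => ?_, ?_⟩
  · by_contra hp
    simp [hp] at hi
  · rw [← Finset.sum_filter_of_ne (p := p) fun i _ hne => by
        by_contra hp
        simp [hp] at hne, Finset.sum_subtype (Finset.univ.filter p) (p := p) (by simp)]
    exact Finset.sum_congr rfl fun i _ => by simp [i.2]

theorem IsFaceOf.setDim_eq {n : ℕ} {x : Fin n → E} {F : Set E}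
    (hF : IsFaceOf F (convexHull ℝ (Set.range x))) {k : Fin n} (hk : x k ∈ F) :
    setDim F = Module.finrank ℝ
      (Submodule.span ℝ ((fun j => x j - x k) '' {j | x j ∈ F})) := by
  have hkS : x k ∈ x '' {j | x j ∈ F} := ⟨k, hk, rfl⟩
  rw [setDim, hF.eq_convexHull, affineSpan_convexHull, direction_affineSpan,
    vectorSpan_eq_span_vsub_set_right ℝ hkS, ← hF.eq_convexHull, Set.image_image]
  rfl

theorem span_sub_eq_top [FiniteDimensional ℝ E] {n : ℕ} {x : Fin n → E}
    (hdim : setDim (convexHull ℝ (Set.range x)) = Module.finrank ℝ E) (k : Fin n) :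
    Submodule.span ℝ (Set.range fun j => x j - x k) = ⊤ := by
  rw [setDim, affineSpan_convexHull, direction_affineSpan,
    vectorSpan_range_eq_span_range_vsub_right ℝ x k] at hdim
  exact Submodule.eq_top_of_finrank_eq hdim

theorem finite_facets {n : ℕ} (x : Fin n → E) :
    Finite {F // IsFacetOf F (convexHull ℝ (Set.range x))} := by
  refine Finite.of_injective
    (fun F : {F // IsFacetOf F (convexHull ℝ (Set.range x))} => {j | x j ∈ F.1})
    fun F G h => Subtype.ext ?_
  have hFG : {j | x j ∈ F.1} = {j | x j ∈ G.1} := h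
  rw [F.2.1.eq_convexHull, G.2.1.eq_convexHull, hFG]

/-- A functional maximal at a vertex is a nonnegative combination of the facet functionals
there. -/
theorem exists_nonneg_facet_combination [FiniteDimensional ℝ E] {n : ℕ} {x : Fin n → E}
    (hdim : setDim (convexHull ℝ (Set.range x)) = Module.finrank ℝ E)
    [Fintype {F // IsFacetOf F (convexHull ℝ (Set.range x))}]
    (c : {F // IsFacetOf F (convexHull ℝ (Set.range x))} → Module.Dual ℝ E)
    (b : {F // IsFacetOf F (convexHull ℝ (Set.range x))} → ℝ)
    (hle : ∀ i j, c i (x j) ≤ b i) (heq : ∀ i j, c i (x j) = b i ↔ x j ∈ i.1)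
    (k : Fin n) (g : Module.Dual ℝ E) (hg : ∀ j, g (x j) ≤ g (x k)) :
    ∃ r : {F // IsFacetOf F (convexHull ℝ (Set.range x))} → ℝ,
      (∀ i, 0 ≤ r i) ∧ (∀ i, r i ≠ 0 → x k ∈ i.1) ∧ g = ∑ i, r i • c i := by
  classical
  let K : PointedCone ℝ (Module.Dual ℝ E) :=
    { carrier := {g | ∃ r : {F // IsFacetOf F (convexHull ℝ (Set.range x))} → ℝ,
        (∀ i, 0 ≤ r i) ∧ (∀ i, r i ≠ 0 → x k ∈ i.1) ∧ g = ∑ i, r i • c i}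
      zero_mem' := ⟨0, by simp, by simp, by simp⟩
      add_mem' := by
        rintro _ _ ⟨r, hr, hrk, rfl⟩ ⟨s, hs, hsk, rfl⟩
        refine ⟨r + s, fun i => add_nonneg (hr i) (hs i), fun i hi => ?_, ?_⟩
        · by_cases h : r i = 0
          · exact hsk i fun h' => hi (by simp [h, h'])
          · exact hrk i h
        · simp [add_smul, Finset.sum_add_distrib]
      smul_mem' := by
        rintro ⟨a, ha⟩ _ ⟨r, hr, hrk, rfl⟩
        refine ⟨a • r, fun i => mul_nonneg ha (hr i), fun i hi => hrk i fun h => hi ?_, ?_⟩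
        · simp [h]
        · rw [Finset.smul_sum]
          refine Finset.sum_congr rfl fun i _ => ?_
          rw [Pi.smul_apply, smul_assoc]
          rfl }
  have hw := span_sub_eq_top hdim k
  refine mem_cone_of_nonpos _ hw K (fun g hg hfr => ?_) g fun j => by
    simpa [sub_nonpos] using hg j
  have hg' : ∀ j, g (x j) ≤ g (x k) := fun j => by simpa [sub_nonpos] using hg j
  have hmem : ∀ j, x j ∈ convexHull ℝ (Set.range x) := fun j => subset_convexHull ℝ _ ⟨j, rfl⟩
  have hface : IsFaceOf {z ∈ convexHull ℝ (Set.range x) | g z = g (x k)}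
      (convexHull ℝ (Set.range x)) :=
    ⟨fun z hz => hz.1, g, g (x k), fun z hz => le_of_mem_convexHull_range hg' hz, rfl⟩
  have hkF : x k ∈ {z ∈ convexHull ℝ (Set.range x) | g z = g (x k)} := ⟨hmem k, rfl⟩
  have hset : {j | x j ∈ {z ∈ convexHull ℝ (Set.range x) | g z = g (x k)}} =
      {j | g (x j - x k) = 0} := by
    ext j
    exact ⟨fun h => (map_sub g _ _).trans (sub_eq_zero.2 h.2),
      fun h => ⟨hmem j, sub_eq_zero.1 ((map_sub g _ _).symm.trans h)⟩⟩
  let i : {F // IsFacetOf F (convexHull ℝ (Set.range x))} :=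
    ⟨_, hface, ⟨_, hkF⟩, by rw [hface.setDim_eq hkF, hset, hfr, hdim]⟩
  have hck : c i (x k) = b i := (heq i k).2 hkF
  obtain ⟨r, hr, hgr⟩ := eq_smul_of_vanish_on_hyperplane (fun j => x j - x k) hw
    {j | g (x j - x k) = 0} hfr (c i) g
    (fun j => by simpa [hck] using hle i j) hg
    (fun j => by
      rw [map_sub, hck, sub_eq_zero, heq i j, ← hset]
      rfl) (fun j hj => hj)
  refine ⟨Pi.single i r, fun i' => ?_, fun i' hi' => ?_, ?_⟩
  · by_cases h : i' = i
    · subst h; simpa using hr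
    · simp [h]
  · by_cases h : i' = i
    · subst h; exact hkF
    · simp [h] at hi'
  · rw [Finset.sum_eq_single i (fun i' _ h => by simp [h]) (by simp)]
    simpa using hgr

/-- At a vertex, the functionals of the facets through it span the dual space. -/
theorem exists_facet_combination [FiniteDimensional ℝ E] {n : ℕ} {x : Fin n → E}
    (hx : Function.Injective x)
    (hdim : setDim (convexHull ℝ (Set.range x)) = Module.finrank ℝ E)
    [Fintype {F // IsFacetOf F (convexHull ℝ (Set.range x))}]
    (c : {F // IsFacetOf F (convexHull ℝ (Set.range x))} → Module.Dual ℝ E)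
    (b : {F // IsFacetOf F (convexHull ℝ (Set.range x))} → ℝ)
    (hle : ∀ i j, c i (x j) ≤ b i) (heq : ∀ i j, c i (x j) = b i ↔ x j ∈ i.1)
    (k : Fin n) (hk : IsVertexOf (x k) (convexHull ℝ (Set.range x))) (g : Module.Dual ℝ E) :
    ∃ r : {F // IsFacetOf F (convexHull ℝ (Set.range x))} → ℝ,
      (∀ i, r i ≠ 0 → x k ∈ i.1) ∧ g = ∑ i, r i • c i := by
  obtain ⟨-, c₀, b₀, hle₀, hF⟩ := hk
  have hmem : ∀ j, x j ∈ convexHull ℝ (Set.range x) := fun j => subset_convexHull ℝ _ ⟨j, rfl⟩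
  have hk₀ : c₀ (x k) = b₀ := by
    have : x k ∈ {z ∈ convexHull ℝ (Set.range x) | c₀ z = b₀} := hF ▸ rfl
    exact this.2
  have hlt : ∀ j, j ≠ k → c₀ (x j) < b₀ := fun j hj =>
    lt_of_le_of_ne (hle₀ _ (hmem j)) fun h => hj <| hx <| by
      have : x j ∈ ({x k} : Set E) := hF ▸ ⟨hmem j, h⟩
      exact this
  obtain ⟨N, -, hN⟩ := exists_mul_add_nonpos (fun j => c₀ (x j - x k)) (fun j => g (x j - x k))
    fun j => by
      by_cases hj : j = k
      · right; simp [hj]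
      · left; simpa [hk₀] using hlt j hj
  obtain ⟨r, -, hr, hrg⟩ := exists_nonneg_facet_combination hdim c b hle heq k c₀
    fun j => hk₀ ▸ hle₀ _ (hmem j)
  obtain ⟨s, -, hs, hsg⟩ := exists_nonneg_facet_combination hdim c b hle heq k (N • c₀ + g)
    fun j => by
      have := hN j
      simp only [map_sub] at this
      simp only [LinearMap.add_apply, LinearMap.smul_apply, smul_eq_mul]
      linarith
  refine ⟨fun i => s i - N * r i, fun i hi => ?_, ?_⟩
  · by_cases h : r i = 0
    · exact hs i fun h' => hi (by simp [h, h'])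
    · exact hr i h
  · have : g = (N • c₀ + g) - N • c₀ := by simp
    rw [this, hsg]
    nth_rw 1 [hrg]
    rw [Finset.smul_sum, ← Finset.sum_sub_distrib]
    exact Finset.sum_congr rfl fun i _ => by
      ext z
      simp only [LinearMap.sub_apply, LinearMap.smul_apply, smul_eq_mul]
      ring

/-- At a simple vertex the facet functionals are linearly independent. -/
theorem linearIndependent_facets [FiniteDimensional ℝ E] {n : ℕ} {x : Fin n → E}
    (hx : Function.Injective x)
    (hdim : setDim (convexHull ℝ (Set.range x)) = Module.finrank ℝ E)
    [Fintype {F // IsFacetOf F (convexHull ℝ (Set.range x))}]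
    (c : {F // IsFacetOf F (convexHull ℝ (Set.range x))} → Module.Dual ℝ E)
    (b : {F // IsFacetOf F (convexHull ℝ (Set.range x))} → ℝ)
    (hle : ∀ i j, c i (x j) ≤ b i) (heq : ∀ i j, c i (x j) = b i ↔ x j ∈ i.1)
    (k : Fin n) (hk : IsVertexOf (x k) (convexHull ℝ (Set.range x)))
    (hcard : Nat.card {i : {F // IsFacetOf F (convexHull ℝ (Set.range x))} // x k ∈ i.1} =
      Module.finrank ℝ E) :
    LinearIndependent ℝ
      fun i : {i : {F // IsFacetOf F (convexHull ℝ (Set.range x))} // x k ∈ i.1} => c i.1 := by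
  classical
  refine linearIndependent_of_top_le_span_of_card_eq_finrank (fun g _ => ?_) ?_
  · obtain ⟨r, hr, rfl⟩ := exists_facet_combination hx hdim c b hle heq k hk g
    refine Submodule.sum_mem _ fun i _ => ?_
    by_cases h : r i = 0
    · simp [h]
    · exact Submodule.smul_mem _ _ (Submodule.subset_span ⟨⟨i, hr i h⟩, rfl⟩)
  · rw [Subspace.dual_finrank_eq, ← hcard, Nat.card_eq_fintype_card]

/-- At a simple vertex, for each facet there is a neighbouring vertex leaving only that facet. -/
theorem exists_edge_leaving_facet [FiniteDimensional ℝ E] {n : ℕ} {x : Fin n → E}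
    (hdim : setDim (convexHull ℝ (Set.range x)) = Module.finrank ℝ E)
    [Fintype {F // IsFacetOf F (convexHull ℝ (Set.range x))}]
    (c : {F // IsFacetOf F (convexHull ℝ (Set.range x))} → Module.Dual ℝ E)
    (b : {F // IsFacetOf F (convexHull ℝ (Set.range x))} → ℝ)
    (hle : ∀ i j, c i (x j) ≤ b i) (heq : ∀ i j, c i (x j) = b i ↔ x j ∈ i.1) (k : Fin n)
    (hlin : LinearIndependent ℝ
      fun i : {i : {F // IsFacetOf F (convexHull ℝ (Set.range x))} // x k ∈ i.1} => c i.1)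
    (i : {F // IsFacetOf F (convexHull ℝ (Set.range x))}) (hi : x k ∈ i.1) :
    ∃ j, x j ∉ i.1 ∧ ∀ i' : {F // IsFacetOf F (convexHull ℝ (Set.range x))},
      x k ∈ i'.1 → i' ≠ i → x j ∈ i'.1 := by
  classical
  by_contra! hno
  set s : Finset {F // IsFacetOf F (convexHull ℝ (Set.range x))} :=
    Finset.univ.filter fun i' => x k ∈ i'.1 ∧ i' ≠ i with hs
  have hmem : ∀ i', i' ∈ s ↔ x k ∈ i'.1 ∧ i' ≠ i := fun i' => by simp [hs]
  have hle' : ∀ i' ∈ s, ∀ j, c i' (x j - x k) ≤ 0 := fun i' hi' j => by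
    rw [map_sub, (heq i' k).2 ((hmem i').1 hi').1]
    exact sub_nonpos.2 (hle i' j)
  obtain ⟨N, -, hN⟩ := exists_mul_add_nonpos (fun j => ∑ i' ∈ s, c i' (x j - x k))
    (fun j => -c i (x j - x k)) fun j => by
      by_cases hj : ∀ i' ∈ s, x j ∈ i'.1
      · right
        have hji : x j ∈ i.1 := by
          by_contra h
          obtain ⟨i', h1, h2, h3⟩ := hno j h
          exact h3 (hj i' ((hmem i').2 ⟨h1, h2⟩))
        refine ⟨Finset.sum_eq_zero fun i' hi' => ?_, ?_⟩
        · rw [map_sub, (heq i' k).2 ((hmem i').1 hi').1, (heq i' j).2 (hj i' hi'), sub_self]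
        · rw [map_sub, (heq i k).2 hi, (heq i j).2 hji]; simp
      · left
        push Not at hj
        obtain ⟨i', hi', hj'⟩ := hj
        refine Finset.sum_neg' (fun i' hi' => hle' i' hi' j) ⟨i', hi', ?_⟩
        refine lt_of_le_of_ne (hle' i' hi' j) fun h => hj' ((heq i' j).1 ?_)
        rw [map_sub, (heq i' k).2 ((hmem i').1 hi').1] at h
        linarith
  obtain ⟨r, hr, hrk, hrg⟩ := exists_nonneg_facet_combination hdim c b hle heq k
    (N • ∑ i' ∈ s, c i' - c i) fun j => by
      have := hN j
      simp only [map_sub, Finset.sum_sub_distrib] at this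
      simp only [LinearMap.sub_apply, LinearMap.smul_apply, LinearMap.sum_apply, smul_eq_mul]
      linarith
  have hzero : ∑ i', (r i' - (if i' ∈ s then N else 0) + if i' = i then 1 else 0) • c i' = 0 := by
    simp only [add_smul, sub_smul, Finset.sum_add_distrib, Finset.sum_sub_distrib, ite_smul,
      zero_smul, one_smul, Finset.sum_ite_mem, Finset.univ_inter, Finset.sum_ite_eq',
      Finset.mem_univ, if_true, ← hrg, ← Finset.smul_sum]
    abel
  have h := hlin.eq_zero_of_sum_subtype (fun i' hi' => ?_) hzero i hi
  · rw [if_neg (by simp [hmem]), if_pos rfl] at h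
    linarith [hr i]
  · by_contra hk
    refine hi' ?_
    have h1 : r i' = 0 := by_contra fun h => hk (hrk i' h)
    rw [if_neg fun h => hk ((hmem i').1 h).1, if_neg fun h : i' = i => hk (h ▸ hi), h1]
    simp

end Facets

/-- Let `P ⊂ ℝ^d` be a simple polytope with vertex set `V` and let
`A ⊆ V` be an affine support set of `P` (in every realization of `P`, the vertices of
`A` lying on any facet are affinely independent).  Then the number of moduli of `P`
(the local dimension of the realization space of `P` near the given realization) is at
least `d·|A|`. -/
theorem affine_support_set_moduli_lower_bound
    (d n : ℕ) (x : Fin n → Fin d → ℝ) (hx : Function.Injective x)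
    (P : Set (Fin d → ℝ)) (hP : P = convexHull ℝ (Set.range x))
    (hvert : {v | IsVertexOf v P} = Set.range x)
    (hdim : setDim P = d)
    (hsimple : IsSimplePoly P)
    (A : Set (Fin n))
    -- `A` is an affine support set of `P`:
    (hA : ∀ y ∈ RealSpace d n x, ∀ G, IsFacetOf G (convexHull ℝ (Set.range y)) →
      AffineIndependent ℝ (fun a : {k : Fin n // k ∈ A ∧ y k ∈ G} => y a.1)) :
    -- the realization space has local dimension at least `d·|A|` at `x`:
    ∃ δ > (0 : ℝ), ∃ f : (Fin (d * A.ncard) → ℝ) → (Fin n → Fin d → ℝ),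
      ContinuousOn f (Metric.ball 0 δ) ∧ Set.InjOn f (Metric.ball 0 δ) ∧
      f 0 = x ∧ Set.MapsTo f (Metric.ball 0 δ) (RealSpace d n x) := by
  classical
  subst hP
  have hdim' : setDim (convexHull ℝ (Set.range x)) = Module.finrank ℝ (Fin d → ℝ) := by
    rw [hdim, Module.finrank_fin_fun]
  have hmem : ∀ j, x j ∈ convexHull ℝ (Set.range x) := fun j => subset_convexHull ℝ _ ⟨j, rfl⟩
  have hvtx : ∀ k, IsVertexOf (x k) (convexHull ℝ (Set.range x)) := fun k => by
    have : x k ∈ {v | IsVertexOf v (convexHull ℝ (Set.range x))} := by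
      rw [hvert]
      exact ⟨k, rfl⟩
    exact this
  have := finite_facets x
  have := Fintype.ofFinite {F // IsFacetOf F (convexHull ℝ (Set.range x))}
  have hcard : ∀ k, Nat.card {i : {F // IsFacetOf F (convexHull ℝ (Set.range x))} // x k ∈ i.1} =
      d := fun k => by
    rw [Nat.card_congr (Equiv.subtypeSubtypeEquivSubtypeInter _ fun F => x k ∈ F)]
    exact (hsimple _ (hvtx k)).trans hdim
  have hfun : ∀ i : {F // IsFacetOf F (convexHull ℝ (Set.range x))},
      ∃ (c : Module.Dual ℝ (Fin d → ℝ)) (b : ℝ), ∀ j, c (x j) ≤ b ∧ (c (x j) = b ↔ x j ∈ i.1) := by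
    rintro ⟨F, hF⟩
    obtain ⟨⟨-, c, b, hle, rfl⟩, -⟩ := id hF
    exact ⟨c, b, fun j => ⟨hle _ (hmem j), fun h => ⟨hmem j, h⟩, fun h => h.2⟩⟩
  choose c b hcb using hfun
  have hle := fun i j => (hcb i j).1
  have heq := fun i j => (hcb i j).2
  have hlin := fun k => linearIndependent_facets hx hdim' c b hle heq k (hvtx k)
    (by rw [hcard k, Module.finrank_fin_fun])
  have hedge := fun k => exists_edge_leaving_facet hdim' c b hle heq k (hlin k)
  let D := dotProductEquiv ℝ (Fin d)
  have hD : ∀ i z, D.symm (c i) ⬝ᵥ z = c i z := fun i z => by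
    rw [← dotProductEquiv_apply_apply, LinearEquiv.apply_symm_apply]
  obtain ⟨y, c', b', hy0, hc0, hb0, hev⟩ := exists_deformation_s17 (x := x)
    (c := fun i => D.symm (c i)) (b := b) (I := fun i k => x k ∈ i.1)
    (fun i k h => (hD i _).trans ((heq i k).2 h)) A
    (fun i => hA x (mem_realSpace_of_isFaceIndexSet_iff hx fun _ => Iff.rfl) i.1 i.2)
    (fun k => (Finite.equivFinOfCardEq (hcard k)).symm)
    (fun k => (hlin k).map' D.symm.toLinearMap D.symm.ker)
  have hstrict : ∀ i j, x j ∉ i.1 → ∀ᶠ t in nhds 0, c' t i ⬝ᵥ y t j < b' t i := by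
    intro i j hij
    obtain ⟨h1, h2, h3, -⟩ := hev.self_of_nhds
    have h1' := continuousAt_pi.1 h1 j
    have h2' := continuousAt_pi.1 h2 i
    have h3' := continuousAt_pi.1 h3 i
    have hdot : Continuous fun p : (Fin d → ℝ) × (Fin d → ℝ) => p.1 ⬝ᵥ p.2 := by fun_prop
    refine (hdot.continuousAt.comp (h2'.prodMk h1')).eventually_lt h3' ?_
    simp only [Function.comp, hy0, hc0, hb0, hD]
    exact lt_of_le_of_ne (hle i j) fun h => hij ((heq i j).1 h)
  have hstrict' : ∀ᶠ t in nhds 0, ∀ i j, x j ∉ i.1 → c' t i ⬝ᵥ y t j < b' t i := by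
    simp only [Filter.eventually_all]
    exact hstrict
  have hreal : ∀ᶠ t in nhds 0, ContinuousAt y t ∧ (∀ a : A, y t a.1 = x a.1 + t a) ∧
      y t ∈ RealSpace d n x := by
    filter_upwards [hev, hstrict'] with t ht hlt
    obtain ⟨hcont, -, -, hinc, hmove, hind⟩ := ht
    refine ⟨hcont, hmove, mem_realSpace_of_isFaceIndexSet_iff hx fun S => ?_⟩
    rw [isFaceIndexSet_iff_of_incidence hle heq
      (fun k g => exists_facet_combination hx hdim' c b hle heq k (hvtx k) g) hedge]
    refine (isFaceIndexSet_iff_of_incidence (c := fun i => D (c' t i)) (b := b' t)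
      (fun i j => ?_) (fun i j => ?_) (fun k g => ?_) hedge S).symm
    · by_cases h : x j ∈ i.1
      · exact (hinc i j h).le
      · exact (hlt i j h).le
    · exact ⟨fun h => by_contra fun h' => (hlt i j h').ne h, hinc i j⟩
    · have hindD : LinearIndependent ℝ
          fun i : {i : {F // IsFacetOf F (convexHull ℝ (Set.range x))} // x k ∈ i.1} =>
            D (c' t i.1) := (hind k).map' D.toLinearMap D.ker
      exact LinearIndependent.exists_sum_subtype (p := fun i => x k ∈ i.1)
        (c := fun i => D (c' t i)) hindD
        (by rw [hcard k, Subspace.dual_finrank_eq, Module.finrank_fin_fun]) g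
  have hcardA : Nat.card (A × Fin d) = d * A.ncard := by
    rw [Nat.card_prod, Nat.card_fin, mul_comm]
    rfl
  let e := Finite.equivFinOfCardEq hcardA
  let Φ : (Fin (d * A.ncard) → ℝ) → A → Fin d → ℝ := fun s a q => s (e (a, q))
  have hΦ : Continuous Φ := by fun_prop
  have hΦev := (hΦ.tendsto' 0 0 rfl).eventually hreal
  obtain ⟨δ, hδ, hball⟩ := Metric.eventually_nhds_iff_ball.1 hΦev
  refine ⟨δ, hδ, y ∘ Φ, fun s hs => ?_, fun s hs s' hs' h => ?_, hy0, fun s hs => (hball s hs).2.2⟩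
  · exact ((hball s hs).1.comp hΦ.continuousAt).continuousWithinAt
  · funext m
    have h1 := congrFun (congrFun h (e.symm m).1.1) (e.symm m).2
    simp only [Function.comp, (hball s hs).2.1, (hball s' hs').2.1, Pi.add_apply,
      add_right_inj] at h1
    simpa [Φ] using h1
end
end
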